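/- Let m_1, …, m_k be integers with each m_i ≥ 2, with m_1 ∉ {4, 6}, and suppose that for every ℓ with 1 ≤ ℓ < k one has m_{ℓ+1} − δ(m_{ℓ+1}) > Σ_{i=1}^{ℓ} (m_i + δ(m_i)). Then OP*(m_1, …, m_k) has a solution. -/

import Mathlib

/-- A solution to the directed Oberwolfach problem OP*(m₁, …, m_k). -/
def HasOPSolution (m : List ℕ) : Prop :=
  ∃ σ : Fin (m.sum - 1) → Equiv.Perm (Fin m.sum),
    (∀ i, (σ i).cycleType = (m : Multiset ℕ)) ∧
    ∀ x y : Fin m.sum, x ≠ y → ∃! i, σ i x = y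

/-- δ(m) = 0 if m is even, 1 if m is odd. -/
def deltaOdd (m : ℕ) : ℕ := m % 2

/-- The lists `bs` partition `V`, and `σ` moves each entry of each list cyclically to the next. -/
def Realizes {V : Type*} (σ : V → V) (bs : List (List V)) : Prop :=
  bs.flatten.Nodup ∧ (∀ x, x ∈ bs.flatten) ∧ ∀ B ∈ bs, B.map σ = B.rotate 1

/-- `σ` is a single cycle through all of `V`. -/
def FullCycle {V : Type*} (σ : V → V) : Prop :=
  ∃ B : List V, B.Nodup ∧ (∀ x, x ∈ B) ∧ B.map σ = B.rotate 1

/-- A decomposition of the complete symmetric digraph in terms of partitions into lists,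
over arbitrary finite index types; covering every arc is enough. -/
def Sol (m : List ℕ) : Prop :=
  ∃ (V ι : Type) (_ : Fintype V) (_ : Fintype ι) (σ : ι → V → V),
    Fintype.card V = m.sum ∧ Fintype.card ι + 1 = m.sum ∧
    (∀ i, ∃ bs : List (List V), bs.map List.length = m ∧ Realizes (σ i) bs) ∧
    ∀ x y : V, x ≠ y → ∃ i, σ i x = y

/-- The arcs of the relation `P` are covered by `k` directed Hamiltonian cycles. -/
def Cov {V : Type*} (P : V → V → Prop) (k : ℕ) : Prop :=
  ∃ hs : List (V → V), hs.length = k ∧ (∀ h ∈ hs, FullCycle h) ∧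
    ∀ x y, P x y → ∃ h ∈ hs, h x = y

section Lists

variable {V W : Type*}

lemma map_formPerm_eq_rotate [DecidableEq V] {B : List V} (hB : B.Nodup) :
    B.map B.formPerm = B.rotate 1 := by
  apply List.ext_getElem
  · simp
  · intro i h1 h2
    simp only [List.getElem_map, List.getElem_rotate]
    rw [List.formPerm_apply_getElem _ hB]

lemma prod_formPerm_spec [DecidableEq V] (bs : List (List V)) (h : bs.flatten.Nodup) :
    (∀ x, x ∉ bs.flatten → (bs.map List.formPerm).prod x = x) ∧
    ∀ B ∈ bs, B.map (bs.map List.formPerm).prod = B.rotate 1 := by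
  induction bs with
  | nil => simp
  | cons A bs ih =>
    rw [List.flatten_cons, List.nodup_append'] at h
    obtain ⟨hA, hbs, hd⟩ := h
    obtain ⟨ih1, ih2⟩ := ih hbs
    refine ⟨?_, ?_⟩
    · intro x hx
      rw [List.flatten_cons, List.mem_append, not_or] at hx
      rw [List.map_cons, List.prod_cons, Equiv.Perm.mul_apply, ih1 x hx.2,
        List.formPerm_apply_of_notMem hx.1]
    · intro B hB
      rw [List.mem_cons] at hB
      rcases hB with rfl | hB
      · rw [← map_formPerm_eq_rotate hA]
        apply List.map_congr_left
        intro x hx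
        rw [List.map_cons, List.prod_cons, Equiv.Perm.mul_apply, ih1 x (hd hx)]
      · rw [← ih2 B hB]
        apply List.map_congr_left
        intro x hx
        rw [List.map_cons, List.prod_cons, Equiv.Perm.mul_apply]
        apply List.formPerm_apply_of_notMem
        intro hx'
        have h1 : (bs.map List.formPerm).prod x ∈ B.rotate 1 := by
          rw [← ih2 B hB]; exact List.mem_map_of_mem hx
        rw [List.mem_rotate] at h1
        exact hd hx' (List.mem_flatten.2 ⟨B, hB, h1⟩)

lemma exists_realizes (bs : List (List V)) (h : bs.flatten.Nodup)
    (hc : ∀ x, x ∈ bs.flatten) : ∃ σ, Realizes σ bs := by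
  classical
  exact ⟨(bs.map List.formPerm).prod, h, hc, (prod_formPerm_spec bs h).2⟩

lemma exists_perm_of_realizes [Fintype V] [DecidableEq V] {σ : V → V} {bs : List (List V)}
    (h : Realizes σ bs) (h2 : ∀ B ∈ bs, 2 ≤ B.length) :
    ∃ π : Equiv.Perm V, ⇑π = σ ∧ π.cycleType = (bs.map List.length : Multiset ℕ) := by
  obtain ⟨hn, hc, hr⟩ := h
  have hs := prod_formPerm_spec bs hn
  have hB : ∀ B ∈ bs, B.Nodup := fun B hB => (List.nodup_flatten.1 hn).1 B hB
  refine ⟨(bs.map List.formPerm).prod, ?_, ?_⟩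
  · funext x
    obtain ⟨B, hB, hx⟩ := List.mem_flatten.1 (hc x)
    have := (hs.2 B hB).trans (hr B hB).symm
    exact List.map_inj_left.1 this x hx
  · rw [Equiv.Perm.cycleType_eq (bs.map List.formPerm) rfl, List.map_map]
    · congr 1
      apply List.map_congr_left
      intro B hb
      simp only [Function.comp]
      rw [List.support_formPerm_of_nodup _ (hB B hb), List.toFinset_card_of_nodup (hB B hb)]
      rintro x rfl
      have := h2 _ hb
      simp at this
    · simp only [List.mem_map]
      rintro _ ⟨B, hb, rfl⟩
      exact List.isCycle_formPerm (hB B hb) (h2 B hb)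
    · rw [List.pairwise_map]
      refine List.Pairwise.imp_of_mem ?_ (List.nodup_flatten.1 hn).2
      intro A B hA hb hd
      exact (List.formPerm_disjoint_iff (hB A hA) (hB B hb) (h2 A hA) (h2 B hb)).2 hd

lemma Realizes.conj {σ : V → V} {bs : List (List V)} (h : Realizes σ bs) (e : V ≃ W) :
    Realizes (fun w => e (σ (e.symm w))) (bs.map (List.map e)) := by
  obtain ⟨h1, h2, h3⟩ := h
  rw [Realizes, ← List.map_flatten]
  refine ⟨h1.map e.injective, fun x => ?_, fun B hB => ?_⟩
  · rw [List.mem_map]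
    exact ⟨e.symm x, h2 _, by simp⟩
  · obtain ⟨A, hA, rfl⟩ := List.mem_map.1 hB
    rw [← List.map_rotate, ← h3 A hA]
    simp

lemma FullCycle.conj {σ : V → V} (h : FullCycle σ) (e : V ≃ W) :
    FullCycle (fun w => e (σ (e.symm w))) := by
  obtain ⟨B, h1, h2, h3⟩ := h
  refine ⟨B.map e, h1.map e.injective, fun x => ?_, ?_⟩
  · rw [List.mem_map]
    exact ⟨e.symm x, h2 _, by simp⟩
  · rw [← List.map_rotate, ← h3]
    simp

end Lists

theorem Sol.hasOPSolution {m : List ℕ} (h2 : ∀ x ∈ m, 2 ≤ x) (h : Sol m) : HasOPSolution m := by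
  classical
  obtain ⟨V, ι, _, _, σ, hV, hι, hσ, hcov⟩ := h
  have hι' : Fintype.card ι = m.sum - 1 := by omega
  let eV := Fintype.equivFinOfCardEq hV
  let eI := Fintype.equivFinOfCardEq hι'
  have key : ∀ i, ∃ π : Equiv.Perm (Fin m.sum), (∀ x, π x = eV (σ (eI.symm i) (eV.symm x))) ∧
      π.cycleType = (m : Multiset ℕ) := by
    intro i
    obtain ⟨bs, hbs, hr⟩ := hσ (eI.symm i)
    have hl : (bs.map (List.map eV)).map List.length = m := by
      refine Eq.trans ?_ hbs
      rw [List.map_map]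
      congr 1
      funext B
      simp
    obtain ⟨π, h1, h2⟩ := exists_perm_of_realizes (hr.conj eV) (by
      
      intro B hB
      have := List.mem_map_of_mem (f := List.length) hB
      rw [hl] at this
      exact h2 _ this)
    exact ⟨π, fun x => by rw [h1], by rw [h2, hl]⟩
  choose π hπ1 hπ2 using key
  have hfix : ∀ i x, π i x ≠ x := by
    intro i x hx
    have h1 : (π i).support.card = Fintype.card (Fin m.sum) := by
      rw [← Equiv.Perm.sum_cycleType, hπ2]; simp
    have h3 : x ∈ (π i).support := by rw [Finset.card_eq_iff_eq_univ _ |>.1 h1]; simp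
    exact (Equiv.Perm.mem_support.1 h3) hx
  have hex : ∀ x y, x ≠ y → ∃ i, π i x = y := by
    intro x y hxy
    obtain ⟨i, hi⟩ := hcov (eV.symm x) (eV.symm y) (by simpa using hxy)
    exact ⟨eI i, by simp [hπ1, hi]⟩
  refine ⟨π, hπ2, fun x y hxy => ?_⟩
  have hinj : Function.Injective (fun i => (⟨π i x, hfix i x⟩ : {y // y ≠ x})) := by
    refine ((Fintype.bijective_iff_surjective_and_card _).2 ⟨?_, ?_⟩).1
    · rintro ⟨y, hy⟩
      obtain ⟨i, hi⟩ := hex x y (Ne.symm hy)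
      exact ⟨i, by simp [hi]⟩
    · rw [Fintype.card_subtype_compl, Fintype.card_subtype_eq]
      simp
  obtain ⟨i, hi⟩ := hex x y hxy
  refine ⟨i, hi, fun j hj => hinj ?_⟩
  ext
  simp only [hi, hj]

section Covers

variable {V W : Type*}

lemma Cov.mono {P Q : V → V → Prop} {k : ℕ} (h : Cov P k) (hQ : ∀ x y, Q x y → P x y) :
    Cov Q k := by
  obtain ⟨hs, h1, h2, h3⟩ := h
  exact ⟨hs, h1, h2, fun x y hxy => h3 x y (hQ x y hxy)⟩

lemma Cov.append {P Q : V → V → Prop} {k l : ℕ} (hP : Cov P k) (hQ : Cov Q l) :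
    Cov (fun x y => P x y ∨ Q x y) (k + l) := by
  obtain ⟨hs, h1, h2, h3⟩ := hP
  obtain ⟨gs, g1, g2, g3⟩ := hQ
  refine ⟨hs ++ gs, by simp [h1, g1], ?_, ?_⟩
  · intro h hh
    rcases List.mem_append.1 hh with hh | hh
    exacts [h2 h hh, g2 h hh]
  · rintro x y (hxy | hxy)
    · obtain ⟨h, hh, e⟩ := h3 x y hxy
      exact ⟨h, List.mem_append_left _ hh, e⟩
    · obtain ⟨h, hh, e⟩ := g3 x y hxy
      exact ⟨h, List.mem_append_right _ hh, e⟩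

lemma Cov.nil : Cov (fun _ _ : V => False) 0 := ⟨[], rfl, by simp, by simp⟩

lemma Cov.comap {P : W → W → Prop} {k : ℕ} (h : Cov P k) (e : V ≃ W) :
    Cov (fun x y => P (e x) (e y)) k := by
  obtain ⟨hs, h1, h2, h3⟩ := h
  refine ⟨hs.map (fun f v => e.symm (f (e v))), by simpa using h1, ?_, ?_⟩
  · intro f hf
    obtain ⟨g, hg, rfl⟩ := List.mem_map.1 hf
    simpa using (h2 g hg).conj e.symm
  · intro x y hxy
    obtain ⟨g, hg, he⟩ := h3 _ _ hxy
    exact ⟨_, List.mem_map_of_mem hg, by simp [he]⟩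

lemma Cov.single {f : V → V} (hf : FullCycle f) : Cov (fun x y => f x = y) 1 :=
  ⟨[f], rfl, by simpa using hf, by simp⟩

lemma fullCycle_of_orbit [Finite V] {f : V → V} (hf : Function.Injective f) (x : V)
    (h : ∀ y, ∃ n, f^[n] x = y) : FullCycle f := by
  have hx : x ∈ Function.periodicPts f := Function.Injective.mem_periodicPts hf x
  have hpos := Function.minimalPeriod_pos_of_mem_periodicPts hx
  set p := Function.minimalPeriod f x with hp
  refine ⟨(List.range p).map (fun n => f^[n] x), ?_, ?_, ?_⟩
  · refine List.Nodup.map_on ?_ List.nodup_range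
    intro i hi j hj hij
    exact Function.iterate_injOn_Iio_minimalPeriod (by simpa using hi) (by simpa using hj) hij
  · intro y
    obtain ⟨n, rfl⟩ := h y
    rw [List.mem_map]
    exact ⟨n % p, by simpa using Nat.mod_lt _ hpos, Function.iterate_mod_minimalPeriod_eq⟩
  · apply List.ext_getElem
    · simp
    · intro i h1 h2
      simp only [List.map_map, List.getElem_map, List.getElem_range, List.getElem_rotate,
        Function.comp, List.length_map, List.length_range]
      rw [hp, Function.iterate_mod_minimalPeriod_eq, Function.iterate_succ_apply']

lemma fullCycle_add_isUnit {n : ℕ} [NeZero n] {u : ZMod n} (hu : IsUnit u) :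
    FullCycle (fun x : ZMod n => x + u) := by
  refine fullCycle_of_orbit (add_left_injective u) 0 fun y => ?_
  obtain ⟨v, hv⟩ := hu.exists_left_inv
  refine ⟨(y * v).val, ?_⟩
  have : ∀ n : ℕ, (fun x => x + u)^[n] 0 = n * u := by
    intro n
    induction n with
    | zero => simp
    | succ k ih => rw [Function.iterate_succ_apply', ih]; push_cast; ring
  rw [this, ZMod.natCast_zmod_val, mul_assoc, hv, mul_one]

lemma cov_isUnit {n : ℕ} [NeZero n] {u : ZMod n} (hu : IsUnit u) :
    Cov (fun x y => y = x + u) 1 :=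
  (Cov.single (fullCycle_add_isUnit hu)).mono fun _ _ h => h.symm

end Covers

section Starter

variable {S T : Type*}

lemma map_expand_aux (τ : T → T) (lab : T → Option S) (σ : S ⊕ T → S ⊕ T)
    (h1 : ∀ x, lab x = none → σ (.inr x) = .inr (τ x))
    (h2 : ∀ x e, lab x = some e → σ (.inr x) = .inl e ∧ σ (.inl e) = .inr (τ x))
    (xs : List T) : ∀ (x y : T), (x :: xs).map τ = xs ++ [y] →
    ((x :: xs).flatMap fun z => .inr z :: ((lab z).map Sum.inl).toList).map σ =
      ((lab x).map Sum.inl).toList ++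
        (xs.flatMap fun z => .inr z :: ((lab z).map Sum.inl).toList) ++ [.inr y] := by
  have hone : ∀ x, (Sum.inr x :: ((lab x).map Sum.inl).toList).map σ =
      ((lab x).map Sum.inl).toList ++ [.inr (τ x)] := by
    intro x
    rcases hx : lab x with _ | e
    · simp [h1 x hx]
    · simp [h2 x e hx]
  induction xs with
  | nil =>
    intro x y h
    simp only [List.map_cons, List.map_nil, List.nil_append, List.cons.injEq, and_true] at h
    subst h
    simpa using hone x
  | cons z xs ih =>
    intro x y h
    simp only [List.map_cons, List.cons_append, List.cons.injEq] at h
    have := ih z y (by simpa using h.2)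
    rw [List.flatMap_cons, List.map_append, this, hone, h.1]
    simp

/-- The successor function on `T`, interrupted by the points of `S` sitting after their labels. -/
lemma exists_expand [DecidableEq T] [Fintype S] (bs : List (List T)) (hn : bs.flatten.Nodup)
    (hc : ∀ x, x ∈ bs.flatten) (E : Finset T) (hE : E.card = Fintype.card S) :
    ∃ (σ : S ⊕ T → S ⊕ T) (τ : T → T) (bs' : List (List (S ⊕ T))),
      Realizes τ bs ∧ Realizes σ bs' ∧
      bs'.map List.length = bs.map (fun B => B.length + B.countP (· ∈ E)) ∧
      (∀ e, ∃ x, σ (.inl e) = .inr x) ∧ (∀ e, ∃ x, σ (.inr x) = .inl e) ∧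
      (∀ x, x ∉ E → σ (.inr x) = .inr (τ x)) := by
  classical
  obtain ⟨τ, hτ⟩ := exists_realizes bs hn hc
  have eq : {x // x ∈ E} ≃ S := Fintype.equivOfCardEq (by simpa using hE)
  let lab : T → Option S := fun x => if h : x ∈ E then some (eq ⟨x, h⟩) else none
  let σ : S ⊕ T → S ⊕ T := Sum.elim (fun e => .inr (τ (eq.symm e)))
    (fun x => if h : x ∈ E then .inl (eq ⟨x, h⟩) else .inr (τ x))
  have lab_mem : ∀ x (h : x ∈ E), lab x = some (eq ⟨x, h⟩) := fun x h => by simp [lab, h]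
  have lab_not : ∀ x, x ∉ E → lab x = none := fun x h => by simp [lab, h]
  have lab_some : ∀ x e, lab x = some e → x = eq.symm e := by
    intro x e h
    by_cases hx : x ∈ E
    · rw [lab_mem x hx, Option.some.injEq] at h
      rw [← h]; simp
    · rw [lab_not x hx] at h; simp at h
  have lab_symm : ∀ e, lab (eq.symm e) = some e := by
    intro e
    rw [lab_mem _ (eq.symm e).2]; simp
  let ex : T → List (S ⊕ T) := fun z => .inr z :: ((lab z).map Sum.inl).toList
  refine ⟨σ, τ, bs.map (List.flatMap ex), hτ, ⟨?_, ?_, ?_⟩, ?_, ?_, ?_, ?_⟩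
  · have hfl : (bs.map (List.flatMap ex)).flatten = bs.flatten.flatMap ex := by
      clear hτ hc hn
      induction bs with
      | nil => simp
      | cons B bs ih => simp [ih]
    rw [hfl, List.nodup_flatMap]
    refine ⟨fun x _ => ?_, hn.imp fun {x y} hxy => ?_⟩
    · rcases hx : lab x with _ | e <;> simp [ex, hx]
    · rintro (e | z) h1 h2
      · have h1' : lab x = some e := by simpa [ex] using h1
        have h2' : lab y = some e := by simpa [ex] using h2
        exact hxy ((lab_some x e h1').trans (lab_some y e h2').symm)
      · have h1' : z = x := by simpa [ex] using h1
        have h2' : z = y := by simpa [ex] using h2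
        exact hxy (h1'.symm.trans h2')
  · rintro (e | x)
    · obtain ⟨B, hB, hx⟩ := List.mem_flatten.1 (hc (eq.symm e : T))
      refine List.mem_flatten.2 ⟨_, List.mem_map_of_mem hB, List.mem_flatMap.2 ⟨_, hx, ?_⟩⟩
      simp [ex, lab_symm]
    · obtain ⟨B, hB, hx⟩ := List.mem_flatten.1 (hc x)
      refine List.mem_flatten.2 ⟨_, List.mem_map_of_mem hB, List.mem_flatMap.2 ⟨_, hx, ?_⟩⟩
      simp [ex]
  · intro B' hB'
    obtain ⟨B, hB, rfl⟩ := List.mem_map.1 hB'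
    rcases B with _ | ⟨x, xs⟩
    · simp
    · have := map_expand_aux τ lab σ (fun x hx => ?_) (fun x e hx => ?_) xs x x
        (by simpa using hτ.2.2 _ hB)
      · rw [this, List.flatMap_cons]
        simp [ex]
      · have : x ∉ E := fun h => by rw [lab_mem x h] at hx; simp at hx
        simp [σ, this]
      · have h := lab_some x e hx
        subst h
        simp [σ]
  · rw [List.map_map]
    apply List.map_congr_left
    intro B hB
    clear hB
    simp only [Function.comp]
    induction B with
    | nil => simp
    | cons x xs ih =>
      rw [List.flatMap_cons, List.length_append, ih, List.countP_cons]
      by_cases hx : x ∈ E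
      · simp [ex, lab_mem x hx, hx]; omega
      · simp [ex, lab_not x hx, hx]; omega
  · intro e; exact ⟨_, rfl⟩
  · intro e; exact ⟨eq.symm e, by simp [σ]⟩
  · intro x hx; simp [σ, hx]

lemma three_mul_countP_odd_le (m : List ℕ) (h2 : ∀ x ∈ m, 2 ≤ x) :
    3 * m.countP (· % 2 = 1) ≤ m.sum := by
  induction m with
  | nil => simp
  | cons x m ih =>
    have h1 := ih fun y hy => h2 y (List.mem_cons_of_mem _ hy)
    have h3 := h2 x List.mem_cons_self
    rw [List.countP_cons, List.sum_cons]
    split_ifs with h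
    · simp only [decide_eq_true_eq] at h; omega
    · omega

/-- Distribute pairs and isolated points into blocks of prescribed weights, where the first
points of the pairs have weight one and all other points have weight two. -/
lemma exists_blocks [DecidableEq T] (E : Finset T) (m : List ℕ) :
    ∀ (sg : List (T × T)) (I : List T), (∀ x ∈ m, 2 ≤ x) →
    sg.length = m.countP (· % 2 = 1) → m.sum ≤ 2 * I.length + 3 * sg.length →
    (∀ x ∈ I, x ∈ E) → (∀ p ∈ sg, p.1 ∉ E ∧ p.2 ∈ E) →
    ∃ (bs : List (List T)) (I' : List T),
      (bs.flatten ++ I').Perm (sg.flatMap (fun p => [p.1, p.2]) ++ I) ∧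
      (∀ p ∈ sg, ∃ rest, p.1 :: p.2 :: rest ∈ bs) ∧
      bs.map (fun B => B.length + B.countP (· ∈ E)) = m := by
  induction m with
  | nil =>
    intro sg I _ h1 _ _ _
    have : sg = [] := by simpa using h1
    subst this
    exact ⟨[], I, by simp, by simp, rfl⟩
  | cons x m ih =>
    intro sg I h2 h1 hs hI hsg
    have hx := h2 x List.mem_cons_self
    have h2' : ∀ y ∈ m, 2 ≤ y := fun y hy => h2 y (List.mem_cons_of_mem _ hy)
    have h3 := three_mul_countP_odd_le m h2'
    rw [List.sum_cons] at hs
    rw [List.countP_cons] at h1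
    have hcount : ∀ k, (I.take k).countP (· ∈ E) = (I.take k).length := by
      intro k
      rw [List.countP_eq_length]
      intro y hy
      simpa using hI y (List.mem_of_mem_take hy)
    rcases Nat.mod_two_eq_zero_or_one x with he | ho
    · simp only [he, zero_ne_one, decide_false, Bool.false_eq_true, if_false, add_zero] at h1
      have hk : x / 2 ≤ I.length := by omega
      obtain ⟨bs, I', hp, hb, hw⟩ := ih sg (I.drop (x / 2)) h2' h1
        (by rw [List.length_drop]; omega) (fun y hy => hI y (List.mem_of_mem_drop hy)) hsg
      refine ⟨I.take (x / 2) :: bs, I', ?_, ?_, ?_⟩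
      · rw [List.flatten_cons, List.append_assoc]
        refine (hp.append_left _).trans ?_
        nth_rewrite 3 [← List.take_append_drop (x / 2) I]
        rw [← List.append_assoc, ← List.append_assoc]
        exact List.perm_append_comm.append_right _
      · intro p hp
        obtain ⟨rest, hr⟩ := hb p hp
        exact ⟨rest, List.mem_cons_of_mem _ hr⟩
      · rw [List.map_cons, hw, hcount, List.length_take, min_eq_left hk]
        congr 1; omega
    · simp only [ho, decide_true, if_true] at h1
      rcases sg with _ | ⟨p, sg⟩
      · simp at h1
      rw [List.length_cons] at h1 hs
      have hp0 := hsg p List.mem_cons_self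
      have hk : (x - 3) / 2 ≤ I.length := by omega
      obtain ⟨bs, I', hp, hb, hw⟩ := ih sg (I.drop ((x - 3) / 2)) h2' (by omega)
        (by rw [List.length_drop]; omega) (fun y hy => hI y (List.mem_of_mem_drop hy))
        (fun y hy => hsg y (List.mem_cons_of_mem _ hy))
      refine ⟨(p.1 :: p.2 :: I.take ((x - 3) / 2)) :: bs, I', ?_, ?_, ?_⟩
      · rw [List.flatten_cons, List.append_assoc, List.flatMap_cons]
        refine (hp.append_left _).trans ?_
        nth_rewrite 3 [← List.take_append_drop ((x - 3) / 2) I]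
        simp only [List.cons_append, List.nil_append]
        refine List.Perm.cons _ (List.Perm.cons _ ?_)
        rw [← List.append_assoc, ← List.append_assoc]
        exact List.perm_append_comm.append_right _
      · intro p' hp
        rcases List.mem_cons.1 hp with rfl | hp
        · exact ⟨_, List.mem_cons_self⟩
        · obtain ⟨rest, hr⟩ := hb p' hp
          exact ⟨rest, List.mem_cons_of_mem _ hr⟩
      · rw [List.map_cons, hw, List.countP_cons, List.countP_cons, hcount]
        simp only [hp0.1, hp0.2, decide_true, decide_false, List.length_cons, List.length_take,
          min_eq_left hk]
        congr 1; simp; omega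

lemma sum_map_length_add_countP [DecidableEq T] (E : Finset T) (bs : List (List T)) :
    (bs.map (fun B => B.length + B.countP (· ∈ E))).sum =
      bs.flatten.length + bs.flatten.countP (· ∈ E) := by
  induction bs with
  | nil => simp
  | cons B bs ih => simp only [List.map_cons, List.sum_cons, ih, List.flatten_cons,
      List.length_append, List.countP_append]; omega

/-- A starter for the recursion: a path `Vl` whose steps out of points of `U` are kept, together
with isolated arcs `sg`, completed by points of `S` to a permutation of prescribed type. -/
theorem exists_starter [DecidableEq T] [Fintype T] [Fintype S] (m : List ℕ)
    (h2 : ∀ x ∈ m, 2 ≤ x) (hS : Fintype.card S = m.sum)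
    (Vl : List T) (U : Finset T) (sg : List (T × T))
    (hn : (sg.flatMap (fun p => [p.1, p.2]) ++ Vl).Nodup) (hU : ∀ x ∈ U, x ∈ Vl)
    (hsg : sg.length = m.countP (· % 2 = 1))
    (hUc : U.card + sg.length + m.sum = Fintype.card T)
    (hVl : 2 * Vl.length + sg.length + m.sum ≤ 2 * Fintype.card T) :
    ∃ (σ : S ⊕ T → S ⊕ T) (bs : List (List (S ⊕ T))),
      Realizes σ bs ∧ bs.map List.length = m ++ [Fintype.card T] ∧
      (∀ e, ∃ x, σ (.inl e) = .inr x) ∧ (∀ e, ∃ x, σ (.inr x) = .inl e) ∧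
      (∀ p ∈ sg, σ (.inr p.1) = .inr p.2) ∧
      (∀ i (h : i + 1 < Vl.length), Vl[i] ∈ U → σ (.inr Vl[i]) = .inr Vl[i + 1]) := by
  classical
  set F := sg.flatMap (fun p => [p.1, p.2]) ++ Vl with hF
  have hFl : F.length = 2 * sg.length + Vl.length := by
    rw [hF, List.length_append, List.length_flatMap]
    simp [mul_comm]
  have hnd := List.nodup_append'.1 hn
  let N : Finset T := U ∪ (sg.map Prod.fst).toFinset
  let E : Finset T := Nᶜ
  let I : List T := (F.toFinsetᶜ).toList
  have hfst : ∀ p ∈ sg, p.1 ∈ sg.flatMap (fun p => [p.1, p.2]) := fun p hp =>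
    List.mem_flatMap.2 ⟨p, hp, by simp⟩
  have hsnd : ∀ p ∈ sg, p.2 ∈ sg.flatMap (fun p => [p.1, p.2]) := fun p hp =>
    List.mem_flatMap.2 ⟨p, hp, by simp⟩
  have hpair : ∀ (sg : List (T × T)), (sg.flatMap (fun p => [p.1, p.2])).Nodup →
      (sg.map Prod.fst).Nodup ∧ ∀ p ∈ sg, ∀ q ∈ sg, p.2 ≠ q.1 := by
    clear * -
    intro sg
    induction sg with
    | nil => simp
    | cons p sg ih =>
      intro h
      rw [List.flatMap_cons, List.nodup_append'] at h
      obtain ⟨h1, h2, h3⟩ := h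
      obtain ⟨i1, i2⟩ := ih h2
      have hp : p.1 ≠ p.2 := by simpa using h1
      have hd : ∀ q ∈ sg, p.1 ≠ q.1 ∧ p.1 ≠ q.2 ∧ p.2 ≠ q.1 ∧ p.2 ≠ q.2 := by
        intro q hq
        have hq1 : q.1 ∈ sg.flatMap (fun p => [p.1, p.2]) :=
          List.mem_flatMap.2 ⟨q, hq, by simp⟩
        have hq2 : q.2 ∈ sg.flatMap (fun p => [p.1, p.2]) :=
          List.mem_flatMap.2 ⟨q, hq, by simp⟩
        refine ⟨?_, ?_, ?_, ?_⟩ <;> intro he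
        · exact h3 (a := p.1) (by simp) (he ▸ hq1)
        · exact h3 (a := p.1) (by simp) (he ▸ hq2)
        · exact h3 (a := p.2) (by simp) (he ▸ hq1)
        · exact h3 (a := p.2) (by simp) (he ▸ hq2)
      refine ⟨?_, ?_⟩
      · rw [List.map_cons, List.nodup_cons]
        refine ⟨?_, i1⟩
        rw [List.mem_map]
        rintro ⟨q, hq, he⟩
        exact (hd q hq).1 he.symm
      · intro q hq r hr
        rcases List.mem_cons.1 hq with h | h <;> rcases List.mem_cons.1 hr with h' | h'
        · rw [h, h']; exact hp.symm
        · rw [h]; exact (hd r h').2.2.1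
        · rw [h']; exact (hd q h).2.1.symm
        · exact i2 q h r h'
  obtain ⟨hp1, hp2⟩ := hpair sg hnd.1
  have hI : I.length = Fintype.card T - F.length := by
    simp only [I, Finset.length_toList, Finset.card_compl, List.toFinset_card_of_nodup hn]
  have hFle : F.length ≤ Fintype.card T := by
    rw [← List.toFinset_card_of_nodup hn]; exact Finset.card_le_univ _
  have hIE : ∀ x ∈ I, x ∈ E := by
    intro x hx
    have hx' : x ∉ F := by simpa [I] using hx
    simp only [E, N, Finset.mem_compl, Finset.mem_union, List.mem_toFinset, not_or]
    refine ⟨fun h => hx' (List.mem_append_right _ (hU x h)), fun h => ?_⟩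
    obtain ⟨p, hp, rfl⟩ := List.mem_map.1 h
    exact hx' (List.mem_append_left _ (hfst p hp))
  have hsgE : ∀ p ∈ sg, p.1 ∉ E ∧ p.2 ∈ E := by
    intro p hp
    constructor
    · simp only [E, N, Finset.mem_compl, Finset.mem_union, List.mem_toFinset, not_not]
      exact Or.inr (List.mem_map_of_mem hp)
    · simp only [E, N, Finset.mem_compl, Finset.mem_union, List.mem_toFinset, not_or]
      refine ⟨fun h => hnd.2.2 (hsnd p hp) (hU _ h), fun h => ?_⟩
      obtain ⟨q, hq, he⟩ := List.mem_map.1 h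
      exact hp2 p hp q hq he.symm
  have hNc : N.card = U.card + sg.length := by
    rw [Finset.card_union_of_disjoint, List.toFinset_card_of_nodup hp1, List.length_map]
    rw [Finset.disjoint_left]
    intro x hx hx'
    obtain ⟨p, hp, rfl⟩ := List.mem_map.1 (List.mem_toFinset.1 hx')
    exact hnd.2.2 (hfst p hp) (hU _ hx)
  have hEc : E.card = Fintype.card S := by
    rw [hS, Finset.card_compl, hNc]; omega
  obtain ⟨bs, I', hperm, hb, hw⟩ := exists_blocks E m sg I h2 hsg (by omega) hIE hsgE
  let bs' := bs ++ [Vl ++ I']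
  have hperm' : bs'.flatten.Perm (F ++ I) := by
    have e1 : bs'.flatten = bs.flatten ++ (Vl ++ I') := by simp [bs']
    rw [e1, hF]
    have h1 : (bs.flatten ++ (Vl ++ I')).Perm (bs.flatten ++ I' ++ Vl) := by
      rw [List.append_assoc]
      exact List.Perm.append_left _ List.perm_append_comm
    refine h1.trans ((hperm.append_right _).trans ?_)
    rw [List.append_assoc, List.append_assoc]
    exact List.Perm.append_left _ List.perm_append_comm
  have hnFI : (F ++ I).Nodup := by
    rw [List.nodup_append']
    refine ⟨hn, Finset.nodup_toList _, fun x hx hx' => ?_⟩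
    have : x ∉ F := by simpa [I] using hx'
    exact this hx
  have hn' : bs'.flatten.Nodup := hperm'.nodup_iff.2 hnFI
  have hc' : ∀ x, x ∈ bs'.flatten := by
    intro x
    rw [hperm'.mem_iff, List.mem_append]
    by_cases hx : x ∈ F
    · exact Or.inl hx
    · right; simpa [I] using hx
  obtain ⟨σ, τ, cs, hτ, hσ, hlen, hS1, hS2, hout⟩ := exists_expand bs' hn' hc' E hEc
  have huniv : bs'.flatten.toFinset = Finset.univ := by
    ext x; simpa using hc' x
  have hlast : cs.map List.length = m ++ [Fintype.card T] := by
    have hsum := sum_map_length_add_countP E bs'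
    have hl : bs'.flatten.length = Fintype.card T := by
      rw [← List.toFinset_card_of_nodup hn', huniv, Finset.card_univ]
    have hcnt : bs'.flatten.countP (· ∈ E) = E.card := by
      rw [List.countP_eq_length_filter, ← List.toFinset_card_of_nodup (hn'.filter _),
        List.toFinset_filter, huniv]
      congr 1
      ext x; simp
    rw [hl, hcnt, hEc, hS] at hsum
    rw [hlen]
    simp only [bs', List.map_append, hw, List.map_cons, List.map_nil] at hsum ⊢
    rw [List.sum_append] at hsum
    simp only [List.sum_cons, List.sum_nil, add_zero] at hsum
    congr 2
    omega
  have hstep : ∀ (B : List T), B ∈ bs' → ∀ i (h : i + 1 < B.length), τ B[i] = B[i + 1] := by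
    intro B hB i h
    have h1 := hτ.2.2 B hB
    have h2 := congrArg (fun l => l[i]?) h1
    simp only [List.getElem?_map] at h2
    rw [List.getElem?_eq_getElem (by omega), List.getElem?_rotate (by omega),
      Nat.mod_eq_of_lt h, List.getElem?_eq_getElem h] at h2
    simpa using h2
  refine ⟨σ, cs, hσ, hlast, hS1, hS2, ?_, ?_⟩
  · intro p hp
    obtain ⟨rest, hr⟩ := hb p hp
    rw [hout _ (hsgE p hp).1]
    have := hstep _ (List.mem_append_left _ hr) 0 (by simp)
    simpa using this
  · intro i h hi
    have hE : Vl[i] ∉ E := by simp [E, N, hi]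
    rw [hout _ hE]
    have := hstep (Vl ++ I') (by simp [bs']) i (by rw [List.length_append]; omega)
    rw [List.getElem_append_left (by omega), List.getElem_append_left h] at this
    rw [this]

end Starter

section Recursion

/-- The recursive step: `t` rotations of a starter and a Hamiltonian cover of the leftover
differences extend a solution by one cycle of length `t`. -/
theorem Sol.snoc {m : List ℕ} (hm : Sol m) (t : ℕ) [NeZero t] (P : ZMod t → ZMod t → Prop)
    (hcov : Cov P (m.sum - 1))
    (hst : ∀ (S : Type) [Fintype S], Fintype.card S = m.sum →
      ∃ (σ : S ⊕ ZMod t → S ⊕ ZMod t) (bs : List (List (S ⊕ ZMod t))),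
      Realizes σ bs ∧ bs.map List.length = m ++ [t] ∧
      (∀ e, ∃ x, σ (.inl e) = .inr x) ∧ (∀ e, ∃ x, σ (.inr x) = .inl e) ∧
      ∀ d, d ≠ 0 → (∀ x, P x (x + d)) ∨ ∃ x, σ (.inr x) = .inr (x + d)) :
    Sol (m ++ [t]) := by
  obtain ⟨S, ι, _, _, f, hS, hι, hf, hfc⟩ := hm
  obtain ⟨hs, hl, hfull, hP⟩ := hcov
  obtain ⟨σ, bs, hσ, hbs, hin, hout, hd⟩ := hst S hS
  let sh : ZMod t → (S ⊕ ZMod t ≃ S ⊕ ZMod t) := fun g =>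
    Equiv.sumCongr (Equiv.refl S) (Equiv.addRight g)
  have eι : ι ≃ Fin hs.length := Fintype.equivOfCardEq (by simp; omega)
  refine ⟨S ⊕ ZMod t, ι ⊕ ZMod t, inferInstance, inferInstance,
    Sum.elim (fun i => Sum.map (f i) hs[eι i]) (fun g v => sh g (σ ((sh g).symm v))),
    ?_, ?_, ?_, ?_⟩
  · simp [hS]
  · simp; omega
  · rintro (i | g)
    · obtain ⟨cs, h1, h2, h3, h4⟩ := hf i
      obtain ⟨B, b1, b2, b3⟩ := hfull hs[eι i] (List.getElem_mem _)
      refine ⟨cs.map (List.map Sum.inl) ++ [B.map Sum.inr], ?_, ?_, ?_, ?_⟩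
      · have hB : B.length = t := by
          have := b1.length_le_card
          classical
          have h := List.toFinset_card_of_nodup b1
          have hu : B.toFinset = Finset.univ := by ext x; simpa using b2 x
          rw [hu, Finset.card_univ, ZMod.card] at h
          exact h.symm
        simp only [List.map_append, List.map_map, List.map_cons, List.map_nil, List.length_map, hB]
        congr 1
        rw [← h1]
        apply List.map_congr_left
        simp
      · rw [List.flatten_append, ← List.map_flatten, List.nodup_append']
        refine ⟨h2.map Sum.inl_injective, by simpa using b1.map Sum.inr_injective, ?_⟩
        intro x hx hx'
        obtain ⟨y, _, rfl⟩ := List.mem_map.1 hx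
        simp at hx'
      · rw [List.flatten_append, ← List.map_flatten]
        rintro (e | x)
        · exact List.mem_append_left _ (List.mem_map_of_mem (h3 e))
        · apply List.mem_append_right
          simpa using b2 x
      · intro C hC
        rcases List.mem_append.1 hC with hC | hC
        · obtain ⟨A, hA, rfl⟩ := List.mem_map.1 hC
          rw [← List.map_rotate, ← h4 A hA]
          simp
        · rw [List.mem_singleton] at hC
          subst hC
          rw [← List.map_rotate, ← b3]
          simp
    · refine ⟨bs.map (List.map (sh g)), ?_, hσ.conj (sh g)⟩
      rw [← hbs, List.map_map]
      apply List.map_congr_left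
      simp
  · rintro (e | x) (e' | y) hne
    · obtain ⟨i, hi⟩ := hfc e e' (by simpa using hne)
      exact ⟨.inl i, by simp [hi]⟩
    · obtain ⟨x, hx⟩ := hin e
      exact ⟨.inr (y - x), by simp [sh, hx]⟩
    · obtain ⟨z, hz⟩ := hout e'
      exact ⟨.inr (x - z), by simp [sh, hz, ← sub_eq_add_neg]⟩
    · rcases hd (y - x) (by simpa [sub_eq_zero, eq_comm] using hne) with h | ⟨z, hz⟩
      · obtain ⟨h', hh, he⟩ := hP _ _ (h x)
        obtain ⟨k, hk, rfl⟩ := List.getElem_of_mem hh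
        refine ⟨.inl (eι.symm ⟨k, hk⟩), ?_⟩
        simp [he]
      · refine ⟨.inr (x - z), ?_⟩
        simp only [Sum.elim_inr, sh, Equiv.sumCongr_symm, Equiv.refl_symm, Equiv.sumCongr_apply,
          Sum.map_inr, Equiv.addRight_symm, Equiv.coe_addRight, ← sub_eq_add_neg, sub_sub_cancel,
          hz, Sum.inr.injEq]
        ring

end Recursion

section Graph

variable {V : Type*}

lemma FullCycle.length_eq [Fintype V] {B : List V} (hn : B.Nodup) (hc : ∀ x, x ∈ B) :
    B.length = Fintype.card V := by
  classical
  rw [← List.toFinset_card_of_nodup hn, ← Finset.card_univ]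
  congr 1
  ext x
  simpa using hc x

lemma getElem_of_map_eq_rotate {σ : V → V} {B : List V} (h : B.map σ = B.rotate 1) (i : ℕ)
    (hi : i < B.length) : σ B[i] = B[(i + 1) % B.length]'(Nat.mod_lt _ (by omega)) := by
  have h2 := congrArg (fun l => l[i]?) h
  simp only [List.getElem?_map] at h2
  rw [List.getElem?_eq_getElem hi, List.getElem?_rotate hi,
    List.getElem?_eq_getElem (Nat.mod_lt _ (by omega))] at h2
  simpa using h2

lemma FullCycle.apply_apply_ne [Fintype V] {σ : V → V} (h : FullCycle σ)
    (h3 : 3 ≤ Fintype.card V) (x : V) : σ (σ x) ≠ x := by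
  obtain ⟨B, h1, h2, hr⟩ := h
  obtain ⟨i, hi, rfl⟩ := List.getElem_of_mem (h2 x)
  have hl := FullCycle.length_eq h1 h2
  rw [getElem_of_map_eq_rotate hr i hi, getElem_of_map_eq_rotate hr _ (Nat.mod_lt _ (by omega))]
  intro he
  have := (List.Nodup.getElem_inj_iff h1).1 he
  by_cases h : i + 1 < B.length
  · rw [Nat.mod_eq_of_lt h] at this
    by_cases h' : i + 1 + 1 < B.length
    · rw [Nat.mod_eq_of_lt h'] at this; omega
    · have : i + 1 + 1 = B.length := by omega
      simp_all
      omega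
  · have h' : i + 1 = B.length := by omega
    rw [h', Nat.mod_self, Nat.mod_eq_of_lt (by omega)] at this
    omega

lemma FullCycle.bijective [Finite V] {σ : V → V} (h : FullCycle σ) : Function.Bijective σ := by
  obtain ⟨B, h1, h2, hr⟩ := h
  rw [← Finite.surjective_iff_bijective]
  intro y
  have : y ∈ B.map σ := by rw [hr, List.mem_rotate]; exact h2 y
  obtain ⟨x, _, hx⟩ := List.mem_map.1 this
  exact ⟨x, hx⟩

lemma FullCycle.symm {σ : V ≃ V} (h : FullCycle σ) : FullCycle σ.symm := by
  obtain ⟨B, h1, h2, hr⟩ := h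
  refine ⟨B.reverse, List.nodup_reverse.2 h1, by simpa using h2, ?_⟩
  have e1 : B = (B.rotate 1).map σ.symm := by rw [← hr]; simp
  have e2 : B.reverse.rotate 1 = ((B.rotate 1).reverse.rotate 1).map σ.symm := by
    conv_lhs => rw [e1]
    rw [← List.map_reverse, List.map_rotate]
  rw [e2]
  congr 1
  rcases B with _ | ⟨x, xs⟩
  · simp
  · simp [List.rotate_cons_succ]

lemma cov_of_fullCycle_adj [Fintype V] (G : SimpleGraph V) {σ : V → V} (hσ : FullCycle σ)
    (h3 : 3 ≤ Fintype.card V) (hadj : ∀ x, G.Adj x (σ x))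
    (h2 : ∀ x, (G.neighborSet x).ncard = 2) : Cov G.Adj 2 := by
  let e := Equiv.ofBijective σ hσ.bijective
  have he : ∀ x, σ (e.symm x) = x := fun x => e.apply_symm_apply x
  have hσ' : FullCycle e := hσ
  refine ⟨[e, e.symm], rfl, ?_, ?_⟩
  · simp only [List.mem_cons, List.not_mem_nil, or_false, forall_eq_or_imp, forall_eq]
    exact ⟨hσ', hσ'.symm⟩
  · intro x y hxy
    simp only [List.mem_cons, List.not_mem_nil, or_false, exists_eq_or_imp, exists_eq_left]
    by_contra hcon
    push Not at hcon
    obtain ⟨h4, h5⟩ := hcon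
    obtain ⟨p, q, hpq, hN⟩ := Set.ncard_eq_two.1 (h2 x)
    have m1 : y ∈ G.neighborSet x := hxy
    have m2 : σ x ∈ G.neighborSet x := hadj x
    have m3 : e.symm x ∈ G.neighborSet x := by
      have := (hadj (e.symm x)).symm
      rwa [he] at this
    have h6 : σ x ≠ e.symm x := by
      intro h
      have := congrArg σ h
      rw [he] at this
      exact hσ.apply_apply_ne h3 x this
    have h4' : σ x ≠ y := h4
    rw [hN] at m1 m2 m3
    simp only [Set.mem_insert_iff, Set.mem_singleton_iff] at m1 m2 m3
    grind

lemma cov_of_graph [Fintype V] [Nonempty V] (G : SimpleGraph V)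
    (hconn : ∀ f : V → Prop, (∀ x y, G.Adj x y → f x = f y) → ∀ x y, f x = f y)
    (h2 : ∀ x, (G.neighborSet x).ncard = 2) : Cov G.Adj 2 := by
  obtain ⟨v⟩ := ‹Nonempty V›
  have hreach : ∀ y, G.Reachable v y := by
    intro y
    have := hconn (G.Reachable v) (fun x y hxy => propext
      ⟨fun h => h.trans hxy.reachable, fun h => h.trans hxy.symm.reachable⟩) v y
    rw [← this]
  have hcyc : G.IsCycles := fun x _ => h2 x
  have hnon : (G.neighborSet v).Nonempty := by
    rw [← Set.ncard_pos (Set.toFinite _), h2]; norm_num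
  obtain ⟨p, hp, hsupp⟩ := hcyc.exists_cycle_toSubgraph_verts_eq_connectedComponentSupp
    (c := G.connectedComponentMk v) rfl hnon
  have hmem : ∀ x, x ∈ p.support := by
    intro x
    rw [← SimpleGraph.Walk.mem_verts_toSubgraph, hsupp]
    exact SimpleGraph.ConnectedComponent.sound (hreach x).symm
  set B := p.support.tail with hB
  have hsup : v :: B = p.support := p.cons_tail_support
  have hBn : B.Nodup := hp.support_nodup
  have hchain : List.IsChain G.Adj (v :: B) := hsup ▸ p.isChain_adj_support
  have hlast : ∀ h, (v :: B).getLast h = v := by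
    intro h
    simp only [hsup]
    exact p.getLast_support
  have hBne : B ≠ [] := by
    intro h
    have h1 := hmem v
    obtain ⟨w, hw⟩ := hnon
    have hw' := hmem w
    rw [← hsup, h, List.mem_singleton] at hw'
    subst hw'
    exact G.irrefl hw
  have hlast' : B.getLast hBne = v := by
    have := hlast (by simp)
    rwa [List.getLast_cons hBne] at this
  have hBc : ∀ x, x ∈ B := by
    intro x
    have := hmem x
    rw [← hsup, List.mem_cons] at this
    rcases this with rfl | h
    · rw [← hlast']; exact List.getLast_mem _
    · exact h
  obtain ⟨σ, hσ⟩ := exists_realizes [B] (by simpa using hBn) (by simpa using hBc)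
  have hr : B.map σ = B.rotate 1 := hσ.2.2 B (by simp)
  have hcard : 3 ≤ Fintype.card V := by
    obtain ⟨p, q, hpq, hN⟩ := Set.ncard_eq_two.1 (h2 v)
    classical
    have hp : G.Adj v p := by
      have : p ∈ G.neighborSet v := by rw [hN]; simp
      exact this
    have hq : G.Adj v q := by
      have : q ∈ G.neighborSet v := by rw [hN]; simp
      exact this
    rw [← Finset.card_univ]
    refine le_trans (b := ({v, p, q} : Finset V).card) ?_ (Finset.card_le_univ _)
    rw [Finset.card_eq_three.2 ⟨v, p, q, hp.ne, hq.ne, hpq, rfl⟩]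
  refine cov_of_fullCycle_adj G ⟨B, hBn, hBc, hr⟩ hcard (fun x => ?_) h2
  obtain ⟨i, hi, rfl⟩ := List.getElem_of_mem (hBc x)
  rw [getElem_of_map_eq_rotate hr i hi]
  rw [List.isChain_iff_getElem] at hchain
  by_cases h : i + 1 < B.length
  · have := hchain (i + 1) (by simpa using h)
    simpa [Nat.mod_eq_of_lt h] using this
  · have h' : i + 1 = B.length := by omega
    have hv : B[i] = v := by
      rw [← hlast', List.getLast_eq_getElem]
      congr 1
      omega
    have := hchain 0 (by simp; omega)
    simp only [h', Nat.mod_self, hv]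
    simpa using this

end Graph

section Switch

lemma ncard_switch_eq_two {α : Type*} {u v w z : α} {p₁ p₂ p₃ p₄ : Prop} (huv : u ≠ v)
    (huz : u ≠ z) (huw : u ≠ w) (hvw : v ≠ w) (hvz : v ≠ z) (hwz : w ≠ z)
    (h21 : p₂ → ¬ p₁) (h31 : p₃ → ¬ p₁) (h43 : p₄ → ¬ p₃) (h42 : p₄ → ¬ p₂) :
    {y | (y = u ∧ ¬ p₁ ∧ ¬ p₃) ∨ (y = v ∧ ¬ p₂ ∧ ¬ p₄) ∨ (y = w ∧ (p₁ ∨ p₂)) ∨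
      (y = z ∧ (p₃ ∨ p₄))}.ncard = 2 := by
  have key : ∀ {s : Set α} {c d : α}, c ≠ d → (∀ y, y ∈ s ↔ y = c ∨ y = d) → s.ncard = 2 := by
    intro s c d hcd hs
    rw [Set.ncard_eq_two]
    exact ⟨c, d, hcd, by ext y; simpa using hs y⟩
  by_cases h1 : p₁
  · have h2 : ¬ p₂ := fun h => h21 h h1
    have h3 : ¬ p₃ := fun h => h31 h h1
    by_cases h4 : p₄
    · exact key hwz fun y => by simp [h1, h2, h3, h4]
    · exact key hvw fun y => by simp [h1, h2, h3, h4]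
  · by_cases h2 : p₂
    · have h4 : ¬ p₄ := fun h => h42 h h2
      by_cases h3 : p₃
      · exact key hwz fun y => by simp [h1, h2, h3, h4]
      · exact key huw fun y => by simp [h1, h2, h3, h4]
    · by_cases h3 : p₃
      · have h4 : ¬ p₄ := fun h => h43 h h3
        exact key hvz fun y => by simp [h1, h2, h3, h4]
      · by_cases h4 : p₄
        · exact key huz fun y => by simp [h1, h2, h3, h4]
        · exact key huv fun y => by simp [h1, h2, h3, h4]

variable {R : Type*} [AddCommGroup R] [Fintype R]

lemma cov_switch_half (a b : R) (Q : R → Prop) (ha2 : a + a ≠ 0) (hb2 : b + b ≠ 0)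
    (hab : a ≠ b) (hab' : a + b ≠ 0) (hQ : ∀ x, Q x → ¬ Q (x + a) ∧ ¬ Q (x + b))
    (hA : ∀ f : R → Prop, (∀ x, ¬ Q x → ¬ Q (x - b) → f x = f (x + a)) →
      (∀ x, Q x → f x = f (x + b) ∧ f (x + a) = f (x + a + b)) → ∀ x y, f x = f y) :
    Cov (fun x y => (y = x + a ∧ ¬ Q x ∧ ¬ Q (x - b)) ∨ (x = y + a ∧ ¬ Q y ∧ ¬ Q (y - b)) ∨
      (y = x + b ∧ (Q x ∨ Q (x - a))) ∨ (x = y + b ∧ (Q y ∨ Q (y - a)))) 2 := by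
  have ha : a ≠ 0 := fun h => ha2 (by simp [h])
  have hb : b ≠ 0 := fun h => hb2 (by simp [h])
  let G : SimpleGraph R :=
    { Adj := fun x y => (y = x + a ∧ ¬ Q x ∧ ¬ Q (x - b)) ∨
        (x = y + a ∧ ¬ Q y ∧ ¬ Q (y - b)) ∨
        (y = x + b ∧ (Q x ∨ Q (x - a))) ∨ (x = y + b ∧ (Q y ∨ Q (y - a)))
      symm := ⟨fun x y h => by tauto⟩
      loopless := ⟨fun x h => by simp [ha, hb] at h⟩ }
  refine cov_of_graph G (fun f hf => hA f ?_ ?_) fun x => ?_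
  · intro x h1 h2
    exact hf _ _ (Or.inl ⟨rfl, h1, h2⟩)
  · intro x h1
    exact ⟨hf _ _ (Or.inr (Or.inr (Or.inl ⟨rfl, Or.inl h1⟩))),
      hf _ _ (Or.inr (Or.inr (Or.inl ⟨rfl, Or.inr (by simpa using h1)⟩)))⟩
  · have hN : G.neighborSet x = {y | (y = x + a ∧ ¬ Q x ∧ ¬ Q (x - b)) ∨
        (y = x - a ∧ ¬ Q (x - a) ∧ ¬ Q (x - a - b)) ∨
        (y = x + b ∧ (Q x ∨ Q (x - a))) ∨ (y = x - b ∧ (Q (x - b) ∨ Q (x - a - b)))} := by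
      ext y
      have e1 : x = y + a ↔ y = x - a := by rw [eq_sub_iff_add_eq, eq_comm]
      have e2 : x = y + b ↔ y = x - b := by rw [eq_sub_iff_add_eq, eq_comm]
      change ((y = x + a ∧ ¬ Q x ∧ ¬ Q (x - b)) ∨ (x = y + a ∧ ¬ Q y ∧ ¬ Q (y - b)) ∨
        (y = x + b ∧ (Q x ∨ Q (x - a))) ∨ (x = y + b ∧ (Q y ∨ Q (y - a)))) ↔ _
      rw [e1, e2]
      have e3 : x - a - b = x - b - a := by abel
      change _ ↔ _ ∨ _
      refine or_congr Iff.rfl (or_congr ?_ (or_congr Iff.rfl ?_))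
      · exact and_congr_right fun h => by rw [h]
      · exact and_congr_right fun h => by rw [h, e3]
    have q1 : Q (x - a) → ¬ Q x := fun h => by simpa using (hQ _ h).1
    have q2 : Q (x - b) → ¬ Q x := fun h => by simpa using (hQ _ h).2
    have q3 : Q (x - a - b) → ¬ Q (x - b) := fun h => by
      have := (hQ _ h).1
      rwa [show x - a - b + a = x - b by abel] at this
    have q4 : Q (x - a - b) → ¬ Q (x - a) := fun h => by simpa using (hQ _ h).2
    have d1 : x + a ≠ x - a := fun h => ha2 (by
      have := congrArg (fun z => z - x + a) h; simpa using this)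
    have d2 : x + b ≠ x - b := fun h => hb2 (by
      have := congrArg (fun z => z - x + b) h; simpa using this)
    have d3 : x + a ≠ x + b := fun h => hab (add_left_cancel h)
    have d4 : x - a ≠ x - b := fun h => hab (sub_right_injective h)
    have d5 : x + a ≠ x - b := fun h => hab' (by
      have := congrArg (fun z => z - x + b) h; simpa using this)
    have d6 : x - a ≠ x + b := fun h => hab' (by
      have := congrArg (fun z => z - x + a) h; simpa [add_comm] using this.symm)
    rw [hN]
    exact ncard_switch_eq_two d1 d5 d3 d6 d4 d2 q1 q2 q3 q4

/-- Two circulant 2-factors can be made into two Hamiltonian cycles by switching along the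
parallelograms based at the points of `Q`. -/
theorem cov_switch (a b : R) (Q : R → Prop) (ha2 : a + a ≠ 0) (hb2 : b + b ≠ 0)
    (hab : a ≠ b) (hab' : a + b ≠ 0) (hQ : ∀ x, Q x → ¬ Q (x + a) ∧ ¬ Q (x + b))
    (hA : ∀ f : R → Prop, (∀ x, ¬ Q x → ¬ Q (x - b) → f x = f (x + a)) →
      (∀ x, Q x → f x = f (x + b) ∧ f (x + a) = f (x + a + b)) → ∀ x y, f x = f y)
    (hB : ∀ f : R → Prop, (∀ x, ¬ Q x → ¬ Q (x - a) → f x = f (x + b)) →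
      (∀ x, Q x → f x = f (x + a) ∧ f (x + b) = f (x + b + a)) → ∀ x y, f x = f y) :
    Cov (fun x y => y = x + a ∨ x = y + a ∨ y = x + b ∨ x = y + b) 4 := by
  have h1 := cov_switch_half a b Q ha2 hb2 hab hab' hQ hA
  have h2 := cov_switch_half b a Q hb2 ha2 hab.symm (by rwa [add_comm])
    (fun x hx => (hQ x hx).symm) hB
  refine (h1.append h2).mono fun x y h => ?_
  have key : ∀ d z : R, (Q z ∨ Q (z - d)) ∨ (¬ Q z ∧ ¬ Q (z - d)) := fun d z => by
    by_cases h : Q z ∨ Q (z - d)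
    · exact Or.inl h
    · exact Or.inr (not_or.1 h)
  rcases h with h | h | h | h
  · rcases key b x with h' | h'
    · exact Or.inr (Or.inr (Or.inr (Or.inl ⟨h, h'⟩)))
    · exact Or.inl (Or.inl ⟨h, h'⟩)
  · rcases key b y with h' | h'
    · exact Or.inr (Or.inr (Or.inr (Or.inr ⟨h, h'⟩)))
    · exact Or.inl (Or.inr (Or.inl ⟨h, h'⟩))
  · rcases key a x with h' | h'
    · exact Or.inl (Or.inr (Or.inr (Or.inl ⟨h, h'⟩)))
    · exact Or.inr (Or.inl ⟨h, h'⟩)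
  · rcases key a y with h' | h'
    · exact Or.inl (Or.inr (Or.inr (Or.inr ⟨h, h'⟩)))
    · exact Or.inr (Or.inr (Or.inl ⟨h, h'⟩))

end Switch

section Coordinates

/-- Every element is uniquely `l • b + i • a` with `l < d` and `i < N`. -/
structure Coordinates {R : Type*} [AddCommGroup R] (a b : R) (d N : ℕ) : Prop where
  exists_eq : ∀ x : R, ∃ l i, l < d ∧ i < N ∧ x = l • b + i • a
  inj : ∀ l i l' i', l < d → i < N → l' < d → i' < N → l • b + i • a = l' • b + i' • a →
    l = l' ∧ i = i'
  period : N • a = 0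
  wrap : ∃ e : ℕ, d • b = e • a

lemma coordinates_zmod {n : ℕ} (hn : 0 < n) (a b : ℕ) (h : Nat.gcd (Nat.gcd a n) b = 1) :
    Coordinates (a : ZMod n) (b : ZMod n) (Nat.gcd a n) (n / Nat.gcd a n) := by
  have : NeZero n := ⟨hn.ne'⟩
  set d := Nat.gcd a n with hd
  have hdpos : 0 < d := Nat.gcd_pos_of_pos_right a hn
  have hdn : d ∣ n := Nat.gcd_dvd_right a n
  have hda : d ∣ a := Nat.gcd_dvd_left a n
  have hN : 0 < n / d := Nat.div_pos (Nat.le_of_dvd hn hdn) hdpos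
  have hper : (n / d) • (a : ZMod n) = 0 := by
    obtain ⟨a', ha'⟩ := hda
    rw [nsmul_eq_mul, ← Nat.cast_mul, ha', ← mul_assoc, Nat.div_mul_cancel hdn]
    simp
  have hmod : ∀ z : ℤ, ∃ i < n / d, (z : ZMod n) * a = i • (a : ZMod n) := by
    intro z
    refine ⟨(z % (n / d : ℕ)).toNat, ?_, ?_⟩
    · have := Int.emod_lt_of_pos z (by exact_mod_cast hN : (0 : ℤ) < (n / d : ℕ))
      have := Int.emod_nonneg z (by exact_mod_cast hN.ne' : ((n / d : ℕ) : ℤ) ≠ 0)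
      omega
    · have h1 : (((z % (n / d : ℕ)).toNat : ℤ)) = z % (n / d : ℕ) :=
        Int.toNat_of_nonneg (Int.emod_nonneg z (by exact_mod_cast hN.ne'))
      have h2 : (((z % (n / d : ℕ)).toNat : ℕ) : ZMod n) = ((z % (n / d : ℕ) : ℤ) : ZMod n) := by
        rw [← h1]; simp
      rw [nsmul_eq_mul, h2]
      conv_lhs => rw [← Int.emod_add_mul_ediv z (n / d : ℕ)]
      rw [nsmul_eq_mul] at hper
      rw [Int.cast_add, Int.cast_mul, Int.cast_natCast, add_mul, mul_right_comm, hper]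
      simp
  have hdcast : ∃ z : ℤ, (d : ZMod n) = z * a := by
    refine ⟨Nat.gcdA a n, ?_⟩
    have := congrArg (fun z : ℤ => (z : ZMod n)) (Nat.gcd_eq_gcd_ab a n)
    simpa [mul_comm] using this
  obtain ⟨w, hw⟩ := hdcast
  have hsur : ∀ x : ZMod n, ∃ l i, l < d ∧ i < n / d ∧ x = l • (b : ZMod n) + i • (a : ZMod n) := by
    intro x
    have hbez := Nat.gcd_eq_gcd_ab d b
    rw [h] at hbez
    set u := Nat.gcdA d b
    set v := Nat.gcdB d b
    set X : ℤ := (x.val : ℤ)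
    have hx : x = ((X : ℤ) : ZMod n) := by simp [X]
    have hd0 : (d : ℤ) ≠ 0 := by exact_mod_cast hdpos.ne'
    obtain ⟨i, hi, hi'⟩ := hmod (w * (u * X + b * ((v * X) / d)))
    refine ⟨((v * X) % d).toNat, i, ?_, hi, ?_⟩
    · have := Int.emod_lt_of_pos (v * X) (by exact_mod_cast hdpos : (0 : ℤ) < d)
      omega
    · have h1 : ((((v * X) % d).toNat : ℤ)) = (v * X) % d :=
        Int.toNat_of_nonneg (Int.emod_nonneg _ hd0)
      have h2 : ((((v * X) % d).toNat : ℕ) : ZMod n) = (((v * X) % d : ℤ) : ZMod n) := by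
        rw [← h1]; simp
      rw [← hi', nsmul_eq_mul, h2]
      have e1 : X = (v * X) % d * b + d * (u * X + b * ((v * X) / d)) := by
        have := Int.emod_add_mul_ediv (v * X) d
        have e0 : X = X * ((d : ℤ) * u + b * v) := by rw [← hbez]; simp
        linear_combination e0 - b * this
      conv_lhs => rw [hx, e1]
      push_cast
      rw [hw]
      ring
  have hbij : Function.Bijective
      (fun p : Fin d × Fin (n / d) => (p.1 : ℕ) • (b : ZMod n) + (p.2 : ℕ) • (a : ZMod n)) := by
    rw [Fintype.bijective_iff_surjective_and_card]
    constructor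
    · intro x
      obtain ⟨l, i, hl, hi, hx⟩ := hsur x
      exact ⟨(⟨l, hl⟩, ⟨i, hi⟩), hx.symm⟩
    · simp [ZMod.card, Nat.mul_div_cancel' hdn]
  refine ⟨hsur, ?_, hper, ?_⟩
  · intro l i l' i' hl hi hl' hi' he
    have := @hbij.1 (⟨l, hl⟩, ⟨i, hi⟩) (⟨l', hl'⟩, ⟨i', hi'⟩) he
    simpa using this
  · obtain ⟨i, _, hi⟩ := hmod (w * b)
    refine ⟨i, ?_⟩
    rw [← hi, nsmul_eq_mul, hw]
    push_cast
    ring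

/-- Levels joined by switches at alternating positions are connected. -/
lemma levels_connected {F : ℕ → ℕ → Prop} {I : ℕ → ℕ} {d N : ℕ} (hN : 0 < N)
    (hper : ∀ l i, F l (i + N) = F l i)
    (hI : ∀ l, I l < N) (hII : ∀ l, I l ≠ I (l + 1))
    (hpath : ∀ l i, l < d → ¬ (l + 2 ≤ d ∧ i % N = I l) → ¬ (1 ≤ l ∧ i % N = I (l - 1)) →
      F l i = F l (i + 1))
    (hlink : ∀ l, l + 2 ≤ d → F l (I l) = F (l + 1) (I l) ∧
      F l (I l + 1) = F (l + 1) (I l + 1)) :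
    ∀ l i, l < d → i < N → F l i = F 0 0 := by
  have hmod : ∀ p k, p < N → 0 < k → k < N → (p + k) % N ≠ p := by
    intro p k hp hk hk' h
    rcases lt_or_ge (p + k) N with h1 | h1
    · rw [Nat.mod_eq_of_lt h1] at h; omega
    · rw [Nat.mod_eq_sub_mod h1, Nat.mod_eq_of_lt (by omega)] at h; omega
  have hrep : ∀ l p (c : Prop), p < N → (∀ k, 1 ≤ k → k ≤ N → F l (p + k) = c) →
      ∀ i < N, F l i = c := by
    intro l p c hp h i hi
    rcases lt_or_ge p i with h1 | h1
    · have := h (i - p) (by omega) (by omega)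
      rwa [Nat.add_sub_cancel' h1.le] at this
    · rw [← hper, ← h (i + N - p) (by omega) (by omega)]
      congr 1; omega
  have hrun : ∀ l s t, (∀ j, s ≤ j → j < t → F l j = F l (j + 1)) → s ≤ t → F l s = F l t := by
    intro l s t h hst
    induction t, hst using Nat.le_induction with
    | base => rfl
    | succ t ht ih => rw [ih fun j h1 h2 => h j h1 (by omega), h t ht (by omega)]
  have h0 : 0 < d → ∀ i < N, F 0 i = F 0 0 := by
    intro hd
    have h1 := hrep 0 (I 0) (F 0 (I 0 + N)) (hI 0) fun k hk hkN => by
      refine hrun 0 _ _ (fun j hj1 hj2 => hpath 0 j hd ?_ (by omega)) (by omega)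
      rintro ⟨-, h⟩
      have := hmod (I 0) (j - I 0) (hI 0) (by omega) (by omega)
      rw [Nat.add_sub_cancel' (by omega)] at this
      exact this h
    intro i hi
    rw [h1 i hi, h1 0 hN]
  intro l
  induction l with
  | zero => exact fun i h hi => h0 h i hi
  | succ l ih =>
    intro i hl hi
    have hl2 : l + 2 ≤ d := by omega
    have key : ∀ i, F l i = F 0 0 := by
      intro i
      induction i using Nat.strong_induction_on with
      | _ i ihi =>
        rcases lt_or_ge i N with h | h
        · exact ih i (by omega) h
        · rw [show i = (i - N) + N by omega, hper]
          exact ihi _ (by omega)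
    obtain ⟨k1, k2⟩ := hlink l hl2
    rw [key] at k1 k2
    refine hrep (l + 1) (I l) _ (hI l) (fun k hk hkN => ?_) i hi
    have hk0 : ∃ k0, 1 ≤ k0 ∧ k0 < N ∧ (I l + k0) % N = I (l + 1) := by
      rcases lt_or_ge (I l) (I (l + 1)) with h | h
      · exact ⟨I (l + 1) - I l, by omega, by have := hI (l + 1); omega,
          by rw [Nat.add_sub_cancel' h.le, Nat.mod_eq_of_lt (hI _)]⟩
      · have := hII l
        have := hI l
        refine ⟨I (l + 1) + N - I l, by omega, by omega, ?_⟩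
        rw [Nat.add_sub_cancel' (by omega), Nat.add_mod_right, Nat.mod_eq_of_lt (hI _)]
    obtain ⟨k0, hk1, hk2, hk3⟩ := hk0
    have hne : ∀ j, I l < j → j < I l + N → j ≠ I l + k0 → F (l + 1) j = F (l + 1) (j + 1) := by
      intro j hj1 hj2 hj3
      refine hpath (l + 1) j hl ?_ ?_
      · rintro ⟨-, h⟩
        rcases lt_or_ge (I l + k0) j with h4 | h4
        · have := hmod (I (l + 1)) (j - (I l + k0)) (hI _) (by omega) (by omega)
          rw [← hk3, Nat.mod_add_mod, Nat.add_sub_cancel' h4.le] at this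
          exact this (h.trans hk3.symm)
        · have := hmod (j % N) (I l + k0 - j) (Nat.mod_lt _ hN) (by omega) (by omega)
          rw [Nat.mod_add_mod, Nat.add_sub_cancel' h4] at this
          exact this (hk3.trans h.symm)
      · rintro ⟨-, h⟩
        have := hmod (I l) (j - I l) (hI l) (by omega) (by omega)
        rw [Nat.add_sub_cancel' (by omega)] at this
        exact this h
    rcases le_or_gt k k0 with h | h
    · rw [k2]
      exact (hrun (l + 1) (I l + 1) (I l + k) (fun j _ _ => hne j (by omega) (by omega) (by omega))
        (by omega)).symm
    · rw [k1, ← hper (l + 1) (I l)]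
      exact hrun (l + 1) _ _ (fun j _ _ => hne j (by omega) (by omega) (by omega)) (by omega)

variable {R : Type*} [AddCommGroup R] {a b : R} {d N : ℕ} {I : ℕ → ℕ}

lemma Coordinates.add_period (h : Coordinates a b d N) (l i : ℕ) :
    l • b + (i + N) • a = l • b + i • a := by
  rw [add_nsmul, h.period, add_zero]

lemma Coordinates.mod (h : Coordinates a b d N) (l i : ℕ) :
    l • b + (i % N) • a = l • b + i • a := by
  conv_rhs => rw [← Nat.mod_add_div i N, add_nsmul, mul_comm, mul_nsmul', h.period]
  simp

lemma Coordinates.inj_mod (h : Coordinates a b d N) (hN : 0 < N) {l i l' i' : ℕ} (hl : l < d)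
    (hl' : l' < d) (he : l • b + i • a = l' • b + i' • a) : l = l' ∧ i % N = i' % N := by
  rw [← h.mod l, ← h.mod l'] at he
  exact h.inj _ _ _ _ hl (Nat.mod_lt _ hN) hl' (Nat.mod_lt _ hN) he

/-- The switching points. -/
def switchSet (a b : R) (d : ℕ) (I : ℕ → ℕ) (x : R) : Prop :=
  ∃ j, j + 2 ≤ d ∧ x = j • b + I j • a

lemma Coordinates.switchSet_iff (h : Coordinates a b d N) (hI : ∀ l, I l < N) {l i : ℕ}
    (hl : l < d) : switchSet a b d I (l • b + i • a) ↔ l + 2 ≤ d ∧ i % N = I l := by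
  have hN : 0 < N := (Nat.zero_le _).trans_lt (hI 0)
  constructor
  · rintro ⟨j, hj, he⟩
    obtain ⟨rfl, h2⟩ := h.inj_mod hN hl (by omega) he
    exact ⟨hj, by rw [h2, Nat.mod_eq_of_lt (hI _)]⟩
  · rintro ⟨h1, h2⟩
    exact ⟨l, h1, by rw [← h2, h.mod]⟩

lemma Coordinates.switch_isolated (h : Coordinates a b d N) (hN : 2 ≤ N) (hI : ∀ l, I l < N)
    (hII : ∀ l, I l ≠ I (l + 1)) (x : R) (hx : switchSet a b d I x) :
    ¬ switchSet a b d I (x + a) ∧ ¬ switchSet a b d I (x + b) := by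
  obtain ⟨j, hj, rfl⟩ := hx
  have e1 : j • b + I j • a + a = j • b + (I j + 1) • a := by rw [succ_nsmul]; abel
  have e2 : j • b + I j • a + b = (j + 1) • b + I j • a := by rw [succ_nsmul]; abel
  rw [e1, e2, h.switchSet_iff hI (by omega), h.switchSet_iff hI (by omega)]
  constructor
  · rintro ⟨-, h2⟩
    have := hI j
    rcases lt_or_ge (I j + 1) N with h1 | h1
    · rw [Nat.mod_eq_of_lt h1] at h2; omega
    · rw [show I j + 1 = N by omega, Nat.mod_self] at h2; omega
  · rintro ⟨-, h2⟩
    rw [Nat.mod_eq_of_lt (hI j)] at h2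
    exact hII j h2

lemma Coordinates.switch_connected (h : Coordinates a b d N) (hI : ∀ l, I l < N)
    (hII : ∀ l, I l ≠ I (l + 1)) (f : R → Prop)
    (h1 : ∀ x, ¬ switchSet a b d I x → ¬ switchSet a b d I (x - b) → f x = f (x + a))
    (h2 : ∀ x, switchSet a b d I x → f x = f (x + b) ∧ f (x + a) = f (x + a + b)) (x y : R) :
    f x = f y := by
  have hN : 0 < N := (Nat.zero_le _).trans_lt (hI 0)
  have key := levels_connected (F := fun l i => f (l • b + i • a)) (I := I) (d := d) hN
    (fun l i => by simp only [h.add_period]) hI hII ?_ ?_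
  · have : ∀ x, f x = f ((0 : ℕ) • b + (0 : ℕ) • a) := by
      intro x
      obtain ⟨l, i, hl, hi, rfl⟩ := h.exists_eq x
      exact key l i hl hi
    rw [this x, this y]
  · intro l i hl n1 n2
    have e1 : l • b + (i + 1) • a = l • b + i • a + a := by rw [succ_nsmul]; abel
    simp only [e1]
    refine h1 _ ?_ ?_
    · rwa [h.switchSet_iff hI hl]
    · rcases Nat.eq_zero_or_pos l with rfl | hl0
      · obtain ⟨e, he⟩ := h.wrap
        have hd : d = (d - 1) + 1 := by omega
        rw [hd, succ_nsmul] at he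
        have : (0 : ℕ) • b + i • a - b = (d - 1) • b + (i + (N * e - e)) • a := by
          have e3 : (N * e - e) • a + e • a = 0 := by
            rw [← add_nsmul, Nat.sub_add_cancel (Nat.le_mul_of_pos_left e hN), mul_comm,
              mul_nsmul', h.period, nsmul_zero]
          rw [add_nsmul, eq_neg_of_add_eq_zero_left e3, ← he]
          simp only [zero_nsmul]
          abel
        rw [this, h.switchSet_iff hI (by omega)]
        omega
      · have : l • b + i • a - b = (l - 1) • b + i • a := by
          conv_lhs => rw [show l = (l - 1) + 1 by omega, succ_nsmul]
          abel
        rw [this, h.switchSet_iff hI (by omega)]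
        rintro ⟨-, h4⟩
        exact n2 ⟨hl0, h4⟩
  · intro l hl
    have e1 : l • b + (I l + 1) • a = l • b + I l • a + a := by rw [succ_nsmul]; abel
    have e2 : (l + 1) • b + (I l + 1) • a = l • b + I l • a + a + b := by
      rw [succ_nsmul, succ_nsmul]; abel
    have e3 : (l + 1) • b + I l • a = l • b + I l • a + b := by rw [succ_nsmul]; abel
    simp only [e1, e2, e3]
    exact h2 _ ⟨l, hl, rfl⟩

end Coordinates

section UnitStep

lemma run_const {F : ℕ → Prop} {s t : ℕ}
    (h : ∀ j, s ≤ j → j < t → F j = F (j + 1)) : ∀ i, s ≤ i → i ≤ t → F i = F s := by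
  intro i hi
  induction i, hi using Nat.le_induction with
  | base => exact fun _ => rfl
  | succ i hi ih => exact fun h' => by rw [← h i hi (by omega), ih (by omega)]

lemma three_columns_connected {F : ℕ → Prop} {n a d : ℕ} (hd : 2 ≤ d) (hda : d ≤ a)
    (hn : 2 * a + d ≤ n) (hwrap : F n = F 0)
    (hstep : ∀ i < n, ¬ (i + 2 ≤ d ∧ i % 2 = 0) → ¬ (a ≤ i ∧ i - a + 2 ≤ d) →
      ¬ (2 * a ≤ i ∧ i - 2 * a + 2 ≤ d ∧ (i - 2 * a) % 2 = 1) → F i = F (i + 1))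
    (heven : ∀ j, j + 2 ≤ d → j % 2 = 0 → F j = F (a + j) ∧ F (j + 1) = F (a + (j + 1)))
    (hodd : ∀ j, j + 2 ≤ d → j % 2 = 1 → F (a + j) = F (2 * a + j) ∧
      F (a + (j + 1)) = F (2 * a + (j + 1))) :
    ∀ i ≤ n, F i = F 0 := by
  have s0 : ∀ j, j + 2 ≤ d → j % 2 = 1 → F j = F (j + 1) := fun j h1 h2 =>
    hstep j (by omega) (by omega) (by omega) (by omega)
  have s2 : ∀ j, j + 2 ≤ d → j % 2 = 0 → F (2 * a + j) = F (2 * a + (j + 1)) := fun j h1 h2 =>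
    hstep _ (by omega) (by omega) (by omega) (by omega)
  have mid : ∀ j, 1 ≤ j → j + 2 ≤ d →
      F j = F 1 ∧ F (a + j) = F 1 ∧ F (2 * a + j) = F 1 := by
    intro j hj
    induction j, hj using Nat.le_induction with
    | base =>
      intro h
      have e1 := heven 0 (by omega) rfl
      have e2 := hodd 1 h rfl
      exact ⟨rfl, e1.2.symm, by rw [← e2.1, ← e1.2]⟩
    | succ j hj ih =>
      intro h
      obtain ⟨i0, i1, i2⟩ := ih (by omega)
      rcases Nat.mod_two_eq_zero_or_one j with hp | hp
      · have e1 := heven j (by omega) hp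
        have e2 := hodd (j + 1) h (by omega)
        have e3 := s2 j (by omega) hp
        rw [i2] at e3
        rw [← e3] at e2
        rw [e2.1] at e1
        exact ⟨e1.2, e2.1, e3.symm⟩
      · have e1 := hodd j (by omega) hp
        have e2 := heven (j + 1) h (by omega)
        have e3 := s0 j (by omega) hp
        rw [i0] at e3
        rw [← e3] at e2
        rw [← e2.1] at e1
        exact ⟨e3.symm, e2.1.symm, e1.2.symm⟩
  have h00 := heven 0 (by omega) rfl
  have A0 := run_const (F := F) (s := d - 1) (t := a)
    fun j _ _ => hstep j (by omega) (by omega) (by omega) (by omega)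
  have A1 := run_const (F := F) (s := a + (d - 1)) (t := 2 * a)
    fun j _ _ => hstep j (by omega) (by omega) (by omega) (by omega)
  have A2 := run_const (F := F) (s := 2 * a + (d - 1)) (t := n)
    fun j _ _ => hstep j (by omega) (by omega) (by omega) (by omega)
  have B0 : F (d - 1) = F 0 := by rw [← A0 a (by omega) le_rfl, h00.1]; rfl
  have B2 : F (2 * a + (d - 1)) = F 0 := by rw [← A2 n (by omega) le_rfl, hwrap]
  have B1' : F (a + (d - 1)) = F (2 * a + 1) := by
    rw [← A1 (2 * a) (by omega) le_rfl]
    exact s2 0 (by omega) rfl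
  have B : F (a + (d - 1)) = F 0 ∧ (3 ≤ d → F 1 = F 0) := by
    rcases Nat.lt_or_ge d 3 with h | h
    · refine ⟨?_, fun h' => by omega⟩
      rw [B1', ← B2]
      congr 1
      omega
    · have m1 := mid 1 le_rfl (by omega)
      have m2 := mid (d - 2) (by omega) (by omega)
      have hM : F 1 = F 0 := by
        rcases Nat.mod_two_eq_zero_or_one d with hp | hp
        · rw [← m2.2.2, s2 (d - 2) (by omega) (by omega), ← B2]
          congr 1; omega
        · rw [← m2.1, s0 (d - 2) (by omega) (by omega), ← B0]
          congr 1; omega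
      exact ⟨by rw [B1', m1.2.2, hM], fun _ => hM⟩
  intro i hi
  by_cases c1 : i = 0
  · rw [c1]
  by_cases c2 : i + 2 ≤ d
  · rw [(mid i (by omega) c2).1, B.2 (by omega)]
  by_cases c3 : i ≤ a
  · rw [A0 i (by omega) c3, B0]
  by_cases c4 : i + 2 ≤ a + d
  · obtain ⟨j, rfl⟩ : ∃ j, i = a + j := ⟨i - a, by omega⟩
    rw [(mid j (by omega) (by omega)).2.1, B.2 (by omega)]
  by_cases c5 : i ≤ 2 * a
  · rw [A1 i (by omega) c5, B.1]
  by_cases c6 : i + 2 ≤ 2 * a + d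
  · obtain ⟨j, rfl⟩ : ∃ j, i = 2 * a + j := ⟨i - 2 * a, by omega⟩
    rw [(mid j (by omega) (by omega)).2.2, B.2 (by omega)]
  · rw [A2 i (by omega) hi, B2]

lemma zmod_natCast_inj {n i j : ℕ} (hi : i < n) (hj : j < n) (h : (i : ZMod n) = j) : i = j := by
  rw [ZMod.natCast_eq_natCast_iff] at h
  exact Nat.ModEq.eq_of_lt_of_lt h hi hj

lemma zmod_add_self_ne_zero {n i : ℕ} (h0 : 0 < i) (h : 2 * i < n) :
    (i : ZMod n) + i ≠ 0 := by
  rw [← Nat.cast_add, Ne, ZMod.natCast_eq_zero_iff]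
  exact Nat.not_dvd_of_pos_of_lt (by omega) (by omega)

lemma zmod_add_ne_zero {n i j : ℕ} (h0 : 0 < i) (h : i + j < n) :
    (i : ZMod n) + j ≠ 0 := by
  rw [← Nat.cast_add, Ne, ZMod.natCast_eq_zero_iff]
  exact Nat.not_dvd_of_pos_of_lt (by omega) h

lemma cov_pm_isUnit {n : ℕ} [NeZero n] {u : ZMod n} (hu : IsUnit u) :
    Cov (fun x y => y = x + u ∨ x = y + u) 2 := by
  refine ((cov_isUnit hu).append (cov_isUnit hu.neg)).mono fun x y h => ?_
  rcases h with h | h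
  · exact Or.inl h
  · exact Or.inr (by rw [h]; simp)

lemma cov_pm_pm_isUnit {n : ℕ} [NeZero n] {u v : ZMod n} (hu : IsUnit u) (hv : IsUnit v) :
    Cov (fun x y => y = x + u ∨ x = y + u ∨ y = x + v ∨ x = y + v) 4 :=
  ((cov_pm_isUnit hu).append (cov_pm_isUnit hv)).mono fun x y h => by
    rcases h with h | h | h | h
    · exact Or.inl (Or.inl h)
    · exact Or.inl (Or.inr h)
    · exact Or.inr (Or.inl h)
    · exact Or.inr (Or.inr h)

/-- The circulant digraph with connection set `±1, ±a` is covered by four directed Hamiltonian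
cycles. -/
theorem cov_one_pm {n a : ℕ} [NeZero n] (ha : 2 ≤ a) (han : 2 * a < n) :
    Cov (fun x y : ZMod n => y = x + (a : ZMod n) ∨ x = y + (a : ZMod n) ∨
      y = x + 1 ∨ x = y + 1) 4 := by
  have hn : 0 < n := by omega
  set d := Nat.gcd a n with hd
  have hdn : d ∣ n := Nat.gcd_dvd_right a n
  have hda : d ∣ a := Nat.gcd_dvd_left a n
  have hdpos : 0 < d := Nat.gcd_pos_of_pos_right a hn
  by_cases hd1 : d = 1
  · exact cov_pm_pm_isUnit ((ZMod.isUnit_iff_coprime a n).2 hd1) isUnit_one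
  have hdle : d ≤ a := Nat.le_of_dvd (by omega) hda
  have hdle2 : 2 * a + d ≤ n := by
    have : d ∣ n - 2 * a := Nat.dvd_sub hdn (hda.mul_left 2)
    have := Nat.le_of_dvd (by omega) this
    omega
  have hc := coordinates_zmod hn a 1 (Nat.gcd_one_right _)
  rw [← hd, Nat.cast_one] at hc
  have hN : 3 ≤ n / d := by
    rw [Nat.le_div_iff_mul_le hdpos]; omega
  have hI : ∀ l : ℕ, l % 2 < n / d := fun l => by omega
  have hII : ∀ l : ℕ, l % 2 ≠ (l + 1) % 2 := fun l => by omega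
  have h1a : ((1 : ℕ) : ZMod n) = 1 := Nat.cast_one
  have Qcast : ∀ j : ℕ, j • (1 : ZMod n) + (j % 2) • (a : ZMod n) = ((j + j % 2 * a : ℕ) : ZMod n) :=
    fun j => by push_cast; simp
  have hlt : ∀ j, j + 2 ≤ d → j + j % 2 * a < n := fun j hj => by
    rcases Nat.mod_two_eq_zero_or_one j with hp | hp <;> rw [hp] <;> omega
  have Qiff : ∀ i : ℕ, i < n → (switchSet (a : ZMod n) 1 d (fun l => l % 2) (i : ZMod n) ↔
      ∃ j, j + 2 ≤ d ∧ i = j + j % 2 * a) := fun i hi => by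
    constructor
    · rintro ⟨j, hj, h⟩
      rw [Qcast] at h
      exact ⟨j, hj, zmod_natCast_inj hi (hlt j hj) h⟩
    · rintro ⟨j, hj, h⟩
      exact ⟨j, hj, by rw [Qcast, h]⟩
  refine cov_switch (a : ZMod n) 1 (switchSet (a : ZMod n) 1 d fun l => l % 2)
    (zmod_add_self_ne_zero (by omega) han) ?_ ?_ ?_
    (hc.switch_isolated (by omega) hI hII) (fun f => hc.switch_connected hI hII f) ?_
  · simpa using zmod_add_self_ne_zero (n := n) (i := 1) (by omega) (by omega)
  · intro h
    have := zmod_natCast_inj (n := n) (i := a) (j := 1) (by omega) (by omega) (by simpa using h)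
    omega
  · simpa using zmod_add_ne_zero (n := n) (i := a) (j := 1) (by omega) (by omega)
  · intro f h1 h2
    have key := three_columns_connected (F := fun i => f (i : ZMod n)) (n := n) (a := a) (d := d)
      (by omega) hdle hdle2 (by simp) ?_ ?_ ?_
    · have : ∀ x, f x = f 0 := fun x => by
        have := key x.val (ZMod.val_lt x).le
        simpa using this
      intro x y
      rw [this x, this y]
    · intro i hi n1 n2 n3
      have h1' := h1 (i : ZMod n) ?_ ?_
      · simpa using h1'
      · rw [Qiff i hi]
        rintro ⟨j, hj, hij⟩
        rcases Nat.mod_two_eq_zero_or_one j with hp | hp <;> rw [hp] at hij <;> omega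
      · rcases lt_or_ge i a with hia | hia
        · have e : (i : ZMod n) - a = ((i + n - a : ℕ) : ZMod n) := by
            rw [Nat.cast_sub (by omega)]; simp
          rw [e, Qiff _ (by omega)]
          rintro ⟨j, hj, hij⟩
          rcases Nat.mod_two_eq_zero_or_one j with hp | hp <;> rw [hp] at hij <;> omega
        · rw [← Nat.cast_sub hia, Qiff _ (by omega)]
          rintro ⟨j, hj, hij⟩
          rcases Nat.mod_two_eq_zero_or_one j with hp | hp <;> rw [hp] at hij <;> omega
    · intro j hj hp
      have := h2 (j : ZMod n) ((Qiff j (by omega)).2 ⟨j, hj, by rw [hp]; simp⟩)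
      refine ⟨?_, ?_⟩
      · simpa [add_comm] using this.1
      · have := this.2
        push_cast
        rwa [add_comm (a : ZMod n)]
    · intro j hj hp
      have := h2 ((a + j : ℕ) : ZMod n) ((Qiff _ (by omega)).2 ⟨j, hj, by rw [hp]; omega⟩)
      push_cast at this ⊢
      rw [show (2 : ZMod n) * a + j = a + j + a by ring,
        show (2 : ZMod n) * a + (j + 1) = a + j + 1 + a by ring, ← add_assoc (a : ZMod n) j 1]
      exact this

end UnitStep

section Staircase

lemma staircase_connected {F : ℕ → ℕ → Prop} {z e N : ℕ} (hz : 2 ≤ z) (hz2 : z % 2 = 0)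
    (he : 3 ≤ e) (he2 : e % 2 = 1) (hN : z + e ≤ N) (hwrap : ∀ c, F c N = F c 0)
    (hstep : ∀ c l, c < e → l < N → ¬ (l ≤ z ∧ (l % 2 = c ∨ l % 2 + 1 = c)) →
      ¬ (z < l ∧ l + 2 ≤ z + e ∧ (l = z + c ∨ l + 1 = z + c)) → F c l = F c (l + 1))
    (heven : ∀ j ≤ z, j % 2 = 0 → F 0 j = F 1 j ∧ F 0 (j + 1) = F 1 (j + 1))
    (hodd : ∀ j ≤ z, j % 2 = 1 → F 1 j = F 2 j ∧ F 1 (j + 1) = F 2 (j + 1))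
    (hstair : ∀ c, 1 ≤ c → c + 2 ≤ e → F c (z + c) = F (c + 1) (z + c) ∧
      F c (z + c + 1) = F (c + 1) (z + c + 1)) :
    ∀ c l, c < e → l ≤ N → F c l = F 0 0 := by
  have up : ∀ c l, c < e → z + c + 1 ≤ l → l ≤ N → F c l = F c 0 := by
    intro c l hc h1 h2
    have := run_const (F := F c) (s := z + c + 1) (t := N)
      fun j _ _ => hstep c j hc (by omega) (by omega) (by omega)
    rw [this l h1 h2, ← hwrap, this N (by omega) le_rfl]
  have low : ∀ c l, 3 ≤ c → c < e → l + 1 ≤ z + c → F c l = F c 0 := by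
    intro c l h3 hc h2
    exact run_const (F := F c) (s := 0) (t := z + c - 1)
      (fun j _ _ => hstep c j hc (by omega) (by omega) (by omega)) l (by omega) (by omega)
  have top : F (e - 1) (z + e - 1) = F (e - 1) 0 := by
    rw [hstep (e - 1) (z + e - 1) (by omega) (by omega) (by omega) (by omega)]
    exact up _ _ (by omega) (by omega) (by omega)
  have single : ∀ c, 1 ≤ c → c + 2 ≤ e → F (c + 1) (z + (c + 1)) = F c 0 := by
    intro c h1 h2
    rw [← add_assoc, ← (hstair c h1 h2).2]
    exact up _ _ (by omega) (by omega) (by omega)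
  have skip : ∀ c, 1 ≤ c → c + 3 ≤ e → F c 0 = F (c + 2) 0 := by
    intro c h1 h2
    rw [← single c h1 (by omega), (hstair (c + 1) (by omega) (by omega)).1]
    exact low _ _ (by omega) (by omega) (by omega)
  have O1 : F 1 0 = F 0 0 := (heven 0 (by omega) rfl).1.symm
  have Oodd : ∀ k, 2 * k + 1 < e → F (2 * k + 1) 0 = F 0 0 := by
    intro k
    induction k with
    | zero => exact fun _ => O1
    | succ k ih =>
      intro h
      rw [← ih (by omega)]
      exact (skip (2 * k + 1) (by omega) (by omega)).symm
  have Olast : F (e - 1) 0 = F 0 0 := by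
    rw [← Oodd ((e - 3) / 2) (by omega), 
      ← single (2 * ((e - 3) / 2) + 1) (by omega) (by omega), ← top]
    congr 1 <;> omega
  have Oeven : ∀ k, 2 * k + 2 < e → F (e - 1 - 2 * k) 0 = F 0 0 := by
    intro k
    induction k with
    | zero => exact fun _ => Olast
    | succ k ih =>
      intro h
      rw [← ih (by omega), skip _ (by omega) (by omega)]
      congr 1
      omega
  have O : ∀ c < e, F c 0 = F 0 0 := by
    intro c hc
    rcases Nat.mod_two_eq_zero_or_one c with hp | hp
    · rcases Nat.eq_zero_or_pos c with rfl | h0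
      · rfl
      · rw [← Oeven ((e - 1 - c) / 2) (by omega)]
        congr 1; omega
    · rw [← Oodd (c / 2) (by omega)]
      congr 1; omega
  have c0 : ∀ j ≤ z, j % 2 = 1 → F 0 j = F 0 (j + 1) := fun j h1 h2 =>
    hstep 0 j (by omega) (by omega) (by omega) (by omega)
  have c2 : ∀ j ≤ z, j % 2 = 0 → F 2 j = F 2 (j + 1) := fun j h1 h2 =>
    hstep 2 j (by omega) (by omega) (by omega) (by omega)
  have mid : ∀ j, 1 ≤ j → j ≤ z → F 0 j = F 0 1 ∧ F 1 j = F 0 1 ∧ F 2 j = F 0 1 := by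
    intro j hj
    induction j, hj using Nat.le_induction with
    | base =>
      intro h
      have e1 := heven 0 (by omega) rfl
      have e2 := hodd 1 h rfl
      exact ⟨rfl, e1.2.symm, by rw [← e2.1, ← e1.2]⟩
    | succ j hj ih =>
      intro h
      obtain ⟨i0, i1, i2⟩ := ih (by omega)
      rcases Nat.mod_two_eq_zero_or_one j with hp | hp
      · have e1 := heven j (by omega) hp
        have e2 := hodd (j + 1) h (by omega)
        have e3 := c2 j (by omega) hp
        rw [i2] at e3
        rw [← e3] at e2
        rw [e2.1] at e1
        exact ⟨e1.2, e2.1, e3.symm⟩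
      · have e1 := hodd j (by omega) hp
        have e2 := heven (j + 1) h (by omega)
        have e3 := c0 j (by omega) hp
        rw [i0] at e3
        rw [← e3] at e2
        rw [← e2.1] at e1
        exact ⟨e3.symm, e2.1.symm, e1.2.symm⟩
  have z01 : F 1 (z + 1) = F 0 0 := by
    rw [← (heven z le_rfl hz2).2]
    exact up 0 _ (by omega) (by omega) (by omega)
  have z02 : F 2 (z + 1) = F 0 0 := by
    rw [← z01]
    exact (hstair 1 le_rfl he).1.symm
  have hM : F 0 1 = F 0 0 := by
    rw [← (mid z (by omega) le_rfl).2.2, c2 z le_rfl hz2, z02]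
  intro c l hc hl
  by_cases h1 : z + c + 1 ≤ l
  · rw [up c l hc h1 hl, O c hc]
  by_cases h2 : l = z + c
  · rcases Nat.lt_or_ge c 2 with h3 | h3
    · interval_cases c
      · rw [h2, (mid (z + 0) (by omega) (by omega)).1, hM]
      · rw [h2, z01]
    · obtain ⟨c, rfl⟩ : ∃ c', c = c' + 1 := ⟨c - 1, by omega⟩
      rw [h2, single c (by omega) (by omega), O c (by omega)]
  rcases Nat.lt_or_ge c 3 with h3 | h3
  · rcases Nat.eq_zero_or_pos l with rfl | h0
    · exact O c hc
    by_cases hlz : l ≤ z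
    · have := mid l h0 hlz
      interval_cases c
      · rw [this.1, hM]
      · rw [this.2.1, hM]
      · rw [this.2.2, hM]
    · have hc2 : c = 2 := by omega
      have hl1 : l = z + 1 := by omega
      rw [hc2, hl1, z02]
  · rw [low c l h3 hc (by omega), O c hc]

lemma cov_pair_of_gcd {n a b : ℕ} [NeZero n] (hb0 : 0 < b) (hab : a ≠ b)
    (han : 2 * a < n) (hbn : 2 * b < n) (hn2 : n % 2 = 1)
    (hco : Nat.Coprime a b) (he : 3 ≤ Nat.gcd b n) (hde : Nat.gcd b n < Nat.gcd a n) :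
    Cov (fun x y : ZMod n => y = x + (a : ZMod n) ∨ x = y + (a : ZMod n) ∨
      y = x + (b : ZMod n) ∨ x = y + (b : ZMod n)) 4 := by
  have hn : 0 < n := by omega
  have ha0 : 0 < a := Nat.pos_of_ne_zero fun h => by
    have : b = 1 := by simpa [h] using hco
    rw [this] at he; simp at he
  have hca := coordinates_zmod hn a b (by
    rw [Nat.gcd_right_comm, hco]; simp)
  have hcb := coordinates_zmod hn b a (by
    rw [Nat.gcd_right_comm, hco.symm]; simp)
  set d := Nat.gcd a n with hd
  set e := Nat.gcd b n with he'
  have hdn : d ∣ n := Nat.gcd_dvd_right a n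
  have hen : e ∣ n := Nat.gcd_dvd_right b n
  have hda : d ∣ a := Nat.gcd_dvd_left a n
  have hoddn : Odd n := Nat.odd_iff.2 hn2
  have hd2 : d % 2 = 1 := Nat.odd_iff.1 (hoddn.of_dvd_nat hdn)
  have he2 : e % 2 = 1 := Nat.odd_iff.1 (hoddn.of_dvd_nat hen)
  have hcode : Nat.Coprime d e :=
    (hco.coprime_dvd_left (Nat.gcd_dvd_left a n)).coprime_dvd_right (Nat.gcd_dvd_left b n)
  have hdiv : d * e ∣ n := hcode.mul_dvd_of_dvd_of_dvd hdn hen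
  have hdele : d * e ≤ n := Nat.le_of_dvd hn hdiv
  have hN1 : e ≤ n / d := by rw [Nat.le_div_iff_mul_le (by omega)]; rwa [mul_comm]
  have hN2 : d ≤ n / e := by rwa [Nat.le_div_iff_mul_le (by omega)]
  obtain ⟨z, hz⟩ : ∃ z, d = z + e := ⟨d - e, by omega⟩
  set I : ℕ → ℕ := fun l => if l ≤ z then l % 2 else if l + 2 ≤ d then l - z else l % 2 with hIdef
  have hIe : ∀ l, I l + 2 ≤ e := fun l => by simp only [hIdef]; split_ifs <;> omega
  have hI : ∀ l, I l < n / d := fun l => by have := hIe l; omega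
  have hII : ∀ l, I l ≠ I (l + 1) := fun l => by
    simp only [hIdef]; split_ifs <;> omega
  have hI1 : ∀ l ≤ z, I l = l % 2 := fun l h => if_pos h
  have hI2 : ∀ l, z < l → l + 2 ≤ d → I l = l - z := fun l h1 h2 => by
    simp only [hIdef]
    rw [if_neg (by omega), if_pos h2]
  refine cov_switch (a : ZMod n) b (switchSet (a : ZMod n) b d I)
    (zmod_add_self_ne_zero ha0 han) (zmod_add_self_ne_zero hb0 hbn) ?_
    (zmod_add_ne_zero ha0 (by omega))
    (hca.switch_isolated (by omega) hI hII) (fun f => hca.switch_connected hI hII f) ?_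
  · intro h
    exact hab (zmod_natCast_inj (by omega) (by omega) h)
  · intro f h1 h2
    have Qiff : ∀ c l, c < e → (switchSet (a : ZMod n) b d I (c • (a : ZMod n) + l • (b : ZMod n)) ↔
        l % (n / e) + 2 ≤ d ∧ I (l % (n / e)) = c) := by
      intro c l hc
      constructor
      · rintro ⟨j, hj, h⟩
        rw [add_comm (j • (b : ZMod n))] at h
        obtain ⟨r1, r2⟩ := hcb.inj_mod (by omega) hc (by have := hIe j; omega) h
        rw [Nat.mod_eq_of_lt (show j < n / e by omega)] at r2
        rw [r2]
        exact ⟨hj, r1.symm⟩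
      · rintro ⟨h1, h2⟩
        exact ⟨_, h1, by rw [h2, ← hcb.mod c, add_comm]⟩
    have key := staircase_connected (F := fun c l => f (c • (a : ZMod n) + l • (b : ZMod n)))
      (z := z) (e := e) (N := n / e) (by omega) (by omega) he he2 (by omega) ?_ ?_ ?_ ?_ ?_
    · have : ∀ x, f x = f ((0 : ℕ) • (a : ZMod n) + (0 : ℕ) • (b : ZMod n)) := by
        intro x
        obtain ⟨l, i, hl, hi, rfl⟩ := hcb.exists_eq x
        exact key l i hl hi.le
      intro x y
      rw [this x, this y]
    · intro c
      have := hcb.add_period c 0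
      rw [zero_add] at this
      simp only [this]
    · intro c l hc hl n1 n2
      have e1 : c • (a : ZMod n) + (l + 1) • (b : ZMod n) =
        c • (a : ZMod n) + l • (b : ZMod n) + b := by rw [succ_nsmul]; abel
      simp only [e1]
      have split : ∀ k, l + 2 ≤ d → I l = k → (l ≤ z ∧ l % 2 = k) ∨ (z < l ∧ l = z + k) := by
        intro k h1 h2
        rcases le_or_gt l z with h | h
        · left; rw [hI1 l h] at h2; exact ⟨h, h2⟩
        · right; rw [hI2 l h h1] at h2; exact ⟨h, by omega⟩
      refine h1 _ ?_ ?_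
      · rw [Qiff c l hc, Nat.mod_eq_of_lt hl]
        rintro ⟨h3, h4⟩
        have := split c h3 h4
        omega
      · rcases Nat.eq_zero_or_pos c with rfl | hc0
        · obtain ⟨w, hw⟩ := hcb.wrap
          have e2 : (0 : ℕ) • (a : ZMod n) + l • (b : ZMod n) - a =
              (e - 1) • (a : ZMod n) + (l + (n / e * w - w)) • (b : ZMod n) := by
            have e3 : (n / e * w - w) • (b : ZMod n) + w • (b : ZMod n) = 0 := by
              rw [← add_nsmul, Nat.sub_add_cancel (Nat.le_mul_of_pos_left w (by omega)), mul_comm,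
                mul_nsmul', hcb.period, nsmul_zero]
            rw [show e = (e - 1) + 1 by omega, succ_nsmul] at hw
            rw [add_nsmul, eq_neg_of_add_eq_zero_left e3, ← hw]
            simp only [zero_nsmul]
            abel
          rw [e2, Qiff _ _ (by omega)]
          rintro ⟨-, h4⟩
          have := hIe ((l + (n / e * w - w)) % (n / e))
          omega
        · have e2 : c • (a : ZMod n) + l • (b : ZMod n) - a =
              (c - 1) • (a : ZMod n) + l • (b : ZMod n) := by
            conv_lhs => rw [show c = (c - 1) + 1 by omega, succ_nsmul]
            abel
          rw [e2, Qiff _ _ (by omega), Nat.mod_eq_of_lt hl]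
          rintro ⟨h3, h4⟩
          have := split _ h3 h4
          omega
    all_goals
      have link : ∀ c l, l + 2 ≤ d → I l = c →
          f (c • (a : ZMod n) + l • (b : ZMod n)) = f ((c + 1) • (a : ZMod n) + l • (b : ZMod n)) ∧
          f (c • (a : ZMod n) + (l + 1) • (b : ZMod n)) =
            f ((c + 1) • (a : ZMod n) + (l + 1) • (b : ZMod n)) := by
        intro c l h3 h4
        have := h2 (c • (a : ZMod n) + l • (b : ZMod n)) ⟨l, h3, by rw [h4, add_comm]⟩
        have e1 : c • (a : ZMod n) + (l + 1) • (b : ZMod n) =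
          c • (a : ZMod n) + l • (b : ZMod n) + b := by rw [succ_nsmul]; abel
        have e2 : (c + 1) • (a : ZMod n) + l • (b : ZMod n) =
          c • (a : ZMod n) + l • (b : ZMod n) + a := by rw [succ_nsmul]; abel
        have e3 : (c + 1) • (a : ZMod n) + (l + 1) • (b : ZMod n) =
          c • (a : ZMod n) + l • (b : ZMod n) + b + a := by rw [succ_nsmul, succ_nsmul]; abel
        rw [e1, e2, e3]
        exact this
    · intro j hj hp
      exact link 0 j (by omega) (by rw [hI1 j hj, hp])
    · intro j hj hp
      exact link 1 j (by omega) (by rw [hI1 j hj, hp])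
    · intro c hc1 hc2
      exact link c (z + c) (by omega) (by rw [hI2 _ (by omega) (by omega)]; omega)

end Staircase

section Intervals

lemma cov_isUnit_pm {n : ℕ} [NeZero n] {u v : ZMod n} (hu : IsUnit u) (hv : v + v ≠ 0)
    (huv : v ≠ u) (huv' : v ≠ -u) :
    Cov (fun x y => y = x + v ∨ x = y + v ∨ y = x + u ∨ x = y + u) 4 := by
  obtain ⟨u, rfl⟩ := hu
  set w : ZMod n := ↑u⁻¹ * v with hw
  have hv' : v = u * w := by rw [hw, Units.mul_inv_cancel_left]
  have hw2 : w + w ≠ 0 := fun h => hv (by rw [hv', ← mul_add, h, mul_zero])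
  have hw1 : w ≠ 1 := fun h => huv (by rw [hv', h, mul_one])
  have hw1' : w ≠ -1 := fun h => huv' (by rw [hv', h, mul_neg, mul_one])
  have hlt := ZMod.val_lt w
  have hne : 2 * w.val ≠ n := fun h => hw2 (by
    have := congrArg (fun i : ℕ => (i : ZMod n)) h
    simpa [two_mul] using this)
  have hval0 : w.val ≠ 0 := fun h => hw2 (by rw [(ZMod.val_eq_zero w).1 h, add_zero])
  have hval1 : w.val ≠ 1 := fun h => hw1 (by
    have := congrArg (fun i : ℕ => (i : ZMod n)) h
    simpa using this)
  have hval1' : w.val + 1 ≠ n := fun h => hw1' (by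
    have := congrArg (fun i : ℕ => (i : ZMod n)) h
    simp at this
    exact eq_neg_of_add_eq_zero_left this)
  have hcov : Cov (fun x y : ZMod n => y = x + w ∨ x = y + w ∨ y = x + 1 ∨ x = y + 1) 4 := by
    rcases lt_or_ge (2 * w.val) n with h | h
    · have := cov_one_pm (n := n) (a := w.val) (by omega) h
      simpa using this
    · have := cov_one_pm (n := n) (a := n - w.val) (by omega) (by omega)
      rw [Nat.cast_sub hlt.le] at this
      refine this.mono fun x y hxy => ?_
      simp only [CharP.cast_eq_zero, ZMod.natCast_val, ZMod.cast_id', id_eq, zero_sub]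
      rcases hxy with h | h | h | h
      · right; left; rw [h]; simp
      · left; rw [h]; simp
      · exact Or.inr (Or.inr (Or.inl h))
      · exact Or.inr (Or.inr (Or.inr h))
  refine (hcov.comap (Units.mulLeft u⁻¹)).mono fun x y hxy => ?_
  simp only [Units.mulLeft_apply]
  rcases hxy with h | h | h | h
  · left; rw [h, mul_add]
  · right; left; rw [h, mul_add]
  · right; right; left; rw [h, mul_add, Units.inv_mul]
  · right; right; right; rw [h, mul_add, Units.inv_mul]

lemma cov_consecutive {n k : ℕ} [NeZero n] (hn : n % 2 = 1) (hk : 1 ≤ k) (hkn : 2 * (k + 1) < n) :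
    Cov (fun x y : ZMod n => y = x + (k : ZMod n) ∨ x = y + (k : ZMod n) ∨
      y = x + ((k + 1 : ℕ) : ZMod n) ∨ x = y + ((k + 1 : ℕ) : ZMod n)) 4 := by
  have hswap : ∀ {a b : ZMod n}, Cov (fun x y => y = x + a ∨ x = y + a ∨ y = x + b ∨ x = y + b) 4 →
      Cov (fun x y => y = x + b ∨ x = y + b ∨ y = x + a ∨ x = y + a) 4 := fun h =>
    h.mono fun x y hxy => by
      rcases hxy with h | h | h | h
      · exact Or.inr (Or.inr (Or.inl h))
      · exact Or.inr (Or.inr (Or.inr h))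
      · exact Or.inl h
      · exact Or.inr (Or.inl h)
  have hodd : Odd n := Nat.odd_iff.2 hn
  have n1 := zmod_add_self_ne_zero (n := n) (i := k) (by omega) (by omega)
  have n2 := zmod_add_self_ne_zero (n := n) (i := k + 1) (by omega) (by omega)
  have n3 : (k : ZMod n) ≠ ((k + 1 : ℕ) : ZMod n) := fun h => by
    have := zmod_natCast_inj (by omega) (by omega) h
    omega
  have n4 : (k : ZMod n) ≠ -((k + 1 : ℕ) : ZMod n) := fun h => by
    have := zmod_add_ne_zero (n := n) (i := k) (j := k + 1) (by omega) (by omega)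
    rw [h] at this
    simp at this
  by_cases h1 : Nat.gcd (k + 1) n = 1
  · exact cov_isUnit_pm ((ZMod.isUnit_iff_coprime (k + 1) n).2 h1) n1 n3 n4
  by_cases h2 : Nat.gcd k n = 1
  · exact hswap (cov_isUnit_pm ((ZMod.isUnit_iff_coprime k n).2 h2) n2 n3.symm
      fun h => n4 (by rw [h, neg_neg]))
  have o1 := Nat.odd_iff.1 (hodd.of_dvd_nat (Nat.gcd_dvd_right (k + 1) n))
  have o2 := Nat.odd_iff.1 (hodd.of_dvd_nat (Nat.gcd_dvd_right k n))
  have hco : Nat.Coprime k (k + 1) := by simp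
  rcases lt_trichotomy (Nat.gcd (k + 1) n) (Nat.gcd k n) with h | h | h
  · exact cov_pair_of_gcd (by omega) (by omega) (by omega) hkn hn hco (by omega) h
  · exfalso
    have : Nat.gcd k n ∣ 1 := by
      rw [← hco]
      exact Nat.dvd_gcd (Nat.gcd_dvd_left k n) (h ▸ Nat.gcd_dvd_left (k + 1) n)
    exact h2 (Nat.dvd_one.1 this)
  · exact hswap (cov_pair_of_gcd (by omega) (by omega) hkn (by omega) hn hco.symm (by omega) h)

lemma cov_interval_odd {n : ℕ} [NeZero n] (hn : n % 2 = 1) (c : ℕ) (hc : 2 * c < n) :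
    Cov (fun x y : ZMod n => ∃ i : ℕ, 1 ≤ i ∧ i ≤ c ∧ (y = x + i ∨ x = y + i)) (2 * c) := by
  induction c using Nat.twoStepInduction with
  | zero => exact Cov.nil.mono fun x y ⟨i, h1, h2, _⟩ => by omega
  | one =>
    refine (cov_pm_isUnit isUnit_one).mono fun x y ⟨i, h1, h2, h3⟩ => ?_
    obtain rfl : i = 1 := by omega
    simpa using h3
  | more c ih _ =>
    refine ((ih (by omega)).append (cov_consecutive hn (k := c + 1) (by omega)
      (by omega))).mono fun x y ⟨i, h1, h2, h3⟩ => ?_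
    rcases Nat.lt_or_ge c i with h | h
    · right
      obtain rfl | rfl : i = c + 1 ∨ i = c + 1 + 1 := by omega
      · rcases h3 with h3 | h3
        · exact Or.inl h3
        · exact Or.inr (Or.inl h3)
      · rcases h3 with h3 | h3
        · exact Or.inr (Or.inr (Or.inl h3))
        · exact Or.inr (Or.inr (Or.inr h3))
    · exact Or.inl ⟨i, h1, h, h3⟩

variable {n : ℕ}

/-- Arcs of an undirected union of two matchings between even and odd residues. -/
def bipartiteArc (π : ZMod n → ZMod 2) (γ : ℤ) (x y : ZMod n) : Prop :=
  (π x = 0 ∧ (y = x + γ ∨ y = x + γ + 2)) ∨ (π x = 1 ∧ (y = x - γ ∨ y = x - γ - 2))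

lemma zmod_two_cases : ∀ a : ZMod 2, a = 0 ∨ a = 1 := by decide

lemma zmod_two_add_self : ∀ a : ZMod 2, a + a = 0 := by decide

lemma exists_shear (π : ZMod n →+* ZMod 2) {γ : ℤ} (hγ : γ % 2 = 1) :
    ∃ e : ZMod n ≃ ZMod n, (∀ x y, bipartiteArc π γ x y → e y = e x + 1 ∨ e x = e y + 1) ∧
      ∀ x z, π z = 0 → e (x + z) = e x + z := by
  have hg : π ((γ : ZMod n) + 1) = 0 := by
    have : ((γ + 1 : ℤ) : ZMod 2) = 0 := by
      rw [ZMod.intCast_zmod_eq_zero_iff_dvd]; push_cast; omega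
    rw [map_add, map_intCast, map_one]
    exact_mod_cast this
  have hg' : π (γ : ZMod n) = 1 := by
    rw [map_add, map_one] at hg
    rw [eq_neg_of_add_eq_zero_left hg]; decide
  have h2 : π 2 = 0 := by rw [map_ofNat]; decide
  have h10 : (1 : ZMod 2) ≠ 0 := by decide
  refine ⟨{ toFun := fun x => if π x = 0 then x else x - (γ + 1)
            invFun := fun x => if π x = 0 then x else x + (γ + 1)
            left_inv := fun x => ?_
            right_inv := fun x => ?_ }, ?_, ?_⟩
  · rcases zmod_two_cases (π x) with h | h
    · simp [h]
    · have : π (x - (γ + 1)) = 1 := by rw [map_sub, hg, h, sub_zero]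
      simp only [h, this, h10, if_false]; ring
  · rcases zmod_two_cases (π x) with h | h
    · simp [h]
    · have : π (x + (γ + 1)) = 1 := by rw [map_add, hg, h, add_zero]
      simp only [h, this, h10, if_false]; ring
  · intro x y hxy
    simp only [Equiv.coe_fn_mk]
    rcases hxy with ⟨h, rfl | rfl⟩ | ⟨h, rfl | rfl⟩
    · right
      have : π (x + γ) = 1 := by rw [map_add, h, hg', zero_add]
      simp only [h, this, h10, if_false, if_true]; ring
    · left
      have : π (x + γ + 2) = 1 := by rw [map_add, map_add, h, hg', h2, zero_add, add_zero]
      simp only [h, this, h10, if_false, if_true]; ring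
    · left
      have : π (x - γ) = 0 := by rw [map_sub, h, hg', sub_self]
      simp only [h, this, h10, if_false, if_true]; ring
    · right
      have : π (x - γ - 2) = 0 := by rw [map_sub, map_sub, h, hg', h2, sub_self, sub_zero]
      simp only [h, this, h10, if_false, if_true]; ring
  · intro x z hz
    simp only [Equiv.coe_fn_mk, map_add, hz, add_zero]
    split_ifs <;> ring

/-- An arc with a small odd difference lies in one of the bipartite graphs. -/
lemma bipartiteArc_of_odd (π : ZMod n →+* ZMod 2) {γ d : ℤ} (hd : d % 2 = 1) (hγ : γ % 2 = 1)
    {x y : ZMod n} (hy : y = x + d) :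
    (π x = 0 → ∀ u : ℕ, (d = γ + 4 * u ∨ d = γ + 4 * u + 2) → bipartiteArc π (γ + 4 * u) x y) ∧
    (π x = 1 → ∀ u : ℕ, (-d = γ + 4 * u ∨ -d = γ + 4 * u + 2) →
      bipartiteArc π (γ + 4 * u) x y) := by
  constructor
  · intro hx u h
    refine Or.inl ⟨hx, ?_⟩
    rcases h with h | h
    · left; rw [hy, h]
    · right; rw [hy, h]; push_cast; ring
  · intro hx u h
    refine Or.inr ⟨hx, ?_⟩
    rcases h with h | h
    · left; rw [hy, show d = -(γ + 4 * u) by omega]; push_cast; ring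
    · right; rw [hy, show d = -(γ + 4 * u) - 2 by omega]; push_cast; ring

variable [NeZero n]

lemma cov_bipartiteArc (π : ZMod n →+* ZMod 2) {γ : ℤ} (hγ : γ % 2 = 1) :
    Cov (bipartiteArc (n := n) π γ) 2 := by
  obtain ⟨e, he, -⟩ := exists_shear π hγ
  exact ((cov_pm_isUnit isUnit_one).comap e).mono he

lemma cov_bipartiteArc_pm (π : ZMod n →+* ZMod 2) {γ : ℤ} (hγ : γ % 2 = 1) {k : ℕ}
    (hk : 1 ≤ k) (hkn : 4 * k < n) :
    Cov (fun x y => bipartiteArc (n := n) π γ x y ∨ y = x + ((2 * k : ℕ) : ZMod n) ∨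
      x = y + ((2 * k : ℕ) : ZMod n)) 4 := by
  obtain ⟨e, he, he2⟩ := exists_shear π hγ
  have hπ : π ((2 * k : ℕ) : ZMod n) = 0 := by
    rw [map_natCast, ZMod.natCast_eq_zero_iff]; exact dvd_mul_right 2 k
  refine ((cov_one_pm (n := n) (a := 2 * k) (by omega) (by omega)).comap e).mono fun x y h => ?_
  rcases h with h | h | h
  · exact Or.inr (Or.inr (he x y h))
  · exact Or.inl (by rw [h, he2 _ _ hπ])
  · exact Or.inr (Or.inl (by rw [h, he2 _ _ hπ]))

lemma cov_bipartiteArcs (π : ZMod n →+* ZMod 2) {γ : ℤ} (hγ : γ % 2 = 1) (p : ℕ)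
    (hp : 4 * p < n) :
    Cov (fun x y => ∃ u < p, bipartiteArc (n := n) π (γ + 4 * u) x y ∨
      y = x + ((2 * (u + 1) : ℕ) : ZMod n) ∨ x = y + ((2 * (u + 1) : ℕ) : ZMod n)) (4 * p) := by
  induction p with
  | zero => exact Cov.nil.mono fun x y ⟨u, h, _⟩ => by omega
  | succ p ih =>
    refine ((ih (by omega)).append (cov_bipartiteArc_pm π (γ := γ + 4 * p) (k := p + 1) (by omega)
      (by omega) (by omega))).mono fun x y ⟨u, h, hu⟩ => ?_
    rcases Nat.lt_or_ge u p with h' | h'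
    · exact Or.inl ⟨u, h', hu⟩
    · obtain rfl : u = p := by omega
      exact Or.inr hu

lemma cov_interval_even (hn : n % 2 = 0) (c : ℕ) (hc : 2 * c < n) :
    Cov (fun x y : ZMod n => ∃ i : ℕ, 1 ≤ i ∧ i ≤ c ∧ (y = x + i ∨ x = y + i)) (2 * c) := by
  set π := ZMod.castHom (Nat.dvd_of_mod_eq_zero hn) (ZMod 2)
  obtain ⟨p, hp⟩ : ∃ p, c = 2 * p ∨ c = 2 * p + 1 := ⟨c / 2, by omega⟩
  have key : ∀ γ : ℤ, γ % 2 = 1 → ∀ x y : ZMod n, ∀ i : ℕ, i % 2 = 1 →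
      (y = x + i ∨ x = y + i) → (i : ℤ) ≤ -γ →
      ∃ u : ℕ, (4 * u : ℤ) ≤ i - γ ∧ bipartiteArc π (γ + 4 * u) x y := by
    intro γ hγ x y i hi hxy hle
    have pos : ∀ d : ℤ, d % 2 = 1 → d ≤ i → -d ≤ i → y = x + d →
        ∃ u : ℕ, (4 * u : ℤ) ≤ i - γ ∧ bipartiteArc π (γ + 4 * u) x y := by
      intro d hd h1 h2 hy
      have := bipartiteArc_of_odd π hd hγ hy
      rcases zmod_two_cases (π x) with h | h
      · exact ⟨((d - γ) / 4).toNat, by omega, this.1 h _ (by omega)⟩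
      · exact ⟨((-d - γ) / 4).toNat, by omega, this.2 h _ (by omega)⟩
    rcases hxy with h | h
    · exact pos i (by omega) (by omega) (by omega) (by simpa using h)
    · exact pos (-i) (by omega) (by omega) (by omega) (by rw [h]; simp)
  have even : ∀ x y : ZMod n, ∀ i : ℕ, 1 ≤ i → i ≤ c → i % 2 = 0 → (y = x + i ∨ x = y + i) →
      ∃ u < p, y = x + ((2 * (u + 1) : ℕ) : ZMod n) ∨ x = y + ((2 * (u + 1) : ℕ) : ZMod n) := by
    intro x y i h1 h2 h3 h4
    exact ⟨i / 2 - 1, by omega, by rwa [show 2 * (i / 2 - 1 + 1) = i by omega]⟩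
  rcases hp with hp | hp
  · rw [show 2 * c = 4 * p by omega]
    refine (cov_bipartiteArcs π (γ := -(c - 1)) (by omega) p (by omega)).mono
      fun x y ⟨i, h1, h2, h3⟩ => ?_
    rcases Nat.mod_two_eq_zero_or_one i with hi | hi
    · obtain ⟨u, hu, hu'⟩ := even x y i h1 h2 hi h3
      exact ⟨u, hu, Or.inr hu'⟩
    · obtain ⟨u, hu, hu'⟩ := key (-(c - 1)) (by omega) x y i hi h3 (by omega)
      exact ⟨u, by omega, Or.inl hu'⟩
  · rw [show 2 * c = 4 * p + 2 by omega]
    refine ((cov_bipartiteArcs π (γ := -c) (by omega) p (by omega)).append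
      (cov_bipartiteArc π (γ := -c + 4 * p) (by omega))).mono fun x y ⟨i, h1, h2, h3⟩ => ?_
    rcases Nat.mod_two_eq_zero_or_one i with hi | hi
    · obtain ⟨u, hu, hu'⟩ := even x y i h1 h2 hi h3
      exact Or.inl ⟨u, hu, Or.inr hu'⟩
    · obtain ⟨u, hu, hu'⟩ := key (-c) (by omega) x y i hi h3 (by omega)
      rcases Nat.lt_or_ge u p with h | h
      · exact Or.inl ⟨u, h, Or.inl hu'⟩
      · obtain rfl : u = p := by omega
        exact Or.inr hu'

theorem cov_interval (c : ℕ) (hc : 2 * c < n) :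
    Cov (fun x y : ZMod n => ∃ i : ℕ, 1 ≤ i ∧ i ≤ c ∧ (y = x + i ∨ x = y + i)) (2 * c) := by
  rcases Nat.mod_two_eq_zero_or_one n with h | h
  · exact cov_interval_even h c hc
  · exact cov_interval_odd h c hc

end Intervals

section SpecialInterval

variable {n : ℕ} [NeZero n]

lemma fullCycle_alternating (π : ZMod n →+* ZMod 2) {α β : ZMod n} (hα : π α = 1) (hβ : π β = 1)
    (hgen : ∀ x, π x = 0 → ∃ k : ℕ, x = k * (α + β)) :
    FullCycle (fun x => if π x = 0 then x + α else x + β) := by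
  have h10 : (1 : ZMod 2) ≠ 0 := by decide
  set f : ZMod n → ZMod n := fun x => if π x = 0 then x + α else x + β with hf
  have hπ : ∀ x, π (f x) = π x + 1 := fun x => by
    simp only [hf]; split_ifs <;> simp [hα, hβ]
  have hinj : Function.Injective f := by
    intro x y hxy
    have h1 : π x = π y := by
      have := hπ x
      rw [hxy, hπ y] at this
      exact (add_right_cancel this).symm
    simp only [hf, h1] at hxy
    split_ifs at hxy <;> exact add_right_cancel hxy
  have hiter : ∀ k : ℕ, f^[2 * k] 0 = k * (α + β) := by
    intro k
    induction k with
    | zero => simp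
    | succ k ih =>
      rw [show 2 * (k + 1) = (2 * k + 1) + 1 by ring, Function.iterate_succ_apply',
        Function.iterate_succ_apply', ih]
      have e1 : π (k * (α + β)) = 0 := by
        rw [map_mul, map_add, hα, hβ, zmod_two_add_self, mul_zero]
      have e2 : f (k * (α + β)) = k * (α + β) + α := if_pos e1
      have e3 : π (k * (α + β) + α) ≠ 0 := by rw [map_add, e1, hα]; decide
      rw [e2]
      simp only [hf]
      rw [if_neg e3]
      push_cast; ring
  refine fullCycle_of_orbit hinj 0 fun y => ?_
  rcases zmod_two_cases (π y) with h | h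
  · obtain ⟨k, hk⟩ := hgen y h
    exact ⟨2 * k, by rw [hiter, hk]⟩
  · have h' : π (y - α) = 0 := by rw [map_sub, h, hα, sub_self]
    obtain ⟨k, hk⟩ := hgen _ h'
    refine ⟨2 * k + 1, ?_⟩
    rw [Function.iterate_succ_apply', hiter, ← hk]
    simp only [hf]
    rw [if_pos h']
    ring

lemma even_multiple {m : ℕ} (hm : m % 2 = 1) (hn : n = 2 * m) (π : ZMod n →+* ZMod 2)
    (w : ℤ) (hw : w = 2 ∨ w = -4) (x : ZMod n) (hx : π x = 0) :
    ∃ k : ℕ, x = k * (w : ZMod n) := by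
  have hv : 2 ∣ x.val := by
    have : π ((x.val : ℕ) : ZMod n) = 0 := by simpa using hx
    rwa [map_natCast, ZMod.natCast_eq_zero_iff] at this
  obtain ⟨v, hv⟩ := hv
  have hx2 : x = 2 * (v : ZMod n) := by
    have : ((x.val : ℕ) : ZMod n) = ((2 * v : ℕ) : ZMod n) := by rw [hv]
    simpa using this
  have key : ∃ k : ℤ, x = k * (w : ZMod n) := by
    rcases hw with rfl | rfl
    · exact ⟨v, by rw [hx2]; push_cast; ring⟩
    · refine ⟨v * ((m - 1) / 2), ?_⟩
      have h2m : (2 : ZMod n) * m = 0 := by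
        have : ((2 * m : ℕ) : ZMod n) = 0 := by rw [← hn]; exact ZMod.natCast_self n
        push_cast at this
        exact this
      obtain ⟨j, hj⟩ : ∃ j : ℕ, m = 2 * j + 1 := ⟨m / 2, by omega⟩
      have : (((m : ℤ) - 1) / 2) = j := by omega
      rw [this, hx2]
      rw [hj] at h2m
      push_cast at h2m ⊢
      linear_combination (v : ZMod n) * h2m
  obtain ⟨k, hk⟩ := key
  refine ⟨((k : ℤ) : ZMod n).val, ?_⟩
  simpa using hk

lemma cov_alternating {m : ℕ} (hm : m % 2 = 1) (hn : n = 2 * m) (π : ZMod n →+* ZMod 2)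
    {a b : ℤ} (ha : a % 2 = 1) (hab : a + b = 2 ∨ a + b = -4) :
    Cov (fun x y : ZMod n => (π x = 0 ∧ y = x + a) ∨ (π x = 1 ∧ y = x + b)) 1 := by
  have hodd : ∀ c : ℤ, c % 2 = 1 → π (c : ZMod n) = 1 := fun c hc => by
    have : ((c - 1 : ℤ) : ZMod 2) = 0 := by
      rw [ZMod.intCast_zmod_eq_zero_iff_dvd]; push_cast; omega
    rw [map_intCast]
    push_cast at this
    exact sub_eq_zero.1 this
  have h10 : (1 : ZMod 2) ≠ 0 := by decide
  refine (Cov.single (fullCycle_alternating π (hodd a ha) (hodd b (by omega))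
    fun x hx => ?_)).mono fun x y h => ?_
  · have := even_multiple hm hn π (a + b) hab x hx
    push_cast at this
    exact this
  · rcases h with ⟨h, rfl⟩ | ⟨h, rfl⟩
    · simp [h]
    · simp [h]

theorem cov_interval_half {m : ℕ} (hm : m % 2 = 1) (hm3 : 3 ≤ m) (hn : n = 2 * m) :
    Cov (fun x y : ZMod n => (∃ i : ℕ, 1 ≤ i ∧ i ≤ m - 2 ∧ (y = x + i ∨ x = y + i)) ∨
      y = x + (m : ZMod n)) (2 * m - 3) := by
  set π := ZMod.castHom (show 2 ∣ n by omega) (ZMod 2)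
  obtain ⟨p, hp⟩ : ∃ p, m = 2 * p + 3 := ⟨(m - 3) / 2, by omega⟩
  have hmm : (m : ZMod n) + m = 0 := by
    have : ((2 * m : ℕ) : ZMod n) = 0 := by rw [← hn]; exact ZMod.natCast_self n
    push_cast at this
    rw [← two_mul]; exact this
  set g : ℤ := m - 2 with hg
  have c1 := cov_bipartiteArcs π (γ := -g) (by omega) p (by omega)
  have c2 := cov_alternating hm hn π (a := g) (b := -(g - 2)) (by omega) (by omega)
  have c3 := cov_alternating hm hn π (a := g - 2) (b := -(g + 2)) (by omega) (by omega)
  have c4 := cov_alternating hm hn π (a := g + 2) (b := -g) (by omega) (by omega)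
  have c5 := c1.append (c2.append (c3.append c4))
  rw [show 4 * p + (1 + (1 + 1)) = 2 * m - 3 by omega] at c5
  refine c5.mono fun x y h => ?_
  have pos : ∀ d : ℤ, d % 2 = 1 → (d ≤ g ∨ d = g + 2) → -d ≤ g → y = x + d →
      (∃ u < p, bipartiteArc π (-g + 4 * u) x y) ∨
      ((π x = 0 ∧ y = x + (g : ℤ)) ∨ (π x = 1 ∧ y = x + (-(g - 2) : ℤ))) ∨
      ((π x = 0 ∧ y = x + (g - 2 : ℤ)) ∨ (π x = 1 ∧ y = x + (-(g + 2) : ℤ))) ∨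
      ((π x = 0 ∧ y = x + (g + 2 : ℤ)) ∨ (π x = 1 ∧ y = x + (-g : ℤ))) := by
    intro d hd h1 h2 hy
    have := bipartiteArc_of_odd π hd (γ := -g) (by omega) hy
    rcases zmod_two_cases (π x) with h | h
    · by_cases hA : d = g
      · exact Or.inr (Or.inl (Or.inl ⟨h, by rw [hy, hA]⟩))
      by_cases hB : d = g - 2
      · exact Or.inr (Or.inr (Or.inl (Or.inl ⟨h, by rw [hy, hB]⟩)))
      by_cases hC : d = g + 2
      · exact Or.inr (Or.inr (Or.inr (Or.inl ⟨h, by rw [hy, hC]⟩)))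
      · exact Or.inl ⟨((d + g) / 4).toNat, by omega, this.1 h _ (by omega)⟩
    · by_cases hA : d = -g
      · exact Or.inr (Or.inr (Or.inr (Or.inr ⟨h, by rw [hy, hA]⟩)))
      by_cases hB : d = -(g - 2)
      · exact Or.inr (Or.inl (Or.inr ⟨h, by rw [hy, hB]⟩))
      by_cases hC : d = g + 2
      · refine Or.inr (Or.inr (Or.inl (Or.inr ⟨h, ?_⟩)))
        have e : g + 2 = m := by omega
        rw [hy, hC, e]
        push_cast
        linear_combination hmm
      · exact Or.inl ⟨((-d + g) / 4).toNat, by omega, this.2 h _ (by omega)⟩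
  have fin : ∀ d : ℤ, d % 2 = 1 → (d ≤ g ∨ d = g + 2) → -d ≤ g → y = x + d → _ :=
    fun d h1 h2 h3 h4 => (pos d h1 h2 h3 h4).imp
      (fun ⟨u, hu, h⟩ => (⟨u, hu, Or.inl h⟩ : ∃ u < p, bipartiteArc π (-g + 4 * u) x y ∨
        y = x + ((2 * (u + 1) : ℕ) : ZMod n) ∨ x = y + ((2 * (u + 1) : ℕ) : ZMod n))) id
  rcases h with ⟨i, h1, h2, h3⟩ | h
  · rcases Nat.mod_two_eq_zero_or_one i with hi | hi
    · refine Or.inl ⟨i / 2 - 1, by omega, Or.inr ?_⟩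
      rwa [show 2 * (i / 2 - 1 + 1) = i by omega]
    · rcases h3 with h3 | h3
      · exact fin i (by omega) (by omega) (by omega) (by simpa using h3)
      · exact fin (-i) (by omega) (by omega) (by omega) (by rw [h3]; simp)
  · exact fin m (by omega) (by omega) (by omega) (by simpa using h)

end SpecialInterval

section Zigzag

/-- The kind of permutation needed to extend a solution by one more cycle length `t`: the arcs
inside `ZMod t` have all differences except those in `P`. -/
def StarterFor (m : List ℕ) (t : ℕ) (P : ZMod t → Prop) : Prop :=
  ∀ (S : Type) [Fintype S], Fintype.card S = m.sum →
      ∃ (σ : S ⊕ ZMod t → S ⊕ ZMod t) (bs : List (List (S ⊕ ZMod t))),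
      Realizes σ bs ∧ bs.map List.length = m ++ [t] ∧
      (∀ e, ∃ x, σ (.inl e) = .inr x) ∧ (∀ e, ∃ x, σ (.inr x) = .inl e) ∧
      ∀ d, d ≠ 0 → P d ∨ ∃ x, σ (.inr x) = .inr (x + d)

lemma Sol.extend {m : List ℕ} (hm : Sol m) {t : ℕ} [NeZero t] {P : ZMod t → Prop}
    (hcov : Cov (fun x y => P (y - x)) (m.sum - 1)) (hst : StarterFor m t P) :
    Sol (m ++ [t]) := by
  refine hm.snoc t _ hcov fun S _ hS => ?_
  obtain ⟨σ, bs, h1, h2, h3, h4, h5⟩ := hst S hS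
  refine ⟨σ, bs, h1, h2, h3, h4, fun d hd => (h5 d hd).imp_left fun h x => ?_⟩
  simpa using h

lemma starterFor_of_nat (m : List ℕ) (h2 : ∀ x ∈ m, 2 ≤ x) {t : ℕ} [NeZero t]
    (w : ℕ → ℕ) (len : ℕ) (hwt : ∀ i < len, w i < t)
    (hwinj : ∀ i < len, ∀ j < len, w i = w j → i = j)
    (K : Finset ℕ) (hK : ∀ i ∈ K, i + 1 < len)
    (J : Finset ℕ) (p q : ℕ → ℕ) (hpt : ∀ j ∈ J, p j < t) (hqt : ∀ j ∈ J, q j < t)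
    (hp : ∀ i ∈ J, ∀ j ∈ J, p i = p j → i = j) (hq : ∀ i ∈ J, ∀ j ∈ J, q i = q j → i = j)
    (hpq : ∀ i ∈ J, ∀ j ∈ J, p i ≠ q j) (hpw : ∀ j ∈ J, ∀ i < len, p j ≠ w i)
    (hqw : ∀ j ∈ J, ∀ i < len, q j ≠ w i)
    (hJ : J.card = m.countP (· % 2 = 1)) (hcard : K.card + J.card + m.sum = t)
    (hiso : 2 * len + J.card + m.sum ≤ 2 * t) (P : ZMod t → Prop)
    (hcov : ∀ d : ℕ, 0 < d → d < t → P d ∨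
      (∃ i ∈ K, (w i + d) % t = w (i + 1)) ∨ ∃ j ∈ J, (p j + d) % t = q j) :
    StarterFor m t P := by
  intro S _ hS
  have cinj : ∀ {i j : ℕ}, i < t → j < t → ((i : ZMod t) = j ↔ i = j) := fun hi hj =>
    ⟨zmod_natCast_inj hi hj, fun h => by rw [h]⟩
  set Vl := (List.range len).map fun i => (w i : ZMod t) with hVl
  set U := K.image fun i => (w i : ZMod t) with hU
  set sg := J.toList.map fun j => ((p j : ZMod t), (q j : ZMod t)) with hsg
  have n1 : (sg.flatMap (fun p => [p.1, p.2]) ++ Vl).Nodup := by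
    have mem : ∀ {x : ZMod t} {l : List ℕ}, x ∈ (l.map fun j => ((p j : ZMod t), (q j : ZMod t))
        ).flatMap (fun p => [p.1, p.2]) ↔ ∃ j ∈ l, x = p j ∨ x = q j := by
      intro x l
      simp [List.mem_flatMap]
    rw [List.nodup_append']
    refine ⟨?_, ?_, ?_⟩
    · have : ∀ l : List ℕ, l.Nodup → (∀ j ∈ l, j ∈ J) →
          ((l.map fun j => ((p j : ZMod t), (q j : ZMod t))).flatMap
            (fun p => [p.1, p.2])).Nodup := by
        intro l hl hlJ
        induction l with
        | nil => simp
        | cons a l ih =>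
          rw [List.nodup_cons] at hl
          have haJ := hlJ a (by simp)
          have hlJ' : ∀ j ∈ l, j ∈ J := fun j hj => hlJ j (by simp [hj])
          rw [List.map_cons, List.flatMap_cons, List.nodup_append']
          refine ⟨?_, ih hl.2 hlJ', ?_⟩
          · simpa [cinj (hpt a haJ) (hqt a haJ)] using hpq a haJ a haJ
          · intro x hx hx'
            obtain ⟨j, hj, hxj⟩ := mem.1 hx'
            have hjJ := hlJ' j hj
            have hne : a ≠ j := fun h => hl.1 (h ▸ hj)
            simp only [List.mem_cons, List.not_mem_nil, or_false] at hx
            rcases hx with rfl | rfl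
            · rcases hxj with h | h
              · exact hne (hp _ haJ _ hjJ ((cinj (hpt _ haJ) (hpt _ hjJ)).1 h))
              · exact hpq _ haJ _ hjJ ((cinj (hpt _ haJ) (hqt _ hjJ)).1 h)
            · rcases hxj with h | h
              · exact hpq _ hjJ _ haJ ((cinj (hqt _ haJ) (hpt _ hjJ)).1 h).symm
              · exact hne (hq _ haJ _ hjJ ((cinj (hqt _ haJ) (hqt _ hjJ)).1 h))
      exact this _ J.nodup_toList fun j hj => Finset.mem_toList.1 hj
    · refine List.Nodup.map_on (fun i hi j hj h => ?_) List.nodup_range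
      rw [List.mem_range] at hi hj
      exact hwinj i hi j hj ((cinj (hwt i hi) (hwt j hj)).1 h)
    · intro x hx hx'
      obtain ⟨j, hj, hxj⟩ := mem.1 hx
      obtain ⟨i, hi, rfl⟩ := List.mem_map.1 hx'
      rw [List.mem_range] at hi
      rw [Finset.mem_toList] at hj
      rcases hxj with h | h
      · exact hpw j hj i hi ((cinj (hwt i hi) (hpt j hj)).1 h).symm
      · exact hqw j hj i hi ((cinj (hwt i hi) (hqt j hj)).1 h).symm
  have n2 : ∀ x ∈ U, x ∈ Vl := by
    intro x hx
    obtain ⟨i, hi, rfl⟩ := Finset.mem_image.1 hx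
    have := hK i hi
    exact List.mem_map.2 ⟨i, List.mem_range.2 (by omega), rfl⟩
  have n3 : sg.length = m.countP (· % 2 = 1) := by
    simpa [hsg] using hJ
  have n4 : U.card + sg.length + m.sum = Fintype.card (ZMod t) := by
    rw [hU, Finset.card_image_of_injOn, ZMod.card]
    · simpa [hsg] using hcard
    · intro i hi j hj h
      have h1 := hK i hi
      have h2 := hK j hj
      exact hwinj i (by omega) j (by omega) ((cinj (hwt i (by omega)) (hwt j (by omega))).1 h)
  have n5 : 2 * Vl.length + sg.length + m.sum ≤ 2 * Fintype.card (ZMod t) := by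
    simpa [ZMod.card, hsg, hVl] using hiso
  obtain ⟨σ, bs, s1, s2, s3, s4, s5, s6⟩ := exists_starter (T := ZMod t) (S := S) m h2 hS
    Vl U sg n1 n2 n3 n4 n5
  rw [ZMod.card] at s2
  refine ⟨σ, bs, s1, s2, s3, s4, fun d hd => ?_⟩
  have hd' : d = (d.val : ZMod t) := by simp
  have hd0 : 0 < d.val := Nat.pos_of_ne_zero fun h => hd ((ZMod.val_eq_zero d).1 h)
  have arc : ∀ x y : ℕ, (x + d.val) % t = y → (y : ZMod t) = (x : ZMod t) + d := by
    intro x y h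
    rw [← h, ZMod.natCast_mod, Nat.cast_add, ← hd']
  rcases hcov d.val hd0 (ZMod.val_lt d) with h | ⟨i, hi, h⟩ | ⟨j, hj, h⟩
  · left; rwa [← hd'] at h
  · right
    have hl := hK i hi
    have := s6 i (by simpa [hVl] using hl) (by
      simp only [hVl, List.getElem_map, List.getElem_range]
      exact Finset.mem_image_of_mem _ hi)
    simp only [hVl, List.getElem_map, List.getElem_range] at this
    exact ⟨w i, by rw [this, arc _ _ h]⟩
  · right
    have := s5 (p j, q j) (List.mem_map.2 ⟨j, Finset.mem_toList.2 hj, rfl⟩)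
    exact ⟨p j, by rw [this, arc _ _ h]⟩

/-- The zigzag path through `[c, t / 2) ∪ [t / 2 + c, t)`. -/
def zigzag (t c i : ℕ) : ℕ := if i % 2 = 0 then t - 1 - i / 2 else c + i / 2

/-- Starter for the list `[2]`, even case. -/
lemma starterFor_two_even {t : ℕ} [NeZero t] (ht : 3 ≤ t) (ht2 : t % 2 = 0) :
    StarterFor [2] t (fun d => d = -1) := by
  refine starterFor_of_nat [2] (by simp) (zigzag t 0) (t - 1) ?_ ?_ (Finset.range (t - 2)) ?_ ∅ id id
    (by simp) (by simp) (by simp) (by simp) (by simp) (by simp) (by simp) (by simp) ?_ ?_ _ ?_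
  · intro i hi
    simp only [zigzag]; split_ifs <;> omega
  · intro i hi j hj h
    simp only [zigzag] at h; split_ifs at h <;> omega
  · intro i hi
    rw [Finset.mem_range] at hi; omega
  · simp; omega
  · simp; omega
  · intro d hd hdt
    by_cases h : d = t - 1
    · left
      rw [h, Nat.cast_sub (by omega)]; simp
    · right; left
      rcases Nat.mod_two_eq_zero_or_one d with hp | hp
      · refine ⟨t - d - 1, Finset.mem_range.2 (by omega), ?_⟩
        simp only [zigzag]
        rw [if_neg (by omega), if_pos (by omega), Nat.mod_eq_of_lt (by omega)]
        omega
      · refine ⟨d - 1, Finset.mem_range.2 (by omega), ?_⟩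
        simp only [zigzag]
        rw [if_pos (by omega), if_neg (by omega), Nat.mod_eq_sub_mod (by omega),
          Nat.mod_eq_of_lt (by omega)]
        omega

/-- Starter for the list `[2]`, odd case. -/
lemma starterFor_two_odd {t : ℕ} [NeZero t] (ht : 3 ≤ t) (ht2 : t % 2 = 1) :
    StarterFor [2] t (fun d => d = ((t / 2 : ℕ) : ZMod t)) := by
  obtain ⟨M, hM⟩ : ∃ M, M = t / 2 := ⟨_, rfl⟩
  obtain ⟨κ, hκ⟩ : ∃ κ, κ = M / 2 := ⟨_, rfl⟩
  rw [← hM]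
  set w : ℕ → ℕ := fun i => if i % 2 = 0 then t - 1 - i / 2 else
    if i / 2 < κ then i / 2 else i / 2 + 1 with hw
  refine starterFor_of_nat [2] (by simp) w (t - 1) ?_ ?_ (Finset.range (t - 2)) ?_ ∅ id id
    (by simp) (by simp) (by simp) (by simp) (by simp) (by simp) (by simp) (by simp) ?_ ?_ _ ?_
  · intro i hi
    simp only [hw]; split_ifs <;> omega
  · intro i hi j hj h
    simp only [hw] at h; split_ifs at h <;> omega
  · intro i hi
    rw [Finset.mem_range] at hi; omega
  · simp; omega
  · simp; omega
  · intro d hd hdt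
    by_cases h : d = M
    · left; rw [h]
    · right; left
      have low : ∀ j, j + 2 < t → j % 2 = 0 → (j / 2 < κ ∧ d = j + 1 ∨ κ ≤ j / 2 ∧ d = j + 2) →
          ∃ i ∈ Finset.range (t - 2), (w i + d) % t = w (i + 1) := by
        intro j h1 h2 h3
        refine ⟨j, Finset.mem_range.2 (by omega), ?_⟩
        simp only [hw]
        rw [if_pos h2, if_neg (by omega), Nat.mod_eq_sub_mod (by omega),
          Nat.mod_eq_of_lt (by omega)]
        split_ifs <;> omega
      have high : ∀ j, j + 2 < t → j % 2 = 1 →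
          (j / 2 < κ ∧ t = d + j + 1 ∨ κ ≤ j / 2 ∧ t = d + j + 2) →
          ∃ i ∈ Finset.range (t - 2), (w i + d) % t = w (i + 1) := by
        intro j h1 h2 h3
        refine ⟨j, Finset.mem_range.2 (by omega), ?_⟩
        simp only [hw]
        rw [if_neg (by omega), if_pos (by omega : (j + 1) % 2 = 0), Nat.mod_eq_of_lt] <;>
          split_ifs <;> omega
      rcases Nat.mod_two_eq_zero_or_one d with hp | hp
      · by_cases hk : 2 * κ + 2 ≤ d
        · exact low (d - 2) (by omega) (by omega) (by omega)
        · exact high (t - d - 2) (by omega) (by omega) (by omega)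
      · by_cases hk : d < 2 * κ + 1
        · exact low (d - 1) (by omega) (by omega) (by omega)
        · exact high (t - d - 1) (by omega) (by omega) (by omega)

end Zigzag

/-- Left endpoints of the pairs of free vertices that carry the differences near `t / 2`. -/
def spread (h j₀ j : ℕ) : ℕ := if (h + j₀ + j) % 2 = 0 then (h + j₀ - j) / 2 else (3 * h + 1 + j₀ - j) / 2

lemma spread_le {h j₀ j : ℕ} (h1 : j₀ ≤ j + h) (h2 : j ≤ j₀ + h) : spread h j₀ j ≤ 2 * h := by
  unfold spread; split_ifs <;> omega

lemma spread_inj {h j₀ i j : ℕ} (h1 : j₀ ≤ j + h) (h2 : j ≤ j₀ + h) (h3 : j₀ ≤ i + h)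
    (h4 : i ≤ j₀ + h) (e : spread h j₀ i = spread h j₀ j) : i = j := by
  unfold spread at e; split_ifs at e <;> omega

lemma spread_add {h j₀ j : ℕ} (h1 : j₀ ≤ j + h) (h2 : j ≤ j₀ + h) :
    spread h j₀ j + j = spread h j j₀ + j₀ := by
  unfold spread; split_ifs <;> omega

lemma spread_inj' {h j₀ i j : ℕ} (h1 : j₀ ≤ j + h) (h2 : j ≤ j₀ + h) (h3 : j₀ ≤ i + h)
    (h4 : i ≤ j₀ + h) (e : spread h i j₀ = spread h j j₀) : i = j := by
  unfold spread at e; split_ifs at e <;> omega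

/-- A starter from a family of arcs along a path: the arcs in `R` are deleted from the path, and
those in `J ⊆ R` are replaced by arcs of the same difference between free vertices. -/
lemma starterFor_of_arcs (m : List ℕ) (h2 : ∀ x ∈ m, 2 ≤ x) {t c M h L : ℕ} [NeZero t]
    (hM : M = t / 2) (hcM : c + 1 ≤ M) (hL : L + 2 * c + 1 = t) (hhc : 2 * h + 1 ≤ c)
    (w f : ℕ → ℕ) (hwt : ∀ i ≤ L, w i < t) (hwinj : ∀ i ≤ L, ∀ j ≤ L, w i = w j → i = j)
    (hwc : ∀ i ≤ L, c ≤ w i ∧ (w i < M ∨ M + c ≤ w i))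
    (pos : ℕ → Prop) [DecidablePred pos]
    (J R : Finset ℕ) (hRL : ∀ j ∈ R, j < L)
    (hJ1 : ∀ j ∈ J, M - c - 1 ≤ j + h) (hJ2 : ∀ j ∈ J, j ≤ M - c - 1 + h)
    (hfL : ∀ j < L, j ∉ R → f j < L)
    (hfinj : ∀ i < L, i ∉ R → ∀ j < L, j ∉ R → f i = f j → i = j)
    (hf : ∀ j < L, j ∉ R → (w (f j) + if pos j then c + 1 + j else t - (c + 1 + j)) % t = w (f j + 1))
    (hD : ∀ d, c < d → d + c < t → ∃ j < L, d = if pos j then c + 1 + j else t - (c + 1 + j))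
    (hJ : J.card = m.countP (· % 2 = 1)) (hcard : L + J.card + m.sum = t + R.card)
    (hiso : J.card + m.sum ≤ 4 * c) (P : ZMod t → Prop)
    (hP : ∀ i : ℕ, 1 ≤ i → i ≤ c → P i ∧ P (-i))
    (hPR : ∀ j ∈ R, j ∉ J → P ((if pos j then c + 1 + j else t - (c + 1 + j) : ℕ) : ZMod t)) :
    StarterFor m t P := by
  set j₀ := M - c - 1 with hj₀
  have sp1 : ∀ j ∈ J, spread h j₀ j < c := fun j hj => by
    have := spread_le (hJ1 j hj) (hJ2 j hj); omega
  have sp2 : ∀ j ∈ J, spread h j j₀ < c := fun j hj => by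
    have := spread_le (h := h) (j₀ := j) (j := j₀) (by have := hJ2 j hj; omega)
      (by have := hJ1 j hj; omega)
    omega
  have sp3 : ∀ i ∈ J, ∀ j ∈ J, spread h j₀ i = spread h j₀ j → i = j := fun i hi j hj e =>
    spread_inj (hJ1 j hj) (hJ2 j hj) (hJ1 i hi) (hJ2 i hi) e
  have sp4 : ∀ i ∈ J, ∀ j ∈ J, spread h i j₀ = spread h j j₀ → i = j := fun i hi j hj e =>
    spread_inj' (hJ1 j hj) (hJ2 j hj) (hJ1 i hi) (hJ2 i hi) e
  have sp5 : ∀ j ∈ J, spread h j₀ j + j = spread h j j₀ + j₀ := fun j hj =>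
    spread_add (hJ1 j hj) (hJ2 j hj)
  refine starterFor_of_nat m h2 w (L + 1) (fun i hi => hwt i (by omega))
    (fun i hi j hj => hwinj i (by omega) j (by omega)) ((Finset.range L \ R).image f) ?_ J
    (fun j => if pos j then spread h j₀ j else M + spread h j j₀)
    (fun j => if pos j then M + spread h j j₀ else spread h j₀ j) ?_ ?_ ?_ ?_ ?_ ?_ ?_ hJ ?_ ?_ P ?_
  · intro i hi
    simp only [Finset.mem_image, Finset.mem_sdiff, Finset.mem_range] at hi
    obtain ⟨j, ⟨hj, hjR⟩, rfl⟩ := hi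
    have := hfL j hj hjR; omega
  · intro j hj
    have := sp1 j hj; have := sp2 j hj
    split_ifs <;> omega
  · intro j hj
    have := sp1 j hj; have := sp2 j hj
    split_ifs <;> omega
  · intro i hi j hj e
    have := sp1 j hj; have := sp2 j hj; have := sp1 i hi; have := sp2 i hi
    split_ifs at e
    · exact sp3 i hi j hj e
    · omega
    · omega
    · exact sp4 i hi j hj (by omega)
  · intro i hi j hj e
    have := sp1 j hj; have := sp2 j hj; have := sp1 i hi; have := sp2 i hi
    split_ifs at e
    · exact sp4 i hi j hj (by omega)
    · omega
    · omega
    · exact sp3 i hi j hj e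
  · intro i hi j hj e
    have := sp1 j hj; have := sp2 j hj; have := sp1 i hi; have := sp2 i hi
    split_ifs at e with h1 h2 h2
    · omega
    · exact h2 (sp3 i hi j hj e ▸ h1)
    · exact h1 (sp4 i hi j hj (by omega) ▸ h2)
    · omega
  · intro j hj i hi e
    have := sp1 j hj; have := sp2 j hj; have := hwc i (by omega)
    split_ifs at e <;> omega
  · intro j hj i hi e
    have := sp1 j hj; have := sp2 j hj; have := hwc i (by omega)
    split_ifs at e <;> omega
  · rw [Finset.card_image_of_injOn, Finset.card_sdiff_of_subset, Finset.card_range]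
    · have : R.card ≤ L := by
        have := Finset.card_le_card (s := R) (t := Finset.range L) fun j hj => by
          simpa using hRL j hj
        simpa using this
      omega
    · intro j hj; simpa using hRL j hj
    · intro i hi j hj e
      simp only [Finset.coe_sdiff, Finset.coe_range, Set.mem_sdiff, Set.mem_Iio,
        Finset.mem_coe] at hi hj
      exact hfinj i hi.1 hi.2 j hj.1 hj.2 e
  · omega
  · intro d hd hdt
    by_cases h1 : d ≤ c
    · exact .inl (hP d hd h1).1
    by_cases h2 : t ≤ d + c
    · left
      have := (hP (t - d) (by omega) (by omega)).2
      rw [Nat.cast_sub hdt.le] at this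
      simpa using this
    obtain ⟨j, hjL, hj⟩ := hD d (by omega) (by omega)
    by_cases hjR : j ∈ R
    · by_cases hjJ : j ∈ J
      · right; right
        refine ⟨j, hjJ, ?_⟩
        have := sp1 j hjJ; have := sp2 j hjJ; have := sp5 j hjJ
        split_ifs at hj ⊢
        · rw [Nat.mod_eq_of_lt] <;> omega
        · rw [show M + spread h j j₀ + d = spread h j₀ j + t by omega, Nat.add_mod_right,
            Nat.mod_eq_of_lt (by omega)]
      · left
        rw [hj]; exact hPR j hjR hjJ
    · right; left
      refine ⟨f j, ?_, ?_⟩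
      · exact Finset.mem_image_of_mem _ (by simp [hjL, hjR])
      · rw [hj]; exact hf j hjL hjR

lemma zigzag_spec {t c M L i : ℕ} (hM : M = t / 2) (hL : L + 2 * c + 1 = t)
    (hi : i ≤ L) : zigzag t c i < t ∧ c ≤ zigzag t c i ∧ (zigzag t c i < M ∨ M + c ≤ zigzag t c i) := by
  unfold zigzag; split_ifs <;> omega

lemma zigzag_inj {t c L i j : ℕ} (hL : L + 2 * c + 1 = t)
    (hi : i ≤ L) (hj : j ≤ L) (h : zigzag t c i = zigzag t c j) : i = j := by
  unfold zigzag at h; split_ifs at h <;> omega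

lemma zigzag_step {t c L j : ℕ} (hL : L + 2 * c + 1 = t) (hj : j < L) :
    (j % 2 = 0 → (zigzag t c j + (c + 1 + j)) % t = zigzag t c (j + 1)) ∧
    (¬ j % 2 = 0 → (zigzag t c j + (t - (c + 1 + j))) % t = zigzag t c (j + 1)) ∧
    (¬ j % 2 = 0 → (zigzag t c (j + 1) + (c + 1 + j)) % t = zigzag t c j) ∧
    (j % 2 = 0 → (zigzag t c (j + 1) + (t - (c + 1 + j))) % t = zigzag t c j) := by
  have hl : ∀ {a b : ℕ}, a = b → b < t → a % t = b := fun h1 h2 => by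
    rw [h1, Nat.mod_eq_of_lt h2]
  have hr : ∀ {a b : ℕ}, a = b + t → b < t → a % t = b := fun h1 h2 => by
    rw [h1, Nat.add_mod_right, Nat.mod_eq_of_lt h2]
  refine ⟨fun h => ?_, fun h => ?_, fun h => ?_, fun h => ?_⟩
  · simp only [zigzag, if_pos h, if_neg (show ¬ (j + 1) % 2 = 0 by omega)]
    exact hr (by omega) (by omega)
  · simp only [zigzag, if_neg h, if_pos (show (j + 1) % 2 = 0 by omega)]
    exact hl (by omega) (by omega)
  · simp only [zigzag, if_neg h, if_pos (show (j + 1) % 2 = 0 by omega)]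
    exact hr (by omega) (by omega)
  · simp only [zigzag, if_pos h, if_neg (show ¬ (j + 1) % 2 = 0 by omega)]
    exact hl (by omega) (by omega)

lemma starterFor_even (m : List ℕ) (h2 : ∀ x ∈ m, 2 ≤ x) {t c M h L : ℕ} [NeZero t]
    (ht : t % 2 = 0)
    (hM : M = t / 2) (hcM : c + 1 ≤ M) (hL : L + 2 * c + 1 = t) (hhc : 2 * h + 1 ≤ c)
    (J R : Finset ℕ) (hRL : ∀ j ∈ R, j < L)
    (hJ1 : ∀ j ∈ J, M - c - 1 ≤ j + h) (hJ2 : ∀ j ∈ J, j ≤ M - c - 1 + h)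
    (hJ : J.card = m.countP (· % 2 = 1)) (hcard : L + J.card + m.sum = t + R.card)
    (hiso : J.card + m.sum ≤ 4 * c) (P : ZMod t → Prop)
    (hP : ∀ i : ℕ, 1 ≤ i → i ≤ c → P i ∧ P (-i))
    (hPR : ∀ j ∈ R, j ∉ J → P ((if j % 2 = 0 then c + 1 + j else t - (c + 1 + j) : ℕ) : ZMod t)) :
    StarterFor m t P := by
  refine starterFor_of_arcs m h2 hM hcM hL hhc (zigzag t c) id
    (fun i hi => (zigzag_spec hM hL hi).1) (fun i hi j hj => zigzag_inj hL hi hj)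
    (fun i hi => (zigzag_spec hM hL hi).2) (fun j => j % 2 = 0) J R hRL hJ1 hJ2
    (fun j hj _ => hj) (fun i _ _ j _ _ e => e) ?_ ?_ hJ hcard hiso P hP hPR
  · intro j hj _
    obtain ⟨z1, z2, -, -⟩ := zigzag_step hL hj
    dsimp only [id]
    split_ifs with hj2
    · exact z1 hj2
    · exact z2 hj2
  · intro d hd hdt
    by_cases hp : (d - c - 1) % 2 = 0
    · exact ⟨d - c - 1, by omega, by rw [if_pos hp]; omega⟩
    · exact ⟨t - d - c - 1, by omega, by rw [if_neg (by omega)]; omega⟩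

lemma starterFor_odd (m : List ℕ) (h2 : ∀ x ∈ m, 2 ≤ x) {t c M h L : ℕ} [NeZero t]
    (ht : t % 2 = 1)
    (hM : M = t / 2) (hcM : c + 1 ≤ M) (hL : L + 2 * c + 1 = t) (hhc : 2 * h + 1 ≤ c)
    (J R : Finset ℕ) (hRL : ∀ j ∈ R, j < L) (hR : M - c - 1 ∈ R)
    (hJ1 : ∀ j ∈ J, M - c - 1 ≤ j + h) (hJ2 : ∀ j ∈ J, j ≤ M - c - 1 + h)
    (hJ : J.card = m.countP (· % 2 = 1)) (hcard : L + J.card + m.sum = t + R.card)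
    (hiso : J.card + m.sum ≤ 4 * c) (P : ZMod t → Prop)
    (hP : ∀ i : ℕ, 1 ≤ i → i ≤ c → P i ∧ P (-i))
    (hPR : ∀ j ∈ R, j ∉ J → P ((if (j ≤ M - c - 1 ↔ j % 2 = 0) then c + 1 + j
      else t - (c + 1 + j) : ℕ) : ZMod t)) :
    StarterFor m t P := by
  set j₀ := M - c - 1 with hj₀
  refine starterFor_of_arcs m h2 hM hcM hL hhc
    (fun i => zigzag t c (if i ≤ j₀ then i else L + j₀ + 1 - i))
    (fun j => if j ≤ j₀ then j else L + j₀ - j)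
    (fun i hi => (zigzag_spec hM hL (by split_ifs <;> omega)).1)
    (fun i hi j hj e => ?_)
    (fun i hi => (zigzag_spec hM hL (by split_ifs <;> omega)).2)
    (fun j => j ≤ j₀ ↔ j % 2 = 0) J R hRL hJ1 hJ2
    ?_ ?_ ?_ ?_ hJ hcard hiso P hP hPR
  · have := zigzag_inj hL (by split_ifs <;> omega) (by split_ifs <;> omega) e
    split_ifs at this <;> omega
  · intro j hj _
    split_ifs <;> omega
  · intro i hi hiR j hj hjR e
    split_ifs at e <;> omega
  · intro j hj hjR
    have hne : j ≠ j₀ := fun h => hjR (h ▸ hR)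
    obtain ⟨z1, z2, z3, z4⟩ := zigzag_step hL hj
    rcases lt_or_gt_of_ne hne with hlt | hlt
    · rw [if_pos (show j ≤ j₀ by omega), if_pos (show j ≤ j₀ by omega),
        if_pos (show j + 1 ≤ j₀ by omega)]
      by_cases hj2 : j % 2 = 0
      · rw [if_pos (by omega)]; exact z1 hj2
      · rw [if_neg (by omega)]; exact z2 hj2
    · rw [if_neg (show ¬ j ≤ j₀ by omega), if_neg (show ¬ L + j₀ - j ≤ j₀ by omega),
        if_neg (show ¬ L + j₀ - j + 1 ≤ j₀ by omega),
        show L + j₀ + 1 - (L + j₀ - j) = j + 1 by omega,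
        show L + j₀ + 1 - (L + j₀ - j + 1) = j by omega]
      by_cases hj2 : j % 2 = 0
      · rw [if_neg (by omega)]; exact z4 hj2
      · rw [if_pos (by omega)]; exact z3 hj2
  · intro d hd hdt
    by_cases hp : (d - c - 1 ≤ j₀ ↔ (d - c - 1) % 2 = 0)
    · exact ⟨d - c - 1, by omega, by rw [if_pos hp]; omega⟩
    · exact ⟨t - d - c - 1, by omega, by rw [if_neg (by omega)]; omega⟩

lemma countP_odd_mod_two (m : List ℕ) : m.countP (· % 2 = 1) % 2 = m.sum % 2 := by
  induction m with
  | nil => rfl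
  | cons a l ih =>
    rw [List.countP_cons, List.sum_cons]
    by_cases h : a % 2 = 1 <;> simp [h] <;> omega

lemma exists_erased_interval {h j₀ : ℕ} (hh : h ≤ j₀) (u : ℕ) :
    ∃ J : Finset ℕ, J.card = 2 * h ∧ u ∉ J ∧ ∀ j ∈ J, j₀ ≤ j + h ∧ j ≤ j₀ + h := by
  refine ⟨(Finset.Icc (j₀ - h) (j₀ + h)).erase
    (if u ∈ Finset.Icc (j₀ - h) (j₀ + h) then u else j₀), ?_, ?_, ?_⟩
  · rw [Finset.card_erase_of_mem, Nat.card_Icc]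
    · omega
    · split_ifs with hu
      · exact hu
      · simp
  · split_ifs with hu
    · simp
    · simp only [Finset.mem_erase]; tauto
  · intro j hj
    simp only [Finset.mem_erase, Finset.mem_Icc] at hj
    omega

lemma isUnit_natCast_sub {t x : ℕ} (hx : x ≤ t) (h : IsUnit (x : ZMod t)) :
    IsUnit ((t - x : ℕ) : ZMod t) := by
  rw [Nat.cast_sub hx]; simpa using h

lemma cov_short {t c : ℕ} [NeZero t] (hc : 2 * c < t) :
    Cov (fun x y : ZMod t => ∃ i : ℕ, 1 ≤ i ∧ i ≤ c ∧ (y - x = i ∨ y - x = -i)) (2 * c) := by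
  refine (cov_interval c hc).mono ?_
  rintro x y ⟨i, h1, h2, h | h⟩
  · exact ⟨i, h1, h2, .inl (sub_eq_iff_eq_add'.1 h)⟩
  · exact ⟨i, h1, h2, .inr (by rw [sub_eq_iff_eq_add'.1 h]; ring)⟩

lemma cov_short_isUnit {t c : ℕ} [NeZero t] (hc : 2 * c < t) {u : ZMod t} (hu : IsUnit u) :
    Cov (fun x y : ZMod t => (∃ i : ℕ, 1 ≤ i ∧ i ≤ c ∧ (y - x = i ∨ y - x = -i)) ∨ y - x = u)
      (2 * c + 1) :=
  ((cov_short hc).append (cov_isUnit hu)).mono fun _ _ h => h.imp_right fun h =>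
    sub_eq_iff_eq_add'.1 h

lemma cov_short_half {t M c : ℕ} [NeZero t] (hM : M % 2 = 1) (hc : M = c + 2)
    (ht : t = 2 * M) :
    Cov (fun x y : ZMod t => (∃ i : ℕ, 1 ≤ i ∧ i ≤ c ∧ (y - x = i ∨ y - x = -i)) ∨ y - x = (M : ℕ))
      (2 * c + 1) := by
  have := cov_interval_half hM (by omega) ht
  rw [show 2 * M - 3 = 2 * c + 1 by omega] at this
  refine this.mono ?_
  rintro x y (⟨i, h1, h2, h | h⟩ | h)
  · exact .inl ⟨i, h1, by omega, .inl (sub_eq_iff_eq_add'.1 h)⟩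
  · exact .inl ⟨i, h1, by omega, .inr (by rw [sub_eq_iff_eq_add'.1 h]; ring)⟩
  · exact .inr (sub_eq_iff_eq_add'.1 h)

/-- Appending a long cycle to a solution whose total length is odd. -/
lemma Sol.append_of_odd {m : List ℕ} (hm : Sol m) (h2 : ∀ x ∈ m, 2 ≤ x) (hs : 3 ≤ m.sum)
    (hodd : m.sum % 2 = 1) {t : ℕ} [NeZero t]
    (ht : m.sum + m.countP (· % 2 = 1) < t - t % 2) : Sol (m ++ [t]) := by
  have hq2 := countP_odd_mod_two m
  have hq3 := three_mul_countP_odd_le m h2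
  set q := m.countP (· % 2 = 1) with hq
  have hJ : ((Finset.Icc (t / 2 - (m.sum - 1) / 2 - 1 - q / 2)
      (t / 2 - (m.sum - 1) / 2 - 1 + q / 2))).card = q := by
    rw [Nat.card_Icc]; omega
  have hcov := cov_short (t := t) (c := (m.sum - 1) / 2) (by omega)
  rw [show 2 * ((m.sum - 1) / 2) = m.sum - 1 by omega] at hcov
  refine hm.extend (P := fun d => ∃ i : ℕ, 1 ≤ i ∧ i ≤ (m.sum - 1) / 2 ∧ (d = i ∨ d = -i)) hcov ?_
  set c := (m.sum - 1) / 2 with hc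
  set J := Finset.Icc (t / 2 - c - 1 - q / 2) (t / 2 - c - 1 + q / 2) with hJdef
  have hJmem : ∀ j ∈ J, t / 2 - c - 1 ≤ j + q / 2 ∧ j ≤ t / 2 - c - 1 + q / 2 := fun j hj => by
    rw [hJdef, Finset.mem_Icc] at hj; omega
  rcases Nat.mod_two_eq_zero_or_one t with ht2 | ht2
  · refine starterFor_even m h2 (c := c) (M := t / 2) (h := q / 2) (L := t - 2 * c - 1) ht2 rfl
      (by omega) (by omega) (by omega) J J (fun j hj => ?_) (fun j hj => (hJmem j hj).1)
      (fun j hj => (hJmem j hj).2) hJ (by omega) (by omega) _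
      (fun i h1 h2 => ⟨⟨i, h1, h2, .inl rfl⟩, ⟨i, h1, h2, .inr rfl⟩⟩) (fun j hj h => absurd hj h)
    have := hJmem j hj; omega
  · refine starterFor_odd m h2 (c := c) (M := t / 2) (h := q / 2) (L := t - 2 * c - 1) ht2 rfl
      (by omega) (by omega) (by omega) J J (fun j hj => ?_) (by rw [hJdef, Finset.mem_Icc]; omega)
      (fun j hj => (hJmem j hj).1)
      (fun j hj => (hJmem j hj).2) hJ (by omega) (by omega) _
      (fun i h1 h2 => ⟨⟨i, h1, h2, .inl rfl⟩, ⟨i, h1, h2, .inr rfl⟩⟩) (fun j hj h => absurd hj h)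
    have := hJmem j hj; omega

lemma exists_even_drop {t M c : ℕ} [NeZero t] (ht : t = 2 * M) (hc : 1 ≤ c) (hcM : c + 2 ≤ M) :
    ∃ u, u + 2 * c + 1 < t ∧
      Cov (fun x y : ZMod t => (∃ i : ℕ, 1 ≤ i ∧ i ≤ c ∧ (y - x = i ∨ y - x = -i)) ∨
        y - x = ((if u % 2 = 0 then c + 1 + u else t - (c + 1 + u) : ℕ) : ZMod t)) (2 * c + 1) := by
  have key : ∀ {x : ℕ}, x ≤ t → Nat.Coprime x t → ∀ p : Prop, [Decidable p] →
      IsUnit ((if p then x else t - x : ℕ) : ZMod t) := by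
    intro x hx hxt p _
    have := (ZMod.isUnit_iff_coprime x t).2 hxt
    split_ifs
    · exact this
    · exact isUnit_natCast_sub hx this
  rcases Nat.mod_two_eq_zero_or_one M with hM | hM
  · refine ⟨M - c, by omega, cov_short_isUnit (by omega) ?_⟩
    rw [show c + 1 + (M - c) = M + 1 by omega]
    refine key (by omega) ?_ _
    rw [ht]
    refine Nat.Coprime.mul_right ?_ (by simp)
    rw [Nat.coprime_two_right, Nat.odd_iff]; omega
  · by_cases hsp : M = c + 2
    · refine ⟨1, by omega, ?_⟩
      rw [if_neg (by omega), show t - (c + 1 + 1) = M by omega]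
      exact cov_short_half hM hsp ht
    · refine ⟨M - c + 1, by omega, cov_short_isUnit (by omega) ?_⟩
      rw [show c + 1 + (M - c + 1) = M + 2 by omega]
      refine key (by omega) ?_ _
      rw [ht]
      refine Nat.Coprime.mul_right ?_ ?_
      · rw [Nat.coprime_two_right, Nat.odd_iff]; omega
      · rw [Nat.coprime_self_add_left, Nat.coprime_two_left, Nat.odd_iff]; omega

lemma cov_odd_drop {t M c j₀ : ℕ} [NeZero t] (ht : t = 2 * M + 1) (hcM : c + 1 ≤ M)
    (hj : j₀ = M - c - 1) :
    Cov (fun x y : ZMod t => (∃ i : ℕ, 1 ≤ i ∧ i ≤ c ∧ (y - x = i ∨ y - x = -i)) ∨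
        y - x = ((if (j₀ ≤ j₀ ↔ j₀ % 2 = 0) then c + 1 + j₀ else t - (c + 1 + j₀) : ℕ) : ZMod t))
      (2 * c + 1) := by
  refine cov_short_isUnit (by omega) ?_
  rw [show c + 1 + j₀ = M by omega]
  have : IsUnit ((M : ℕ) : ZMod t) := by
    rw [ZMod.isUnit_iff_coprime, ht]; simp
  split_ifs
  · exact this
  · exact isUnit_natCast_sub (by omega) this

/-- Appending a long cycle to a solution whose total length is even. -/
lemma Sol.append_of_even {m : List ℕ} (hm : Sol m) (h2 : ∀ x ∈ m, 2 ≤ x) (hs : 3 ≤ m.sum)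
    (heven : m.sum % 2 = 0) (h5 : 5 * m.countP (· % 2 = 1) ≤ m.sum + 2) {t : ℕ} [NeZero t]
    (ht : m.sum + m.countP (· % 2 = 1) < t - t % 2) : Sol (m ++ [t]) := by
  have hq2 := countP_odd_mod_two m
  have hq3 := three_mul_countP_odd_le m h2
  set q := m.countP (· % 2 = 1) with hq
  set c := (m.sum - 1) / 2 with hc
  set M := t / 2 with hM
  have hsc : m.sum - 1 = 2 * c + 1 := by omega
  rcases Nat.mod_two_eq_zero_or_one t with ht2 | ht2
  · obtain ⟨u, hu, hcov⟩ := exists_even_drop (t := t) (M := M) (c := c) (by omega) (by omega)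
      (by omega)
    obtain ⟨J, hJc, huJ, hJ⟩ := exists_erased_interval (h := q / 2) (j₀ := M - c - 1) (by omega) u
    rw [← hsc] at hcov
    refine hm.extend (P := fun d => (∃ i : ℕ, 1 ≤ i ∧ i ≤ c ∧ (d = i ∨ d = -i)) ∨
      d = ((if u % 2 = 0 then c + 1 + u else t - (c + 1 + u) : ℕ) : ZMod t)) hcov ?_
    have hR := Finset.card_insert_of_notMem huJ
    refine starterFor_even m h2 (c := c) (M := M) (h := q / 2) (L := t - 2 * c - 1) ht2 rfl
      (by omega) (by omega) (by omega) J (insert u J) (fun j hj => ?_) (fun j hj => (hJ j hj).1)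
      (fun j hj => (hJ j hj).2) (by omega) (by omega) (by omega) _
      (fun i h1 h2 => ⟨.inl ⟨i, h1, h2, .inl rfl⟩, .inl ⟨i, h1, h2, .inr rfl⟩⟩) (fun j hj h => ?_)
    · rcases Finset.mem_insert.1 hj with rfl | hj
      · omega
      · have := hJ j hj; omega
    · rw [(Finset.mem_insert.1 hj).resolve_right h]; exact .inr rfl
  · have hcov := cov_odd_drop (t := t) (M := M) (c := c) (by omega) (by omega) rfl
    obtain ⟨J, hJc, huJ, hJ⟩ := exists_erased_interval (h := q / 2) (j₀ := M - c - 1) (by omega)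
      (M - c - 1)
    rw [← hsc] at hcov
    set u := M - c - 1 with hu
    refine hm.extend (P := fun d => (∃ i : ℕ, 1 ≤ i ∧ i ≤ c ∧ (d = i ∨ d = -i)) ∨
      d = ((if (u ≤ u ↔ u % 2 = 0) then c + 1 + u else t - (c + 1 + u) : ℕ) : ZMod t)) hcov ?_
    have hR := Finset.card_insert_of_notMem huJ
    refine starterFor_odd m h2 (c := c) (M := M) (h := q / 2) (L := t - 2 * c - 1) ht2 rfl
      (by omega) (by omega) (by omega) J (insert u J) (fun j hj => ?_) (Finset.mem_insert_self _ _)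
      (fun j hj => (hJ j hj).1)
      (fun j hj => (hJ j hj).2) (by omega) (by omega) (by omega) _
      (fun i h1 h2 => ⟨.inl ⟨i, h1, h2, .inl rfl⟩, .inl ⟨i, h1, h2, .inr rfl⟩⟩) (fun j hj h => ?_)
    · rcases Finset.mem_insert.1 hj with rfl | hj
      · omega
      · have := hJ j hj; omega
    · rw [(Finset.mem_insert.1 hj).resolve_right h]; exact .inr rfl

lemma Sol.append_two (hm : Sol [2]) {t : ℕ} [NeZero t] (ht : 3 ≤ t) : Sol ([2] ++ [t]) := by
  rcases Nat.mod_two_eq_zero_or_one t with ht2 | ht2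
  · refine hm.extend ?_ (starterFor_two_even ht ht2)
    exact (cov_isUnit isUnit_neg_one).mono fun _ _ h => sub_eq_iff_eq_add'.1 h
  · refine hm.extend ?_ (starterFor_two_odd ht ht2)
    refine (cov_isUnit (u := ((t / 2 : ℕ) : ZMod t)) ?_).mono fun _ _ h => sub_eq_iff_eq_add'.1 h
    rw [ZMod.isUnit_iff_coprime]
    conv_rhs => rw [show t = 2 * (t / 2) + 1 by omega]
    simp

/-- Appending to a solution a cycle longer than the sum of the previous rounded lengths. -/
lemma Sol.append {m : List ℕ} (hm : Sol m) (h2 : ∀ x ∈ m, 2 ≤ x) (hne : m ≠ [])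
    (h5 : 5 * m.countP (· % 2 = 1) ≤ m.sum + 2) {t : ℕ}
    (ht : m.sum + m.countP (· % 2 = 1) < t - t % 2) : Sol (m ++ [t]) := by
  have : NeZero t := ⟨by omega⟩
  by_cases hs : 3 ≤ m.sum
  · rcases Nat.mod_two_eq_zero_or_one m.sum with h | h
    · exact hm.append_of_even h2 hs h h5 ht
    · exact hm.append_of_odd h2 hs h ht
  · match m, hne with
    | [a], _ =>
      have ha := h2 a (by simp)
      simp only [List.sum_singleton] at hs ht
      obtain rfl : a = 2 := by omega
      exact hm.append_two (by omega)
    | a :: b :: l, _ =>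
      have ha := h2 a (by simp)
      have hb := h2 b (by simp)
      simp only [List.sum_cons] at hs
      omega

section Walks

variable {V : Type*}

/-- `HasArc l x y` means that `x` is immediately followed by `y` in the walk `l`. -/
def HasArc : List V → V → V → Prop
  | a :: b :: l, x, y => (x = a ∧ y = b) ∨ HasArc (b :: l) x y
  | _, _, _ => False

instance HasArc.decidable [DecidableEq V] : ∀ (l : List V) (x y : V), Decidable (HasArc l x y)
  | [], _, _ => isFalse id
  | [_], _, _ => isFalse id
  | _ :: b :: l, x, y => @instDecidableOr _ _ _ (HasArc.decidable (b :: l) x y)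

/-- `CycArc l x y` means that `x` is followed by `y` in the cyclic list `l`. -/
def CycArc : List V → V → V → Prop
  | [], _, _ => False
  | z :: l, x, y => HasArc (z :: (l ++ [z])) x y

instance CycArc.decidable [DecidableEq V] : ∀ (l : List V) (x y : V), Decidable (CycArc l x y)
  | [], _, _ => isFalse id
  | z :: l, x, y => HasArc.decidable (z :: (l ++ [z])) x y

lemma hasArc_cons_cons {a b : V} {l : List V} {x y : V} :
    HasArc (a :: b :: l) x y ↔ (x = a ∧ y = b) ∨ HasArc (b :: l) x y := Iff.rfl

lemma hasArc_append {l₁ l₂ : List V} {c x y : V} :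
    HasArc (l₁ ++ c :: l₂) x y ↔ HasArc (l₁ ++ [c]) x y ∨ HasArc (c :: l₂) x y := by
  induction l₁ with
  | nil => simp [HasArc]
  | cons a l ih =>
    cases l with
    | nil => simp [HasArc]
    | cons b l =>
      simp only [List.cons_append, hasArc_cons_cons] at ih ⊢
      rw [ih, or_assoc]

lemma hasArc_map_range (f : ℕ → V) (n : ℕ) {i : ℕ} (hi : i < n) :
    HasArc ((List.range (n + 1)).map f) (f i) (f (i + 1)) := by
  induction n with
  | zero => omega
  | succ n ih =>
    rw [List.range_succ, List.map_append, List.range_succ, List.map_append, List.append_assoc]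
    simp only [List.map_cons, List.map_nil, List.cons_append, List.nil_append]
    rw [hasArc_append]
    rcases Nat.lt_succ_iff_lt_or_eq.1 hi with h | rfl
    · left
      have := ih h
      rwa [List.range_succ, List.map_append] at this
    · right; simp [HasArc]

lemma HasArc.append_right {l : List V} {x y : V} (h : HasArc l x y) (l' : List V) :
    HasArc (l ++ l') x y := by
  induction l with
  | nil => exact h.elim
  | cons a l ih =>
    cases l with
    | nil => exact h.elim
    | cons b l => exact h.imp_right ih

lemma HasArc.append_left {l : List V} {x y : V} (h : HasArc l x y) (l' : List V) :
    HasArc (l' ++ l) x y := by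
  cases l with
  | nil => exact h.elim
  | cons b l => exact hasArc_append.2 (.inr h)

lemma apply_of_hasArc {σ : V → V} {e : V} (l : List V) :
    ∀ z, (z :: l).map σ = l ++ [e] → ∀ x y, HasArc (z :: (l ++ [e])) x y → σ x = y := by
  induction l with
  | nil =>
    intro z h x y hxy
    simp only [List.map_cons, List.map_nil, List.nil_append, List.cons.injEq] at h
    simp only [List.nil_append, HasArc, or_false] at hxy
    rw [hxy.1, hxy.2, h.1]
  | cons a l ih =>
    intro z h x y hxy
    rw [List.map_cons, List.cons_append, List.cons.injEq] at h
    rw [List.cons_append, hasArc_cons_cons] at hxy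
    rcases hxy with ⟨rfl, rfl⟩ | hxy
    · exact h.1
    · exact ih a h.2 x y hxy

end Walks

/-- A solution of `OP*(n)` from cyclic lists that cover all vertices and together all arcs. -/
lemma sol_of_cycles {V ι : Type} [Fintype V] [Fintype ι] (C : ι → List V)
    (hC : ∀ i x, x ∈ C i) (hlen : ∀ i, (C i).length = Fintype.card V)
    (hι : Fintype.card ι + 1 = Fintype.card V)
    (hcov : ∀ x y : V, x ≠ y → ∃ i, CycArc (C i) x y) : Sol [Fintype.card V] := by
  classical
  have hnd : ∀ i, (C i).Nodup := fun i => by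
    rw [← Multiset.coe_nodup, ← Multiset.toFinset_card_eq_card_iff_nodup]
    have : (C i : Multiset V).toFinset = Finset.univ := by
      ext x; simpa using hC i x
    rw [this, Multiset.coe_card, hlen, Finset.card_univ]
  have hσ : ∀ i, ∃ σ : V → V, Realizes σ [C i] := fun i =>
    exists_realizes [C i] (by simpa using hnd i) (by simpa using hC i)
  choose σ hσ using hσ
  refine ⟨V, ι, inferInstance, inferInstance, σ, by simp, by simpa using hι,
    fun i => ⟨[C i], by simp [hlen], hσ i⟩, fun x y hxy => ?_⟩
  obtain ⟨i, hi⟩ := hcov x y hxy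
  refine ⟨i, ?_⟩
  have h := (hσ i).2.2 (C i) (by simp)
  revert hi h
  rcases C i with _ | ⟨z, l⟩
  · exact fun hi => hi.elim
  · intro hi h
    rw [List.rotate_cons_succ, List.rotate_zero] at h
    exact apply_of_hasArc l z h x y hi

lemma Cov.sol {V : Type} [Fintype V] {k : ℕ} (h : Cov (fun x y : V => x ≠ y) k)
    (hk : k + 1 = Fintype.card V) : Sol [Fintype.card V] := by
  obtain ⟨hs, h1, h2, h3⟩ := h
  refine ⟨V, Fin hs.length, inferInstance, inferInstance, hs.get, by simp, by simp [h1, hk],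
    fun i => ?_, fun x y hxy => ?_⟩
  · obtain ⟨B, b1, b2, b3⟩ := h2 _ (List.get_mem hs i)
    refine ⟨[B], ?_, by simpa using b1, by simpa using b2, by simpa using b3⟩
    classical
    have : B.toFinset = Finset.univ := by ext x; simpa using b2 x
    simp [← List.toFinset_card_of_nodup b1, this]
  · obtain ⟨f, hf, hfx⟩ := h3 x y hxy
    obtain ⟨i, rfl⟩ := List.get_of_mem hf
    exact ⟨i, hfx⟩

lemma sol_two : Sol [2] :=
  sol_of_cycles (V := Fin 2) (ι := Fin 1) (fun _ => [0, 1]) (by decide) (by decide) (by decide)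
    (by decide)

lemma sol_odd {n : ℕ} (hn : 3 ≤ n) (ho : n % 2 = 1) : Sol [n] := by
  have : NeZero n := ⟨by omega⟩
  have hcov := cov_short (t := n) (c := (n - 1) / 2) (by omega)
  have := Cov.sol (V := ZMod n) (k := 2 * ((n - 1) / 2)) (hcov.mono fun x y hxy => ?_)
    (by rw [ZMod.card]; omega)
  · rwa [ZMod.card] at this
  · have hd : y - x ≠ 0 := sub_ne_zero.2 hxy.symm
    have hlt := ZMod.val_lt (y - x)
    have hpos : 0 < (y - x).val := Nat.pos_of_ne_zero fun h => hd ((ZMod.val_eq_zero _).1 h)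
    have hcast := ZMod.natCast_zmod_val (y - x)
    by_cases h : (y - x).val ≤ (n - 1) / 2
    · exact ⟨_, hpos, h, .inl hcast.symm⟩
    · refine ⟨n - (y - x).val, by omega, by omega, .inr ?_⟩
      rw [Nat.cast_sub hlt.le, hcast]; simp

lemma sol_eight : Sol [8] :=
  sol_of_cycles (V := Fin 8) (ι := Fin 7)
    ![[0, 1, 4, 3, 7, 5, 2, 6], [0, 2, 7, 3, 6, 4, 5, 1], [0, 3, 2, 5, 4, 1, 6, 7],
      [0, 4, 6, 5, 3, 1, 7, 2], [0, 5, 6, 2, 4, 7, 1, 3], [0, 6, 1, 2, 3, 5, 7, 4],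
      [0, 7, 6, 3, 4, 2, 1, 5]]
    (by decide +kernel) (by decide +kernel) (by decide +kernel) (by decide +kernel)

lemma sol_ten : Sol [10] :=
  sol_of_cycles (V := Fin 10) (ι := Fin 9)
    ![[0, 1, 4, 3, 5, 9, 7, 8, 6, 2], [0, 2, 5, 8, 3, 7, 6, 1, 9, 4],
      [0, 3, 9, 2, 1, 8, 4, 7, 5, 6], [0, 4, 2, 8, 1, 3, 6, 9, 5, 7],
      [0, 5, 2, 9, 8, 7, 4, 6, 3, 1], [0, 6, 5, 4, 8, 9, 1, 2, 7, 3],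
      [0, 7, 1, 6, 8, 5, 3, 2, 4, 9], [0, 8, 2, 6, 7, 9, 3, 4, 1, 5],
      [0, 9, 6, 4, 5, 1, 7, 2, 3, 8]]
    (by decide +kernel) (by decide +kernel) (by decide +kernel) (by decide +kernel)

section Paths

variable {V : Type*}

lemma HasArc.cons {l : List V} {x y : V} (h : HasArc l x y) (c : V) : HasArc (c :: l) x y :=
  h.append_left [c]

lemma hasArc_map_range_exit (f : ℕ → V) (n : ℕ) (c : V) (l : List V) :
    HasArc ((List.range (n + 1)).map f ++ c :: l) (f n) c := by
  rw [List.range_succ, List.map_append, List.append_assoc]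
  exact HasArc.append_left (hasArc_cons_cons.2 (.inl ⟨rfl, rfl⟩)) _

lemma hasArc_map_range_enter (f : ℕ → V) (n : ℕ) (c : V) (l : List V) :
    HasArc (c :: ((List.range (n + 1)).map f ++ l)) c (f 0) := by
  rw [List.range_succ_eq_map]
  exact Or.inl ⟨rfl, rfl⟩

lemma cycArc_of_hasArc_append (f : ℕ → V) (n : ℕ) (l : List V) {x y : V}
    (h : HasArc ((List.range (n + 1)).map f ++ (l ++ [f 0])) x y) :
    CycArc ((List.range (n + 1)).map f ++ l) x y := by
  rw [List.range_succ_eq_map] at h ⊢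
  simpa [CycArc] using h

end Paths

section EvenCycle

variable {t : ℕ} {S : Type}

/-- The path `z, z + d, z + 2 * d, …` through all of `ZMod t`. -/
def stepPath (S : Type) (t : ℕ) (z d : ZMod t) : List (ZMod t ⊕ S) :=
  (List.range (t - 1 + 1)).map fun i : ℕ => Sum.inl (z + i * d)

lemma mem_stepPath [NeZero t] {z d e : ZMod t} (hed : e * d = 1) (u : ZMod t) :
    Sum.inl u ∈ stepPath S t z d := by
  have := ZMod.val_lt ((u - z) * e)
  refine List.mem_map.2 ⟨((u - z) * e).val, List.mem_range.2 (by omega), ?_⟩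
  rw [ZMod.natCast_zmod_val, mul_assoc, hed]; simp

lemma cycArc_stepPath [NeZero t] {z d e : ZMod t} (hed : e * d = 1) (l : List (ZMod t ⊕ S))
    {u v : ZMod t} (hu : u ≠ z - d) (hv : v = u + d) :
    CycArc (stepPath S t z d ++ l) (Sum.inl u) (Sum.inl v) := by
  have hlt := ZMod.val_lt ((u - z) * e)
  have hne : ((u - z) * e).val ≠ t - 1 := fun h => hu <| by
    have h1 := ZMod.natCast_zmod_val ((u - z) * e)
    rw [h, Nat.cast_sub (NeZero.one_le), ZMod.natCast_self, zero_sub, Nat.cast_one] at h1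
    linear_combination -d * h1 + (z - u) * hed
  have hcast := ZMod.natCast_zmod_val ((u - z) * e)
  have h := HasArc.append_right (hasArc_map_range
    (fun i : ℕ => (Sum.inl (z + i * d) : ZMod t ⊕ S)) (t - 1)
    (show ((u - z) * e).val < t - 1 by omega)) (l ++ [Sum.inl (z + (0 : ℕ) * d)])
  have e1 : z + (((u - z) * e).val : ZMod t) * d = u := by
    rw [hcast]; linear_combination (u - z) * hed
  have e2 : z + ((((u - z) * e).val + 1 : ℕ) : ZMod t) * d = v := by
    rw [Nat.cast_succ, hcast]; linear_combination (u - z) * hed - hv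
  simp only [e1, e2] at h
  exact cycArc_of_hasArc_append _ _ _ h

lemma cycArc_stepPath_tail [NeZero t] {z d w : ZMod t} (hw : w = z - d) (l : List (ZMod t ⊕ S))
    {x y : ZMod t ⊕ S} (h : HasArc (Sum.inl w :: (l ++ [Sum.inl z])) x y) :
    CycArc (stepPath S t z d ++ l) x y := by
  refine cycArc_of_hasArc_append _ _ _ ?_
  rw [List.range_succ, List.map_append, List.append_assoc]
  refine HasArc.append_left ?_ _
  have e : z + ((t - 1 : ℕ) : ZMod t) * d = w := by
    rw [Nat.cast_sub (NeZero.one_le), ZMod.natCast_self, hw]; push_cast; ring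
  simpa [e] using h

/-- The Hamiltonian cycles of a rotational family on `ZMod t` together with five fixed points. -/
def evenRow (t M a b : ℕ) (α β : ℕ → ZMod t) (g : ZMod t) : List (ZMod t ⊕ Fin 5) :=
  if g = 0 then
    (List.range (a + 1)).map (fun i => Sum.inl (α i + g)) ++ (Sum.inr 0 ::
    ((List.range (b + 1)).map (fun i => Sum.inl (β i + g)) ++
    [Sum.inr 1, Sum.inl (1 + g), Sum.inl g, Sum.inl (M + g), Sum.inl (M + 1 + g), Sum.inr 2,
      Sum.inr 4, Sum.inr 3]))
  else if g = 1 then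
    (List.range (a + 1)).map (fun i => Sum.inl (α i + g)) ++ (Sum.inr 0 :: Sum.inr 3 :: Sum.inr 4 ::
      Sum.inl (M + 1 + g) :: Sum.inr 2 :: Sum.inl g :: Sum.inl (M + g) ::
    ((List.range (b + 1)).map (fun i => Sum.inl (β i + g)) ++
    [Sum.inr 1, Sum.inl (1 + g)]))
  else
    (List.range (a + 1)).map (fun i => Sum.inl (α i + g)) ++ (Sum.inr 0 ::
    ((List.range (b + 1)).map (fun i => Sum.inl (β i + g)) ++
    [Sum.inr 1, Sum.inl (1 + g), Sum.inr 4, Sum.inl (M + 1 + g), Sum.inr 2, Sum.inl g,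
      Sum.inl (M + g), Sum.inr 3]))


variable {M a b : ℕ} {α β : ℕ → ZMod t}

lemma evenRow_arc_left (g : ZMod t) {i : ℕ} (hi : i < a) :
    CycArc (evenRow t M a b α β g) (Sum.inl (α i + g)) (Sum.inl (α (i + 1) + g)) := by
  have h := hasArc_map_range (fun i => (Sum.inl (α i + g) : ZMod t ⊕ Fin 5)) a hi
  unfold evenRow
  split_ifs <;> exact cycArc_of_hasArc_append _ _ _ (h.append_right _)

lemma evenRow_arc_right (g : ZMod t) {i : ℕ} (hi : i < b) :
    CycArc (evenRow t M a b α β g) (Sum.inl (β i + g)) (Sum.inl (β (i + 1) + g)) := by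
  have h := hasArc_map_range (fun i => (Sum.inl (β i + g) : ZMod t ⊕ Fin 5)) b hi
  unfold evenRow
  split_ifs <;> refine cycArc_of_hasArc_append _ _ _ (HasArc.append_left ?_ _) <;>
    simp only [List.cons_append, List.append_assoc]
  · exact (h.append_right _).cons _
  · exact (((((((h.append_right _).cons _).cons _).cons _).cons _).cons _).cons _).cons _
  · exact (h.append_right _).cons _

lemma evenRow_exit_left (g : ZMod t) :
    CycArc (evenRow t M a b α β g) (Sum.inl (α a + g)) (Sum.inr 0) := by
  have h := hasArc_map_range_exit (fun i => (Sum.inl (α i + g) : ZMod t ⊕ Fin 5)) a (Sum.inr 0)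
  unfold evenRow
  split_ifs <;> exact cycArc_of_hasArc_append _ _ _ (h _)

lemma evenRow_exit_right (g : ZMod t) :
    CycArc (evenRow t M a b α β g) (Sum.inl (β b + g)) (Sum.inr 1) := by
  have h := hasArc_map_range_exit (fun i => (Sum.inl (β i + g) : ZMod t ⊕ Fin 5)) b (Sum.inr 1)
  unfold evenRow
  split_ifs <;> refine cycArc_of_hasArc_append _ _ _ (HasArc.append_left ?_ _) <;>
    simp only [List.cons_append, List.append_assoc]
  · exact (h _).cons _
  · exact (((((((h _).cons _).cons _).cons _).cons _).cons _).cons _).cons _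
  · exact (h _).cons _

lemma evenRow_enter_right {g : ZMod t} (hg : g ≠ 1) :
    CycArc (evenRow t M a b α β g) (Sum.inr 0) (Sum.inl (β 0 + g)) := by
  have h := hasArc_map_range_enter (fun i => (Sum.inl (β i + g) : ZMod t ⊕ Fin 5)) b (Sum.inr 0)
  unfold evenRow
  split_ifs <;> refine cycArc_of_hasArc_append _ _ _ (HasArc.append_left ?_ _) <;>
    simp only [List.cons_append, List.append_assoc] <;> exact h _

lemma evenRow_tail_zero {x y : ZMod t ⊕ Fin 5}
    (h : HasArc [Sum.inr 1, Sum.inl 1, Sum.inl 0, Sum.inl (M : ZMod t), Sum.inl (M + 1 : ZMod t),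
      Sum.inr 2, Sum.inr 4, Sum.inr 3, Sum.inl (α 0)] x y) :
    CycArc (evenRow t M a b α β 0) x y := by
  rw [evenRow, if_pos rfl]
  refine cycArc_of_hasArc_append _ _ _ (HasArc.append_left ?_ _)
  simp only [List.cons_append, List.append_assoc]
  simpa using (HasArc.append_left h _).cons _

lemma evenRow_mid_one (ht : (1 : ZMod t) ≠ 0) {x y : ZMod t ⊕ Fin 5}
    (h : HasArc [Sum.inr 0, Sum.inr 3, Sum.inr 4, Sum.inl (M + 1 + 1 : ZMod t), Sum.inr 2,
      Sum.inl 1, Sum.inl (M + 1), Sum.inl (β 0 + 1)] x y) :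
    CycArc (evenRow t M a b α β 1) x y := by
  rw [evenRow, if_neg ht, if_pos rfl]
  refine cycArc_of_hasArc_append _ _ _ (HasArc.append_left ?_ _)
  rw [List.range_succ_eq_map (n := b)]
  simpa using h.append_right _

lemma evenRow_tail_one (ht : (1 : ZMod t) ≠ 0) {x y : ZMod t ⊕ Fin 5}
    (h : HasArc [Sum.inr 1, Sum.inl (1 + 1 : ZMod t), Sum.inl (α 0 + 1)] x y) :
    CycArc (evenRow t M a b α β 1) x y := by
  rw [evenRow, if_neg ht, if_pos rfl]
  refine cycArc_of_hasArc_append _ _ _ (HasArc.append_left ?_ _)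
  simp only [List.cons_append, List.append_assoc]
  simpa using (((((((HasArc.append_left h _).cons _).cons _).cons _).cons _).cons _).cons _).cons _

lemma evenRow_tail {g : ZMod t} (h0 : g ≠ 0) (h1 : g ≠ 1) {x y : ZMod t ⊕ Fin 5}
    (h : HasArc [Sum.inr 1, Sum.inl (1 + g), Sum.inr 4, Sum.inl (M + 1 + g : ZMod t), Sum.inr 2,
      Sum.inl g, Sum.inl (M + g), Sum.inr 3, Sum.inl (α 0 + g)] x y) :
    CycArc (evenRow t M a b α β g) x y := by
  rw [evenRow, if_neg h0, if_neg h1]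
  refine cycArc_of_hasArc_append _ _ _ (HasArc.append_left ?_ _)
  simp only [List.cons_append, List.append_assoc]
  simpa using (HasArc.append_left h _).cons _

lemma length_evenRow (g : ZMod t) (hab : a + b + 6 = t) :
    (evenRow t M a b α β g).length = t + 5 := by
  unfold evenRow
  split_ifs <;> simp <;> omega

lemma mem_evenRow (g : ZMod t) (hV : ∀ v : ZMod t, (v = 0 ∨ v = 1 ∨ v = M ∨ v = M + 1) ∨
      (∃ i ≤ a, α i = v) ∨ ∃ i ≤ b, β i = v) (x : ZMod t ⊕ Fin 5) :
    x ∈ evenRow t M a b α β g := by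
  rcases x with v | s
  · rcases hV (v - g) with h | ⟨i, hi, h⟩ | ⟨i, hi, h⟩
    · have h' : v = g ∨ v = 1 + g ∨ v = M + g ∨ v = M + 1 + g := by
        simpa only [sub_eq_iff_eq_add, zero_add] using h
      unfold evenRow
      rcases h' with rfl | rfl | rfl | rfl <;> split_ifs <;> simp
    · have hm : (Sum.inl v : ZMod t ⊕ Fin 5) ∈
          (List.range (a + 1)).map (fun i => Sum.inl (α i + g)) :=
        List.mem_map.2 ⟨i, List.mem_range.2 (by omega), by rw [h, sub_add_cancel]⟩
      unfold evenRow
      split_ifs <;> exact List.mem_append_left _ hm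
    · have hm : (Sum.inl v : ZMod t ⊕ Fin 5) ∈
          (List.range (b + 1)).map (fun i => Sum.inl (β i + g)) :=
        List.mem_map.2 ⟨i, List.mem_range.2 (by omega), by rw [h, sub_add_cancel]⟩
      unfold evenRow
      split_ifs <;> simp only [List.mem_append, List.mem_cons] <;> tauto
  · unfold evenRow
    fin_cases s <;> split_ifs <;> simp

end EvenCycle

/-- A Hamiltonian decomposition of the complete symmetric digraph on `t + 5` vertices from two
paths in `ZMod t`. -/
lemma sol_of_paths {t M a b : ℕ} (hM : 3 ≤ M) (ht : t = 2 * M + 1) (hab : a + b + 6 = t)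
    {α β : ℕ → ZMod t} (hα : α 0 = 2 * M) (hβ : β 0 = M + 2)
    (hV : ∀ v : ZMod t, (v = 0 ∨ v = 1 ∨ v = M ∨ v = M + 1) ∨
      (∃ i ≤ a, α i = v) ∨ ∃ i ≤ b, β i = v)
    (hD : ∀ d : ZMod t, d ≠ 0 → d ≠ 1 → d ≠ -1 → d ≠ 2 → d ≠ -2 → d ≠ M →
      (∃ i < a, α (i + 1) = α i + d) ∨ ∃ i < b, β (i + 1) = β i + d) : Sol [t + 5] := by
  have : NeZero t := ⟨by omega⟩
  have : Fact (1 < t) := ⟨by omega⟩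
  have h10 : (1 : ZMod t) ≠ 0 := one_ne_zero
  have hM0 : (2 * M + 1 : ZMod t) = 0 := by
    have := ZMod.natCast_self t
    rw [ht] at this ⊢
    exact_mod_cast this
  let A : Fin 4 → List (ZMod t ⊕ Fin 5) := ![
    stepPath _ t 0 (-1) ++ [Sum.inr 4, Sum.inr 1, Sum.inr 3, Sum.inr 0, Sum.inr 2],
    stepPath _ t (M + 1) 1 ++ [Sum.inr 3, Sum.inr 2, Sum.inr 1, Sum.inr 0, Sum.inr 4],
    stepPath _ t 0 (-2) ++ [Sum.inr 4, Sum.inr 0, Sum.inr 1, Sum.inr 2, Sum.inr 3],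
    stepPath _ t (M + 3) 2 ++ [Sum.inr 3, Sum.inr 1, Sum.inr 4, Sum.inr 2, Sum.inr 0]]
  have e0 : (-1 : ZMod t) * -1 = 1 := by ring
  have e1 : (1 : ZMod t) * 1 = 1 := by ring
  have e2 : (M : ZMod t) * -2 = 1 := by linear_combination -hM0
  have e3 : (-M : ZMod t) * 2 = 1 := by linear_combination -hM0
  have key : Sol [Fintype.card (ZMod t ⊕ Fin 5)] := by
    refine sol_of_cycles (ι := ZMod t ⊕ Fin 4) (Sum.elim (evenRow t M a b α β) A) ?_ ?_ ?_ ?_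
    · rintro (g | j) x
      · exact mem_evenRow g hV x
      · rcases x with u | s
        · fin_cases j
          · exact List.mem_append_left _ (mem_stepPath e0 u)
          · exact List.mem_append_left _ (mem_stepPath e1 u)
          · exact List.mem_append_left _ (mem_stepPath e2 u)
          · exact List.mem_append_left _ (mem_stepPath e3 u)
        · fin_cases j <;> fin_cases s <;> simp [A]
    · rintro (g | j)
      · simpa [ZMod.card] using length_evenRow g hab
      · fin_cases j <;> simp [A, stepPath, ZMod.card] <;> omega
    · simp [ZMod.card]
    · set P : ZMod t ⊕ Fin 5 → ZMod t ⊕ Fin 5 → Prop := fun x y =>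
        ∃ i, CycArc (Sum.elim (evenRow t M a b α β) A i) x y
      have row : ∀ g x y, CycArc (evenRow t M a b α β g) x y → P x y :=
        fun g _ _ h => ⟨Sum.inl g, h⟩
      have col : ∀ j x y, CycArc (A j) x y → P x y := fun j _ _ h => ⟨Sum.inr j, h⟩
      have col0 : ∀ x y, HasArc [Sum.inl 1, Sum.inr 4, Sum.inr 1, Sum.inr 3, Sum.inr 0,
          Sum.inr 2, Sum.inl 0] x y → P x y := fun x y h =>
        col 0 x y (cycArc_stepPath_tail (by ring) _ h)
      have col1 : ∀ x y, HasArc [Sum.inl (M : ZMod t), Sum.inr 3, Sum.inr 2, Sum.inr 1,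
          Sum.inr 0, Sum.inr 4, Sum.inl (M + 1 : ZMod t)] x y → P x y := fun x y h =>
        col 1 x y (cycArc_stepPath_tail (by ring) _ h)
      have col2 : ∀ x y, HasArc [Sum.inl 2, Sum.inr 4, Sum.inr 0, Sum.inr 1, Sum.inr 2,
          Sum.inr 3, Sum.inl 0] x y → P x y := fun x y h =>
        col 2 x y (cycArc_stepPath_tail (by ring) _ h)
      have col3 : ∀ x y, HasArc [Sum.inl (M + 1 : ZMod t), Sum.inr 3, Sum.inr 1, Sum.inr 4,
          Sum.inr 2, Sum.inr 0, Sum.inl (M + 3 : ZMod t)] x y → P x y := fun x y h =>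
        col 3 x y (cycArc_stepPath_tail (by ring) _ h)
      have tail0 := fun x y h => row 0 x y (evenRow_tail_zero h)
      have mid1 := fun x y h => row 1 x y (evenRow_mid_one h10 h)
      have tail1 := fun x y h => row 1 x y (evenRow_tail_one h10 h)
      change ∀ x y, x ≠ y → P x y
      rintro (u | p) (v | q) hne
      · obtain ⟨d, rfl⟩ : ∃ d, v = u + d := ⟨v - u, by ring⟩
        by_cases h0 : d = 0
        · exact absurd (by rw [h0, add_zero]) hne
        by_cases h1 : d = -1
        · by_cases hu : u = 1
          · exact tail0 _ _ (by rw [h1, hu]; simp [HasArc])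
          · exact col 0 _ _ (cycArc_stepPath e0 _ (by simpa using hu) (by rw [h1]))
        by_cases h1' : d = 1
        · by_cases hu : u = M
          · exact tail0 _ _ (by rw [h1', hu]; simp [HasArc])
          · exact col 1 _ _ (cycArc_stepPath e1 _ (by simpa using hu) (by rw [h1']))
        by_cases h2 : d = -2
        · by_cases hu : u = 2
          · have : α 0 + 1 = 0 := by rw [hα, hM0]
            exact tail1 _ _ (by rw [h2, hu, this, one_add_one_eq_two]; simp [HasArc])
          · exact col 2 _ _ (cycArc_stepPath e2 _ (by simpa using hu) (by rw [h2]))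
        by_cases h2' : d = 2
        · by_cases hu : u = M + 1
          · have : (M + 1 + 2 : ZMod t) = β 0 + 1 := by rw [hβ]; ring
            exact mid1 _ _ (by rw [h2', hu, this]; simp [HasArc])
          · exact col 3 _ _ (cycArc_stepPath e3 _ (fun h => hu (by rw [h]; ring)) (by rw [h2']))
        by_cases hdM : d = M
        · by_cases hu : u = 0
          · exact tail0 _ _ (by rw [hdM, hu]; simp [HasArc])
          by_cases hu1 : u = 1
          · exact mid1 _ _ (by rw [hdM, hu1, add_comm 1]; simp [HasArc])
          · exact row u _ _ (evenRow_tail hu hu1 (by rw [hdM, add_comm u]; simp [HasArc]))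
        rcases hD d h0 h1' h1 h2' h2 hdM with ⟨i, hi, h⟩ | ⟨i, hi, h⟩
        · have := evenRow_arc_left (M := M) (b := b) (α := α) (β := β) (u - α i) hi
          rw [h] at this
          ring_nf at this
          exact row _ _ _ (by simpa [add_comm] using this)
        · have := evenRow_arc_right (M := M) (a := a) (α := α) (β := β) (u - β i) hi
          rw [h] at this
          ring_nf at this
          exact row _ _ _ (by simpa [add_comm] using this)
      · fin_cases q
        · simpa using row (u - α a) _ _ (evenRow_exit_left (u - α a))
        · simpa using row (u - β b) _ _ (evenRow_exit_right (u - β b))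
        · obtain ⟨g, rfl⟩ : ∃ g, u = M + 1 + g := ⟨u - (M + 1 + 0), by ring⟩
          by_cases h0 : g = 0
          · exact tail0 _ _ (by rw [h0]; simp [HasArc])
          by_cases h1 : g = 1
          · exact mid1 _ _ (by rw [h1]; simp [HasArc])
          · exact row g _ _ (evenRow_tail h0 h1 (by simp [HasArc]))
        · obtain ⟨g, rfl⟩ : ∃ g, u = M + g := ⟨u - (M + 0), by ring⟩
          by_cases h0 : g = 0
          · exact col1 _ _ (by rw [h0]; simp [HasArc])
          by_cases h1 : g = 1
          · exact col3 _ _ (by rw [h1]; simp [HasArc])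
          · exact row g _ _ (evenRow_tail h0 h1 (by simp [HasArc]))
        · obtain ⟨g, rfl⟩ : ∃ g, u = 1 + g := ⟨u - (1 + 0), by ring⟩
          by_cases h0 : g = 0
          · exact col0 _ _ (by rw [h0]; simp [HasArc])
          by_cases h1 : g = 1
          · have := one_add_one_eq_two (R := ZMod t)
            exact col2 _ _ (by rw [h1, this]; simp [HasArc])
          · exact row g _ _ (evenRow_tail h0 h1 (by simp [HasArc]))
      · fin_cases p
        · by_cases h1 : v = M + 3
          · exact col3 _ _ (by rw [h1]; simp [HasArc])
          · simpa using row (v - β 0) _ _ (evenRow_enter_right fun h => h1 (by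
              rw [sub_eq_iff_eq_add.1 h, hβ]; ring))
        · obtain ⟨g, rfl⟩ : ∃ g, v = 1 + g := ⟨v - (1 + 0), by ring⟩
          by_cases h0 : g = 0
          · exact tail0 _ _ (by rw [h0]; simp [HasArc])
          by_cases h1 : g = 1
          · exact tail1 _ _ (by rw [h1]; simp [HasArc])
          · exact row g _ _ (evenRow_tail h0 h1 (by simp [HasArc]))
        · by_cases h0 : v = 0
          · exact col0 _ _ (by rw [h0]; simp [HasArc])
          by_cases h1 : v = 1
          · exact mid1 _ _ (by rw [h1]; simp [HasArc])
          · exact row v _ _ (evenRow_tail h0 h1 (by simp [HasArc]))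
        · obtain ⟨g, rfl⟩ : ∃ g, v = α 0 + g := ⟨v - (α 0 + 0), by ring⟩
          by_cases h0 : g = 0
          · exact tail0 _ _ (by rw [h0]; simp [HasArc])
          by_cases h1 : g = 1
          · have : α 0 + 1 = 0 := by rw [hα, hM0]
            exact col2 _ _ (by rw [h1, this]; simp [HasArc])
          · exact row g _ _ (evenRow_tail h0 h1 (by simp [HasArc]))
        · obtain ⟨g, rfl⟩ : ∃ g, v = M + 1 + g := ⟨v - (M + 1 + 0), by ring⟩
          by_cases h0 : g = 0
          · exact col1 _ _ (by rw [h0]; simp [HasArc])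
          by_cases h1 : g = 1
          · exact mid1 _ _ (by rw [h1]; simp [HasArc])
          · exact row g _ _ (evenRow_tail h0 h1 (by simp [HasArc]))
      · clear_value P
        fin_cases p <;> fin_cases q <;> first
          | exact absurd rfl hne
          | (refine tail0 _ _ ?_; simp [HasArc]; done)
          | (refine mid1 _ _ ?_; simp [HasArc]; done)
          | (refine col0 _ _ ?_; simp [HasArc]; done)
          | (refine col1 _ _ ?_; simp [HasArc]; done)
          | (refine col2 _ _ ?_; simp [HasArc]; done)
          | (refine col3 _ _ ?_; simp [HasArc])
  simpa [ZMod.card] using key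

lemma exists_zigzag_eq {t M : ℕ} (ht : t = 2 * M + 1) (hM : 3 ≤ M) {w : ℕ} (hw : w < t) :
    (w = 0 ∨ w = 1 ∨ w = M ∨ w = M + 1) ∨ ∃ i ≤ 2 * M - 4, zigzag t 2 i = w := by
  by_cases h : w = 0 ∨ w = 1 ∨ w = M ∨ w = M + 1
  · exact .inl h
  · right
    by_cases hw2 : M + 2 ≤ w
    · exact ⟨2 * (t - 1 - w), by omega, by rw [zigzag, if_pos (by omega)]; omega⟩
    · exact ⟨2 * (w - 2) + 1, by omega, by rw [zigzag, if_neg (by omega)]; omega⟩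

lemma exists_zigzag_cast_eq {t M : ℕ} (ht : t = 2 * M + 1) (hM : 3 ≤ M) (v : ZMod t) :
    (v = 0 ∨ v = 1 ∨ v = M ∨ v = M + 1) ∨ ∃ i ≤ 2 * M - 4, (zigzag t 2 i : ZMod t) = v := by
  have : NeZero t := ⟨by omega⟩
  rw [← ZMod.natCast_zmod_val v]
  rcases exists_zigzag_eq ht hM (ZMod.val_lt v) with (h | h | h | h) | ⟨i, hi, h⟩
  · simp [h]
  · simp [h]
  · simp [h]
  · simp [h]
  · exact .inr ⟨i, hi, by rw [h]⟩

/-- The steps of the zigzag path, with the middle one removed and the second half reversed, have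
all differences except `0`, `±1`, `±2` and one of the two elements closest to `t / 2`. -/
lemma exists_zigzag_step {t M : ℕ} (ht : t = 2 * M + 1) (hM : 3 ≤ M) (d : ZMod t) (h0 : d ≠ 0)
    (h1 : d ≠ 1) (h1' : d ≠ -1) (h2 : d ≠ 2) (h2' : d ≠ -2)
    (hd : d ≠ if M % 2 = 0 then -(M : ZMod t) else M) :
    (∃ j < M - 3, (zigzag t 2 (j + 1) : ZMod t) = zigzag t 2 j + d) ∨
      ∃ j, M - 3 < j ∧ j < 2 * M - 4 ∧ (zigzag t 2 j : ZMod t) = zigzag t 2 (j + 1) + d := by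
  have : NeZero t := ⟨by omega⟩
  have hlt := ZMod.val_lt d
  have hcast := ZMod.natCast_zmod_val d
  set δ := d.val
  have hneg : ∀ k ≤ t, δ = t - k → d = -k := fun k hk h => by
    rw [← hcast, h, Nat.cast_sub hk, ZMod.natCast_self, zero_sub]
  have k0 : δ ≠ 0 := fun h => h0 (by rw [← hcast, h]; simp)
  have k1 : δ ≠ 1 := fun h => h1 (by rw [← hcast, h]; simp)
  have k2 : δ ≠ 2 := fun h => h2 (by rw [← hcast, h]; simp)
  have k1' : δ ≠ t - 1 := fun h => h1' (by simpa using hneg 1 (by omega) h)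
  have k2' : δ ≠ t - 2 := fun h => h2' (by simpa using hneg 2 (by omega) h)
  have kM : δ ≠ if M % 2 = 0 then M + 1 else M := fun h => hd <| by
    split_ifs at h ⊢
    · exact hneg M (by omega) (by omega)
    · rw [← hcast, h]
  have conv : ∀ {z w k : ℕ}, (z + k) % t = w → k = δ → (w : ZMod t) = z + d := by
    rintro z w k rfl rfl
    rw [ZMod.natCast_mod, Nat.cast_add, hcast]
  by_cases hp : (δ - 3) % 2 = 0
  · by_cases hj : δ - 3 < M - 3
    · exact .inl ⟨δ - 3, hj, conv ((zigzag_step (L := 2 * M - 4) (by omega) (by omega)).1 hp)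
        (by omega)⟩
    · refine .inl ⟨t - 3 - δ, ?_, conv ((zigzag_step (L := 2 * M - 4) (by omega) (by omega)).2.1
        (by omega)) (by omega)⟩
      split_ifs at kM <;> omega
  · by_cases hj : M - 3 < δ - 3
    · exact .inr ⟨δ - 3, hj, by omega,
        conv ((zigzag_step (L := 2 * M - 4) (by omega) (by omega)).2.2.1 hp) (by omega)⟩
    · exact .inr ⟨t - 3 - δ, by omega, by omega,
        conv ((zigzag_step (L := 2 * M - 4) (by omega) (by omega)).2.2.2 (by omega)) (by omega)⟩

lemma sol_even {n : ℕ} (hn : 12 ≤ n) (he : n % 2 = 0) : Sol [n] := by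
  obtain ⟨M, rfl⟩ : ∃ M, n = 2 * M + 1 + 5 := ⟨(n - 6) / 2, by omega⟩
  have hM : 3 ≤ M := by omega
  obtain ⟨t, ht⟩ : ∃ t, t = 2 * M + 1 := ⟨_, rfl⟩
  rw [← ht]
  have hM0 : (2 * M + 1 : ZMod t) = 0 := by
    have := ZMod.natCast_self t
    rw [ht] at this ⊢
    exact_mod_cast this
  have hz0 : (zigzag t 2 0 : ZMod t) = 2 * M := by
    rw [zigzag, if_pos rfl, show t - 1 - 0 / 2 = 2 * M by omega]; push_cast; ring
  have hzL : (zigzag t 2 (2 * M - 4) : ZMod t) = M + 2 := by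
    rw [zigzag, if_pos (by omega), show t - 1 - (2 * M - 4) / 2 = M + 2 by omega]; push_cast; ring
  by_cases hp : M % 2 = 0
  · refine sol_of_paths hM ht (a := M - 2) (b := M - 3) (by omega)
      (α := fun i => M + 1 - zigzag t 2 (2 * M - 4 - i)) (β := fun i => M + 1 - zigzag t 2 i)
      ?_ ?_ ?_ ?_
    · simp only [Nat.sub_zero, hzL]; linear_combination -hM0
    · simp only [hz0]; linear_combination -hM0
    · intro v
      rcases exists_zigzag_cast_eq ht hM (M + 1 - v) with h | ⟨i, hi, h⟩
      · left
        rcases h with h | h | h | h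
        · exact .inr (.inr (.inr (by linear_combination -h)))
        · exact .inr (.inr (.inl (by linear_combination -h)))
        · exact .inr (.inl (by linear_combination -h))
        · exact .inl (by linear_combination -h)
      · right
        by_cases hi' : i ≤ M - 3
        · exact .inr ⟨i, hi', by simp only [h]; ring⟩
        · refine .inl ⟨2 * M - 4 - i, by omega, ?_⟩
          simp only [show 2 * M - 4 - (2 * M - 4 - i) = i by omega, h]; ring
    · intro d h0 h1 h1' h2 h2' hd
      rcases exists_zigzag_step ht hM (-d) (by simpa using h0) (fun h => h1' (by rw [← h, neg_neg]))
        (fun h => h1 (by simpa using h)) (fun h => h2' (by rw [← h, neg_neg]))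
        (fun h => h2 (by simpa using h)) (by simpa [hp] using hd) with ⟨j, hj, h⟩ | ⟨j, hj, hj2, h⟩
      · exact .inr ⟨j, hj, by simp only [h]; ring⟩
      · refine .inl ⟨2 * M - 4 - (j + 1), by omega, ?_⟩
        simp only [show 2 * M - 4 - (2 * M - 4 - (j + 1) + 1) = j by omega,
          show 2 * M - 4 - (2 * M - 4 - (j + 1)) = j + 1 by omega, h]
        ring
  · refine sol_of_paths hM ht (a := M - 3) (b := M - 2) (by omega)
      (α := fun i => zigzag t 2 i) (β := fun i => zigzag t 2 (2 * M - 4 - i)) hz0 hzL ?_ ?_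
    · intro v
      refine (exists_zigzag_cast_eq ht hM v).imp_right ?_
      rintro ⟨i, hi, h⟩
      by_cases hi' : i ≤ M - 3
      · exact .inl ⟨i, hi', h⟩
      · refine .inr ⟨2 * M - 4 - i, by omega, ?_⟩
        simp only [show 2 * M - 4 - (2 * M - 4 - i) = i by omega, h]
    · intro d h0 h1 h1' h2 h2' hd
      rcases exists_zigzag_step ht hM d h0 h1 h1' h2 h2' (by rwa [if_neg hp])
        with ⟨j, hj, h⟩ | ⟨j, hj, hj2, h⟩
      · exact .inl ⟨j, hj, h⟩
      · refine .inr ⟨2 * M - 4 - (j + 1), by omega, ?_⟩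
        simp only [show 2 * M - 4 - (2 * M - 4 - (j + 1) + 1) = j by omega,
          show 2 * M - 4 - (2 * M - 4 - (j + 1)) = j + 1 by omega, h]

lemma sol_singleton {n : ℕ} (h2 : 2 ≤ n) (h4 : n ≠ 4) (h6 : n ≠ 6) : Sol [n] := by
  by_cases ho : n % 2 = 1
  · exact sol_odd (by omega) ho
  · by_cases hn : 12 ≤ n
    · exact sol_even hn (by omega)
    · obtain rfl | rfl | rfl : n = 2 ∨ n = 8 ∨ n = 10 := by omega
      exacts [sol_two, sol_eight, sol_ten]

lemma sum_map_add_deltaOdd (m : List ℕ) :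
    (m.map (fun x => x + deltaOdd x)).sum = m.sum + m.countP (· % 2 = 1) := by
  induction m with
  | nil => rfl
  | cons a m ih =>
    rw [List.map_cons, List.sum_cons, ih, List.sum_cons, List.countP_cons, deltaOdd]
    by_cases h : a % 2 = 1
    · simp [h]; omega
    · simp [h]; omega

/-- Solutions for lists in which every entry dominates the preceding ones. -/
lemma sol_of_dominating (m : List ℕ) (hne : m ≠ []) (h2 : ∀ x ∈ m, 2 ≤ x)
    (hm1 : m.headI ≠ 4 ∧ m.headI ≠ 6)
    (hdom : ∀ ℓ, 1 ≤ ℓ → ℓ < m.length →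
      ((m.take ℓ).map (fun x => x + deltaOdd x)).sum < m.getD ℓ 0 - deltaOdd (m.getD ℓ 0)) :
    Sol m ∧ 5 * m.countP (· % 2 = 1) ≤ m.sum + 2 := by
  induction m using List.reverseRecOn with
  | nil => exact absurd rfl hne
  | append_singleton m x ih =>
    rcases m with _ | ⟨y, m⟩
    · refine ⟨sol_singleton (h2 x (by simp)) hm1.1 hm1.2, ?_⟩
      have := h2 x (by simp)
      by_cases h : x % 2 = 1
      · simp [h]; omega
      · simp [h]
    · have h2' : ∀ z ∈ y :: m, 2 ≤ z := fun z hz => h2 z (List.mem_append_left _ hz)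
      obtain ⟨hs, h5⟩ := ih (by simp) h2' hm1 fun ℓ h1 hl => by
        have := hdom ℓ h1 (by rw [List.length_append]; omega)
        rwa [List.take_append_of_le_length hl.le, List.getD_append _ _ _ _ hl] at this
      have hx := hdom (y :: m).length (by simp) (by simp)
      rw [List.take_left, sum_map_add_deltaOdd, List.getD_append_right _ _ _ _ le_rfl,
        Nat.sub_self, List.getD_cons_zero, deltaOdd] at hx
      refine ⟨hs.append h2' (by simp) h5 hx, ?_⟩
      have h3 := three_mul_countP_odd_le _ h2'
      have h4 := countP_odd_mod_two (y :: m)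
      rw [List.countP_append, List.sum_append, List.countP_singleton, List.sum_singleton]
      by_cases h : x % 2 = 1
      · simp only [h, decide_true, if_true]; omega
      · simp only [h, decide_false, Bool.false_eq_true, if_false]; omega

/-- Corollary: if each mᵢ ≥ 2, m₁ ∉ {4,6}, and for every ℓ < k we have
m_{ℓ+1} − δ(m_{ℓ+1}) > Σ_{i=1}^{ℓ} (m_i + δ(m_i)), then OP*(m₁,…,m_k) has a solution.
Here the list `m` is 0-indexed, so `m.getD ℓ 0` is m_{ℓ+1}. -/
theorem stmt7 (m : List ℕ) (hne : m ≠ [])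
    (h2 : ∀ x ∈ m, 2 ≤ x)
    (hm1 : m.headI ≠ 4 ∧ m.headI ≠ 6)
    (hdom : ∀ ℓ, 1 ≤ ℓ → ℓ < m.length →
      ((m.take ℓ).map (fun x => x + deltaOdd x)).sum <
        m.getD ℓ 0 - deltaOdd (m.getD ℓ 0)) :
    HasOPSolution m := by
  exact (sol_of_dominating m hne h2 hm1 hdom).1.hasOPSolution h2
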